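/- Without any smoothness assumption on S: there exists a nonempty Zariski open subset O of ℂ^{(n−p)×n} such that for every a ∈ O (all submatrices a^{(i)} having maximal rank n−p−i+1) and every 1 ≤ i ≤ n−p, the generic polar varieties W_{K(\underline{a^{(i)}})}(S) and W_{\bar K(\bar{a^{(i)}})}(S) are empty or subvarieties of S of pure codimension i that are normal and Cohen–Macaulay at every point where J(F_1, …, F_p) has maximal rank p. -/

import Mathlib

open MvPolynomial

noncomputable section

/-- The Zariski closure of a subset of the affine space `σ → ℂ`. -/
def zcl {σ : Type} (T : Set (σ → ℂ)) : Set (σ → ℂ) :=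
  MvPolynomial.zeroLocus ℂ (MvPolynomial.vanishingIdeal ℂ T)

/-- Zariski open subsets of the affine space `σ → ℂ`. -/
def ZOpen {σ : Type} (U : Set (σ → ℂ)) : Prop :=
  ∃ I : Ideal (MvPolynomial σ ℂ), U = {x | ∃ f ∈ I, MvPolynomial.eval x f ≠ 0}

/-- Zariski open subsets of the space of `m × n` complex matrices. -/
def ZOpenMat {m n : ℕ} (U : Set (Matrix (Fin m) (Fin n) ℂ)) : Prop :=
  ∃ I : Ideal (MvPolynomial (Fin m × Fin n) ℂ),
    U = {a | ∃ f ∈ I, MvPolynomial.eval (fun q => a q.1 q.2) f ≠ 0}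

/-- `T` is of pure dimension `d`: every irreducible component of (the Zariski closure of) `T`,
i.e. every minimal prime over its vanishing ideal, has coordinate ring of Krull dimension `d`. -/
def IsPureDim {σ : Type} (T : Set (σ → ℂ)) (d : ℕ) : Prop :=
  ∀ P ∈ (MvPolynomial.vanishingIdeal ℂ T).minimalPrimes,
    ringKrullDim (MvPolynomial σ ℂ ⧸ P) = (d : WithBot (WithTop ℕ))

/-- The Zariski tangent space at a point `x` of (the Zariski closure of) a subset `T`
of affine space: the common kernel of the differentials at `x` of all polynomials
vanishing on `T`. -/
def tangentAt {σ : Type} [Fintype σ] [DecidableEq σ] (T : Set (σ → ℂ)) (x : σ → ℂ) :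
    Submodule ℂ (σ → ℂ) :=
  ⨅ (f : MvPolynomial σ ℂ) (_ : f ∈ MvPolynomial.vanishingIdeal ℂ T),
    LinearMap.ker
      (∑ l, MvPolynomial.eval x (MvPolynomial.pderiv l f) •
        (LinearMap.proj l : (σ → ℂ) →ₗ[ℂ] ℂ))

/-- `rs` is a regular sequence in the commutative ring `R`. -/
def IsRegSeq {R : Type*} [CommRing R] (rs : List R) : Prop :=
  Ideal.span {x | x ∈ rs} ≠ ⊤ ∧
  ∀ j, j < rs.length → ∀ b : R,
    rs.getD j 0 * b ∈ Ideal.span {x | x ∈ rs.take j} →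
    b ∈ Ideal.span {x | x ∈ rs.take j}

/-- The common zero set in `ℂⁿ` of polynomials `F₁, …, F_p ∈ ℚ[X₁, …, Xₙ]`. -/
def zeroSetC {n p : ℕ} (F : Fin p → MvPolynomial (Fin n) ℚ) : Set (Fin n → ℂ) :=
  {x | ∀ k, MvPolynomial.aeval x (F k) = 0}

/-- The Jacobian matrix `[∂F_k/∂X_l]` evaluated at `x ∈ ℂⁿ`. -/
def jacC {n p : ℕ} (F : Fin p → MvPolynomial (Fin n) ℚ) (x : Fin n → ℂ) :
    Matrix (Fin p) (Fin n) ℂ :=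
  Matrix.of fun k l => MvPolynomial.aeval x (MvPolynomial.pderiv l (F k))

/-- The set of regular points of `S = {F₁ = 0, …, F_p = 0}`: points of `S` where the
Jacobian has maximal rank `p`. -/
def SregC {n p : ℕ} (F : Fin p → MvPolynomial (Fin n) ℚ) : Set (Fin n → ℂ) :=
  {x | x ∈ zeroSetC F ∧ (jacC F x).rank = p}

/-- The classic polar variety: the Zariski closure of the locus of regular points of `S`
where the matrix obtained by appending the rows of `a` to the Jacobian has rank at
most `r` (i.e. where all `(r+1)`-minors vanish). -/
def Wclassic {n p m : ℕ} (F : Fin p → MvPolynomial (Fin n) ℚ)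
    (a : Matrix (Fin m) (Fin n) ℂ) (r : ℕ) : Set (Fin n → ℂ) :=
  zcl {x | x ∈ SregC F ∧ (Matrix.fromRows (jacC F x) a).rank ≤ r}

/-- The dual polar variety: as `Wclassic`, with appended rows `(a_{k,1} - X₁, …, a_{k,n} - Xₙ)`. -/
def Wdual {n p m : ℕ} (F : Fin p → MvPolynomial (Fin n) ℚ)
    (a : Matrix (Fin m) (Fin n) ℂ) (r : ℕ) : Set (Fin n → ℂ) :=
  zcl {x | x ∈ SregC F ∧
    (Matrix.fromRows (jacC F x) (Matrix.of fun k l => a k l - x l)).rank ≤ r}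

/-- `F₁, …, F_p` generate the full vanishing ideal of their zero set (over `ℂ`);
this encodes that `(F₁, …, F_p)` is reduced (radical) and the ideal of definition of `S`. -/
def idealOfDef {n p : ℕ} (F : Fin p → MvPolynomial (Fin n) ℚ) : Prop :=
  MvPolynomial.vanishingIdeal ℂ (zeroSetC F) =
    Ideal.span (Set.range fun k => MvPolynomial.map (algebraMap ℚ ℂ) (F k))

/-- The submatrix of the first `m` rows of a matrix. -/
def firstRows {N n' m : ℕ} (a : Matrix (Fin N) (Fin n') ℂ) (h : m ≤ N) :
    Matrix (Fin m) (Fin n') ℂ :=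
  Matrix.of fun k l => a (Fin.castLE h k) l

/-- The matrix obtained by deleting row `h`. -/
def rowErase {m n' : ℕ} (a : Matrix (Fin (m + 1)) (Fin n') ℂ) (h : Fin (m + 1)) :
    Matrix (Fin m) (Fin n') ℂ :=
  Matrix.of fun k l => a (h.succAbove k) l

/-- The real trace `S_ℝ := S ∩ ℝⁿ`, as a subset of Euclidean space. -/
def SR {n p : ℕ} (F : Fin p → MvPolynomial (Fin n) ℚ) : Set (EuclideanSpace ℝ (Fin n)) :=
  {x | (fun j => (x j : ℂ)) ∈ zeroSetC F}

/-- `C` is a connected component of `T`. -/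
def IsConnCompOf {α : Type*} [TopologicalSpace α] (C T : Set α) : Prop :=
  C.Nonempty ∧ C ⊆ T ∧ IsPreconnected C ∧
    ∀ D, C ⊆ D → D ⊆ T → IsPreconnected D → D = C

end

/-- A (Noetherian) local ring is Cohen–Macaulay iff it admits a regular sequence of
nonunits whose length equals its Krull dimension. -/
def IsCMLocalRing (R : Type) [CommRing R] : Prop :=
  ∃ rs : List R, (∀ r ∈ rs, ¬IsUnit r) ∧ IsRegSeq rs ∧
    (rs.length : WithBot (WithTop ℕ)) = ringKrullDim R

/-- The maximal ideal of the coordinate ring of (the closure of) `T` corresponding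
to the point `x`. -/
noncomputable def ptIdeal {σ : Type} (T : Set (σ → ℂ)) (x : σ → ℂ) :
    Ideal (MvPolynomial σ ℂ ⧸ MvPolynomial.vanishingIdeal ℂ T) :=
  Ideal.map (Ideal.Quotient.mk (MvPolynomial.vanishingIdeal ℂ T))
    (MvPolynomial.vanishingIdeal ℂ {x})

/-- The variety (closure of) `T` is normal at the point `x`: its local ring at `x` is a
normal domain (an integrally closed domain). -/
def NormalAt {σ : Type} (T : Set (σ → ℂ)) (x : σ → ℂ) : Prop :=
  ∃ _hp : (ptIdeal T x).IsPrime,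
    IsDomain (Localization.AtPrime (ptIdeal T x)) ∧
    IsIntegrallyClosed (Localization.AtPrime (ptIdeal T x))

/-- The variety (closure of) `T` is Cohen–Macaulay at the point `x`: its local ring at
`x` is a Cohen–Macaulay local ring. -/
def CMAt {σ : Type} (T : Set (σ → ℂ)) (x : σ → ℂ) : Prop :=
  ∃ _hp : (ptIdeal T x).IsPrime, IsCMLocalRing (Localization.AtPrime (ptIdeal T x))

set_option linter.unusedSectionVars false

section MaxMinors

variable {R S : Type*} [CommRing R] [CommRing S]
variable {ι κ ρ : Type*} [Fintype ι] [Fintype κ] [Fintype ρ] [DecidableEq ι] [DecidableEq κ]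
  [DecidableEq ρ]

/-- The ideal generated by the maximal (row-size) minors of a matrix. -/
def maxMinors (M : Matrix ι κ R) : Ideal R :=
  Ideal.span (Set.range fun C : Matrix κ ι R => (M * C).det)

theorem det_mul_mem_maxMinors (M : Matrix ι κ R) (C : Matrix κ ι R) :
    (M * C).det ∈ maxMinors M :=
  Ideal.subset_span ⟨C, rfl⟩

theorem maxMinors_mul_left_le (G : Matrix ι ι R) (M : Matrix ι κ R) :
    maxMinors (G * M) ≤ maxMinors M := by
  refine Ideal.span_le.2 ?_
  rintro _ ⟨C, rfl⟩
  simp only [Matrix.mul_assoc G, Matrix.det_mul G]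
  exact Ideal.mul_mem_left _ _ (det_mul_mem_maxMinors M C)

theorem maxMinors_mul_right_le (M : Matrix ι κ R) (H : Matrix κ ρ R) :
    maxMinors (M * H) ≤ maxMinors M := by
  refine Ideal.span_le.2 ?_
  rintro _ ⟨C, rfl⟩
  simp only [Matrix.mul_assoc M]
  exact det_mul_mem_maxMinors M _

theorem maxMinors_mul_mul {G G' : Matrix ι ι R} {H H' : Matrix κ κ R} (hG : G' * G = 1)
    (hH : H * H' = 1) (M : Matrix ι κ R) : maxMinors (G * M * H) = maxMinors M := by
  refine le_antisymm ((maxMinors_mul_right_le _ _).trans (maxMinors_mul_left_le _ _)) ?_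
  have : M = G' * (G * M * H) * H' := by
    calc M = (G' * G) * M * (H * H') := by simp [hG, hH]
      _ = _ := by simp only [Matrix.mul_assoc]
  conv_lhs => rw [this]
  exact (maxMinors_mul_right_le _ _).trans (maxMinors_mul_left_le _ _)

theorem det_mul_eq_sum_submatrix (M : Matrix ι κ R) (C : Matrix κ ι R) :
    (M * C).det = ∑ g : ι → κ, (∏ i, C (g i) i) * (M.submatrix id g).det := by
  rw [← Matrix.det_transpose]
  have h : (M * C).transpose = fun i => ∑ l, C l i • M.transpose l := by
    ext i k
    simp [Matrix.mul_apply, mul_comm]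
  have := (Matrix.detRowAlternating (n := ι) (R := R)).toMultilinearMap.map_sum
    (fun i l => C l i • M.transpose l)
  rw [h]
  refine this.trans (Finset.sum_congr rfl fun g _ => ?_)
  rw [MultilinearMap.map_smul_univ, smul_eq_mul, ← Matrix.det_transpose (M.submatrix id g)]
  rfl

theorem submatrix_eq_mul_selection (M : Matrix ι κ R) (g : ρ → κ) :
    M.submatrix id g = M * Matrix.of fun l i => if l = g i then (1 : R) else 0 := by
  ext i j
  simp [Matrix.mul_apply]

theorem maxMinors_eq_span_submatrix (M : Matrix ι κ R) :
    maxMinors M = Ideal.span (Set.range fun g : ι → κ => (M.submatrix id g).det) := by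
  apply le_antisymm
  · refine Ideal.span_le.2 ?_
    rintro _ ⟨C, rfl⟩
    simp only [det_mul_eq_sum_submatrix M C]
    exact Ideal.sum_mem _ fun g _ => Ideal.mul_mem_left _ _ (Ideal.subset_span ⟨g, rfl⟩)
  · refine Ideal.span_le.2 ?_
    rintro _ ⟨g, rfl⟩
    simp only [submatrix_eq_mul_selection M g]
    exact det_mul_mem_maxMinors M _

theorem maxMinors_map (f : R →+* S) (M : Matrix ι κ R) :
    maxMinors (M.map f) = (maxMinors M).map f := by
  rw [maxMinors_eq_span_submatrix, maxMinors_eq_span_submatrix, Ideal.map_span, ← Set.range_comp]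
  congr 2
  ext g
  simp [RingHom.map_det, RingHom.mapMatrix_apply, Matrix.submatrix_map]

theorem AlternatingMap.apply_mem_maxMinors (hc : IsUnit ((Fintype.card ι).factorial : R))
    (Φ : (κ → R) [⋀^ι]→ₗ[R] R) (N : Matrix ι κ R) : Φ N ∈ maxMinors N := by
  have key : ((Fintype.card ι).factorial : R) * Φ N =
      ∑ r : ι → κ, Φ (fun i => Pi.single (r i) 1) * (N.submatrix id r).det := by
    have h1 : Φ N = ∑ r : ι → κ, (∏ i, N i (r i)) * Φ (fun i => Pi.single (r i) 1) := by
      have hN : N = fun i => ∑ l, N i l • (Pi.single l (1 : R) : κ → R) := by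
        ext i l
        simp [Finset.sum_apply, Pi.single_apply]
      conv_lhs => rw [hN]
      refine (Φ.toMultilinearMap.map_sum fun i l => N i l • (Pi.single l (1 : R) : κ → R)).trans
        (Finset.sum_congr rfl fun r _ => ?_)
      rw [MultilinearMap.map_smul_univ, smul_eq_mul]
      rfl
    have h2 : ∀ τ : Equiv.Perm ι, Φ N = ∑ r : ι → κ, (∏ i, N i (r (τ i))) *
        (((Equiv.Perm.sign τ : ℤ) : R) * Φ (fun i => Pi.single (r i) 1)) := by
      intro τ
      rw [h1, ← (Equiv.arrowCongr τ.symm (Equiv.refl κ)).sum_comp]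
      refine Finset.sum_congr rfl fun r _ => ?_
      have h3 := Φ.map_perm (fun i => (Pi.single (r i) 1 : κ → R)) τ
      simp only [Function.comp_def, Equiv.arrowCongr_apply, Equiv.refl_apply,
        Equiv.symm_symm] at h3 ⊢
      rw [h3]
      rcases Int.units_eq_one_or (Equiv.Perm.sign τ) with h | h <;> simp [h]
    calc ((Fintype.card ι).factorial : R) * Φ N = ∑ _τ : Equiv.Perm ι, Φ N := by
          simp [Fintype.card_perm]
      _ = ∑ τ : Equiv.Perm ι, ∑ r : ι → κ, (∏ i, N i (r (τ i))) *
        (((Equiv.Perm.sign τ : ℤ) : R) * Φ (fun i => Pi.single (r i) 1)) :=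
          Finset.sum_congr rfl fun τ _ => h2 τ
      _ = _ := by
          rw [Finset.sum_comm]
          refine Finset.sum_congr rfl fun r _ => ?_
          rw [← Matrix.det_transpose, Matrix.det_apply', Finset.mul_sum]
          refine Finset.sum_congr rfl fun τ _ => ?_
          simp only [Matrix.transpose_apply, Matrix.submatrix_apply, id]
          ring
  rw [← Ideal.unit_mul_mem_iff_mem _ hc, key, maxMinors_eq_span_submatrix]
  exact Ideal.sum_mem _ fun g _ => Ideal.mul_mem_left _ _ (Ideal.subset_span ⟨g, rfl⟩)

theorem det_mem_maxMinors_of_rows (hc : IsUnit ((Fintype.card ι).factorial : R))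
    (A : Matrix ρ ρ R) {f : ι → ρ} (hf : Function.Injective f) (N : Matrix ι κ R)
    (C : Matrix κ ρ R) (h : ∀ i, A (f i) = (N * C) i) : A.det ∈ maxMinors N := by
  classical
  let A' : (ι → κ → R) → Matrix ρ ρ R := fun w k =>
    if h : ∃ i, f i = k then Matrix.vecMul (w h.choose) C else A k
  have hA'f : ∀ w i, A' w (f i) = Matrix.vecMul (w i) C := by
    intro w i
    have hex : ∃ j, f j = f i := ⟨i, rfl⟩
    simp only [A', dif_pos hex]
    rw [hf hex.choose_spec]
  have hA'n : ∀ w k, (¬ ∃ i, f i = k) → A' w k = A k := by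
    intro w k hk
    simp only [A', dif_neg hk]
  have hup : ∀ (_ : DecidableEq ι) w i x, A' (Function.update w i x) =
      (A' w).updateRow (f i) (Matrix.vecMul x C) := by
    intro _ w i x
    funext k
    by_cases hk : ∃ j, f j = k
    · obtain ⟨j, rfl⟩ := hk
      rw [hA'f]
      by_cases hj : j = i
      · subst hj
        rw [Function.update_self, Matrix.updateRow_self]
      · rw [Function.update_of_ne hj, Matrix.updateRow_ne (fun hh => hj (hf hh)), hA'f]
    · rw [hA'n _ _ hk, Matrix.updateRow_ne (fun hh => hk ⟨i, hh.symm⟩), hA'n _ _ hk]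
  let Φ : (κ → R) [⋀^ι]→ₗ[R] R :=
    { toFun := fun w => (A' w).det
      map_update_add' := by
        intro hd w i x y
        change (A' (Function.update w i (x + y))).det =
          (A' (Function.update w i x)).det + (A' (Function.update w i y)).det
        rw [hup, hup, hup, Matrix.add_vecMul, Matrix.det_updateRow_add]
      map_update_smul' := by
        intro hd w i c x
        change (A' (Function.update w i (c • x))).det = c * (A' (Function.update w i x)).det
        rw [hup, hup, Matrix.smul_vecMul, Matrix.det_updateRow_smul]
      map_eq_zero_of_eq' := by
        intro w i j hij hne
        refine Matrix.det_zero_of_row_eq (fun hh => hne (hf hh)) ?_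
        rw [hA'f, hA'f, hij] }
  have : A.det = Φ N := by
    change A.det = (A' N).det
    congr 1
    funext k
    by_cases hk : ∃ j, f j = k
    · obtain ⟨j, rfl⟩ := hk
      exact (h j).trans (hA'f N j).symm
    · exact (hA'n N k hk).symm
  rw [this]
  exact Φ.apply_mem_maxMinors hc N

theorem maxMinors_fromBlocks_one {α : Type*} [Fintype α] [DecidableEq α]
    (hc : IsUnit ((Fintype.card ι).factorial : R)) (N : Matrix ι κ R) :
    maxMinors (Matrix.fromBlocks (1 : Matrix α α R) 0 0 N) = maxMinors N := by
  apply le_antisymm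
  · refine Ideal.span_le.2 ?_
    rintro _ ⟨C, rfl⟩
    refine det_mem_maxMinors_of_rows hc _ Sum.inr_injective N (C.submatrix Sum.inr id) fun i => ?_
    ext j
    simp [Matrix.mul_apply]
  · refine Ideal.span_le.2 ?_
    rintro _ ⟨C, rfl⟩
    have := det_mul_mem_maxMinors (Matrix.fromBlocks (1 : Matrix α α R) 0 0 N)
      (Matrix.fromBlocks 1 0 0 C)
    simpa [Matrix.fromBlocks_multiply] using this

theorem maxMinors_submatrix_equiv {ι' κ' : Type*} [Fintype ι'] [DecidableEq ι'] [Fintype κ']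
    [DecidableEq κ'] (M : Matrix ι κ R) (f : ι' ≃ ι) (g : κ' ≃ κ) :
    maxMinors (M.submatrix f g) = maxMinors M := by
  apply le_antisymm
  · refine Ideal.span_le.2 ?_
    rintro _ ⟨C, rfl⟩
    have : M.submatrix f g * C = (M * C.submatrix g.symm f.symm).submatrix f f := by
      conv_lhs => rw [show C = (C.submatrix g.symm f.symm).submatrix g f by simp]
      rw [Matrix.submatrix_mul_equiv]
    simp only [this, Matrix.det_submatrix_equiv_self]
    exact det_mul_mem_maxMinors M _
  · refine Ideal.span_le.2 ?_
    rintro _ ⟨C, rfl⟩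
    have := det_mul_mem_maxMinors (M.submatrix f g) (C.submatrix g f)
    rwa [Matrix.submatrix_mul_equiv, Matrix.det_submatrix_equiv_self] at this

theorem maxMinors_fromBlocks {α : Type*} [Fintype α] [DecidableEq α]
    (hc : IsUnit ((Fintype.card ι).factorial : R)) (A : Matrix α α R) [Invertible A]
    (B : Matrix α κ R) (C : Matrix ι α R) (D : Matrix ι κ R) :
    maxMinors (Matrix.fromBlocks A B C D) = maxMinors (D - C * ⅟A * B) := by
  rw [← maxMinors_fromBlocks_one (α := α) hc (D - C * ⅟A * B)]
  rw [Matrix.fromBlocks_eq_of_invertible₁₁]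
  generalize D - C * ⅟A * B = N
  have h1 : Matrix.fromBlocks A (0 : Matrix α κ R) (0 : Matrix ι α R) N =
      (Matrix.fromBlocks A 0 0 1 : Matrix (α ⊕ ι) (α ⊕ ι) R) *
        Matrix.fromBlocks (1 : Matrix α α R) (0 : Matrix α κ R) (0 : Matrix ι α R) N := by
    rw [Matrix.fromBlocks_multiply]
    simp
  rw [h1, ← Matrix.mul_assoc]
  refine maxMinors_mul_mul
    (G' := Matrix.fromBlocks (⅟A) 0 0 1 * Matrix.fromBlocks 1 0 (-(C * ⅟A)) 1)
    (H' := Matrix.fromBlocks 1 (-(⅟A * B)) 0 1) ?_ ?_ _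
  · have : Matrix.fromBlocks (1 : Matrix α α R) 0 (-(C * ⅟A)) (1 : Matrix ι ι R) *
        Matrix.fromBlocks 1 0 (C * ⅟A) 1 = 1 := by
      simp [Matrix.fromBlocks_multiply]
    calc _ = Matrix.fromBlocks (⅟A) 0 0 (1 : Matrix ι ι R) *
        (Matrix.fromBlocks (1 : Matrix α α R) 0 (-(C * ⅟A)) (1 : Matrix ι ι R) *
        Matrix.fromBlocks 1 0 (C * ⅟A) 1) * Matrix.fromBlocks A 0 0 1 := by
          simp only [Matrix.mul_assoc]
      _ = 1 := by
          rw [this]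
          simp [Matrix.fromBlocks_multiply]
  · simp [Matrix.fromBlocks_multiply]

/-- A finite type as a point and its complement. -/
def unitSumNe {α : Type*} [DecidableEq α] (a : α) : Unit ⊕ {k : α // k ≠ a} ≃ α :=
  (Equiv.sumComm _ _).trans ((Equiv.optionEquivSumPUnit _).symm.trans (Equiv.optionSubtypeNe a))

@[simp] theorem unitSumNe_inl {α : Type*} [DecidableEq α] (a : α) (u : Unit) :
    unitSumNe a (Sum.inl u) = a := by
  simp [unitSumNe]

@[simp] theorem unitSumNe_inr {α : Type*} [DecidableEq α] (a : α) (k : {k : α // k ≠ a}) :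
    unitSumNe a (Sum.inr k) = k := by
  simp [unitSumNe]

theorem maxMinors_pivot (hc : IsUnit ((Fintype.card ι).factorial : R)) (M : Matrix ι κ R)
    (i₀ : ι) (c₀ : κ) (w : R) (hw : M i₀ c₀ * w = 1) :
    maxMinors M = maxMinors (Matrix.of fun (i : {k // k ≠ i₀}) (c : {k // k ≠ c₀}) =>
      M i c - M i c₀ * w * M i₀ c) := by
  rw [← maxMinors_submatrix_equiv M (unitSumNe i₀) (unitSumNe c₀)]
  have hc' : IsUnit ((Fintype.card {k // k ≠ i₀}).factorial : R) := by
    refine isUnit_of_dvd_unit ?_ hc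
    exact_mod_cast Nat.cast_dvd_cast (Nat.factorial_dvd_factorial (Fintype.card_subtype_le _))
  let A : Matrix Unit Unit R := Matrix.of fun _ _ => M i₀ c₀
  let _ : Invertible A := ⟨Matrix.of fun _ _ => w, by ext; simp [A, Matrix.mul_apply, mul_comm w, hw],
    by ext; simp [A, Matrix.mul_apply, hw]⟩
  have hA : ⅟A = Matrix.of fun _ _ => w := rfl
  have h1 : M.submatrix (unitSumNe i₀) (unitSumNe c₀) = Matrix.fromBlocks A
      (Matrix.of fun _ (c : {k // k ≠ c₀}) => M i₀ c)
      (Matrix.of fun (i : {k // k ≠ i₀}) _ => M i c₀)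
      (Matrix.of fun (i : {k // k ≠ i₀}) (c : {k // k ≠ c₀}) => M i c) := by
    ext (i | i) (c | c) <;> simp [A]
  rw [h1, maxMinors_fromBlocks hc', hA]
  congr 1
  ext i c
  simp [Matrix.mul_apply]

theorem maxMinors_eq_bot_of_card_lt (M : Matrix ι κ R) (h : Fintype.card κ < Fintype.card ι) :
    maxMinors M = ⊥ := by
  rw [eq_bot_iff, maxMinors_eq_span_submatrix]
  refine Ideal.span_le.2 ?_
  rintro _ ⟨g, rfl⟩
  obtain ⟨i, j, hij, hg⟩ := Fintype.exists_ne_map_eq_of_card_lt g h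
  exact Matrix.det_zero_of_column_eq hij fun k => by simp [hg]

theorem maxMinors_eq_span_of_unique [Unique ι] (M : Matrix ι κ R) :
    maxMinors M = Ideal.span (Set.range fun q : ι × κ => M q.1 q.2) := by
  rw [maxMinors_eq_span_submatrix]
  congr 1
  ext x
  constructor
  · rintro ⟨g, rfl⟩
    exact ⟨(default, g default), by simp⟩
  · rintro ⟨⟨i, c⟩, rfl⟩
    refine ⟨fun _ => c, ?_⟩
    simp [Subsingleton.elim i default]

theorem maxMinors_le_ker_of_vecMul [IsDomain S] (f : R →+* S) (M : Matrix ι κ R) (l : ι → S)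
    (hl : l ≠ 0) (h : ∀ c, ∑ i, l i * f (M i c) = 0) : maxMinors M ≤ RingHom.ker f := by
  rw [maxMinors_eq_span_submatrix]
  refine Ideal.span_le.2 ?_
  rintro _ ⟨g, rfl⟩
  change f _ = 0
  rw [RingHom.map_det]
  refine Matrix.exists_vecMul_eq_zero_iff.1 ⟨l, hl, ?_⟩
  ext c
  simpa [Matrix.vecMul, dotProduct] using h (g c)

theorem maxMinors_le_ker_of_smul (f g : R →+* S) (M : Matrix ι κ R) (a : S)
    (h : ∀ i c, f (M i c) = a * g (M i c)) (hg : maxMinors M ≤ RingHom.ker g) :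
    maxMinors M ≤ RingHom.ker f := by
  rw [maxMinors_eq_span_submatrix] at hg ⊢
  refine Ideal.span_le.2 ?_
  rintro _ ⟨r, rfl⟩
  change f _ = 0
  have h1 : f.mapMatrix (M.submatrix id r) = a • g.mapMatrix (M.submatrix id r) := by
    ext i j
    simp [h]
  have h2 : g (M.submatrix id r).det = 0 := hg (Ideal.subset_span ⟨r, rfl⟩)
  rw [RingHom.map_det, h1, Matrix.det_smul, ← RingHom.map_det, h2, mul_zero]

theorem maxMinors_le_ker_of_mul_left (f g : R →+* S) (M : Matrix ι κ R) (E : Matrix ι ι S)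
    (h : M.map f = E * M.map g) (hg : maxMinors M ≤ RingHom.ker g) :
    maxMinors M ≤ RingHom.ker f := by
  rw [← Ideal.map_eq_bot_iff_le_ker, ← maxMinors_map] at hg ⊢
  rw [h, eq_bot_iff, ← hg]
  exact maxMinors_mul_left_le _ _

theorem maxMinors_le_ker_of_rows {ι' κ' : Type*} [Fintype ι'] [DecidableEq ι'] [Fintype κ']
    [DecidableEq κ'] (f : R →+* S) (hc : IsUnit ((Fintype.card ι').factorial : S))
    (M : Matrix ι κ R) (N : Matrix ι' κ' R) (r : ι' → ι) (hr : Function.Injective r)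
    (C : Matrix κ' κ S) (h : ∀ i c, f (M (r i) c) = ∑ c', f (N i c') * C c' c)
    (hN : maxMinors N ≤ RingHom.ker f) : maxMinors M ≤ RingHom.ker f := by
  rw [← Ideal.map_eq_bot_iff_le_ker, ← maxMinors_map] at hN ⊢
  rw [eq_bot_iff, ← hN]
  refine Ideal.span_le.2 ?_
  rintro _ ⟨D, rfl⟩
  refine det_mem_maxMinors_of_rows hc _ hr (N.map f) (C * D) fun i => ?_
  have : (M.map f) (r i) = (N.map f * C) i := by
    ext c
    simp [Matrix.mul_apply, h]
  ext j
  rw [← Matrix.mul_assoc]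
  simp only [Matrix.mul_apply (M := M.map f), Matrix.mul_apply (M := N.map f * C), this]

theorem map_mul_eq_zero_of_corner (f : R →+* S) (M : Matrix ι κ R) (i₀ : ι) (c₀ : κ)
    (h : ∀ i, i ≠ i₀ → f (M i c₀) = 0) (hM : maxMinors M ≤ RingHom.ker f) {a : R}
    (ha : a ∈ maxMinors (Matrix.of fun (i : {k // k ≠ i₀}) (c : {k // k ≠ c₀}) => M i c)) :
    f (M i₀ c₀ * a) = 0 := by
  rw [← maxMinors_submatrix_equiv M (unitSumNe i₀) (unitSumNe c₀)] at hM
  set N : Matrix {k // k ≠ i₀} {k // k ≠ c₀} R := Matrix.of fun i c => M i c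
  suffices maxMinors N ≤ Submodule.comap (LinearMap.mulLeft R (M i₀ c₀)) (RingHom.ker f) from this ha
  refine Ideal.span_le.2 ?_
  rintro _ ⟨D, rfl⟩
  change f (M i₀ c₀ * (N * D).det) = 0
  have h1 := hM (det_mul_mem_maxMinors _ (Matrix.fromBlocks (1 : Matrix Unit Unit R) 0 0 D))
  have h2 : M.submatrix (unitSumNe i₀) (unitSumNe c₀) = Matrix.fromBlocks
      (Matrix.of fun (_ : Unit) (_ : Unit) => M i₀ c₀)
      (Matrix.of fun _ (c : {k // k ≠ c₀}) => M i₀ c)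
      (Matrix.of fun (i : {k // k ≠ i₀}) _ => M i c₀) N := by
    ext (i | i) (c | c) <;> simp [N]
  have h3 : (Matrix.of fun (i : {k // k ≠ i₀}) (_ : Unit) => M i c₀).map f = 0 := by
    ext i c
    simpa using h i i.2
  rw [h2, Matrix.fromBlocks_multiply, RingHom.mem_ker, RingHom.map_det, RingHom.mapMatrix_apply,
    Matrix.fromBlocks_map] at h1
  simp only [Matrix.mul_one, Matrix.mul_zero, add_zero, zero_add] at h1
  rw [h3, Matrix.det_fromBlocks_zero₂₁] at h1
  rw [map_mul, RingHom.map_det]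
  simpa using h1

end MaxMinors

section GenericMatrix

theorem isUnit_natCast_factorial (R : Type*) [CommRing R] [Algebra ℂ R] (k : ℕ) :
    IsUnit ((k.factorial : ℕ) : R) := by
  have h : IsUnit ((k.factorial : ℕ) : ℂ) :=
    isUnit_iff_ne_zero.2 (Nat.cast_ne_zero.2 (Nat.factorial_ne_zero k))
  simpa using h.map (algebraMap ℂ R)

variable {σ ι κ : Type} [Fintype ι] [Fintype κ] [DecidableEq ι] [DecidableEq κ]

/-- The matrix of variables indexed by `e`. -/
noncomputable def genMat (e : ι → κ → σ) : Matrix ι κ (MvPolynomial σ ℂ) :=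
  Matrix.of fun i c => X (e i c)

/-- The ideal generated by the variables in `Z` and the maximal minors of a matrix of variables. -/
noncomputable def genIdeal (Z : Set σ) (e : ι → κ → σ) : Ideal (MvPolynomial σ ℂ) :=
  Ideal.span (X '' Z) ⊔ maxMinors (genMat e)

theorem X_mem_genIdeal {Z : Set σ} (e : ι → κ → σ) {v : σ} (hv : v ∈ Z) :
    (X v : MvPolynomial σ ℂ) ∈ genIdeal Z e :=
  Ideal.mem_sup_left (Ideal.subset_span ⟨v, hv, rfl⟩)

theorem genIdeal_le {Z : Set σ} {e : ι → κ → σ} {I : Ideal (MvPolynomial σ ℂ)}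
    (hZ : ∀ v ∈ Z, X v ∈ I) (hM : maxMinors (genMat e) ≤ I) : genIdeal Z e ≤ I := by
  refine sup_le (Ideal.span_le.2 ?_) hM
  rintro _ ⟨v, hv, rfl⟩
  exact hZ v hv

theorem maxMinors_le_genIdeal (Z : Set σ) (e : ι → κ → σ) :
    maxMinors (genMat e) ≤ genIdeal Z e := le_sup_right

theorem genIdeal_mono {Z Z' : Set σ} (h : Z ⊆ Z') (e : ι → κ → σ) :
    genIdeal Z e ≤ genIdeal Z' e :=
  sup_le_sup_right (Ideal.span_mono (Set.image_mono h)) _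

theorem genIdeal_insert (Z : Set σ) (v : σ) (e : ι → κ → σ) :
    genIdeal (insert v Z) e = genIdeal Z e ⊔ Ideal.span {X v} := by
  rw [genIdeal, Set.image_insert_eq, Ideal.span_insert, genIdeal, sup_assoc, sup_comm]

theorem genIdeal_le_ker {S : Type*} [CommRing S] [IsDomain S] (f : MvPolynomial σ ℂ →+* S)
    {Z : Set σ} {e : ι → κ → σ} (hZ : ∀ v ∈ Z, f (X v) = 0) (l : ι → S) (hl : l ≠ 0)
    (h : ∀ c, ∑ i, l i * f (X (e i c)) = 0) : genIdeal Z e ≤ RingHom.ker f :=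
  genIdeal_le hZ (maxMinors_le_ker_of_vecMul f _ l hl h)

/-- The endomorphism-like map `X v ↦ w v` into polynomials over an algebra specializes at `a`
to `q` as soon as it does on variables. -/
theorem eval_comp_eq {S : Type*} [CommRing S] [Algebra ℂ S] (χ : MvPolynomial σ ℂ →ₐ[ℂ] Polynomial S)
    (q : MvPolynomial σ ℂ →ₐ[ℂ] S) (a : S) (h : ∀ v, (χ (X v)).eval a = q (X v))
    (f : MvPolynomial σ ℂ) : (χ f).eval a = q f := by
  have h2 : (Polynomial.evalRingHom a).comp (χ : MvPolynomial σ ℂ →+* Polynomial S) =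
      (q : MvPolynomial σ ℂ →+* S) := by
    refine MvPolynomial.ringHom_ext (fun b => ?_) fun v => ?_
    · have h3 : χ (C b) = algebraMap ℂ _ b := χ.commutes b
      have h4 : q (C b) = algebraMap ℂ _ b := q.commutes b
      simp [h3, h4, Polynomial.algebraMap_apply]
    · simpa using h v
  exact congrArg (fun g => g f) h2

/-- If a polynomial arc starting at the point `q` stays in `V(I)` and leaves
`{y = 0}`, then `q` kills the `y`-saturation of `I`. -/
theorem eq_zero_of_arc {S : Type*} [CommRing S] [IsDomain S] [Algebra ℂ S]
    {I : Ideal (MvPolynomial σ ℂ)} (q : MvPolynomial σ ℂ →ₐ[ℂ] S)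
    (χ : MvPolynomial σ ℂ →ₐ[ℂ] Polynomial S)
    (hI : I ≤ RingHom.ker χ) (h0 : ∀ v, (χ (X v)).eval 0 = q (X v))
    {y f : MvPolynomial σ ℂ} (hy : χ y ≠ 0) {N : ℕ} (hf : y ^ N * f ∈ I) : q f = 0 := by
  have h1 : χ f = 0 := by
    have : χ (y ^ N * f) = 0 := hI hf
    rw [map_mul, map_pow] at this
    exact (mul_eq_zero.1 this).resolve_left (pow_ne_zero _ hy)
  rw [← eval_comp_eq χ q 0 h0, h1, Polynomial.eval_zero]

theorem eq_zero_of_mul_mem_genIdeal {S : Type*} [CommRing S] [Algebra ℂ S] {Z : Set σ}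
    {e : ι → κ → σ} (q : MvPolynomial σ ℂ →ₐ[ℂ] S) (hq : genIdeal Z e ≤ RingHom.ker q)
    {u f : MvPolynomial σ ℂ} (hu : constantCoeff u = 1) (huf : u * f ∈ genIdeal Z e) :
    q f = 0 := by
  let χ : MvPolynomial σ ℂ →ₐ[ℂ] Polynomial S :=
    aeval fun v => Polynomial.X * Polynomial.C (q (X v))
  have hχ : ∀ v, χ (X v) = Polynomial.X * Polynomial.C (q (X v)) := fun v => aeval_X _ v
  have hI : genIdeal Z e ≤ RingHom.ker χ := by
    refine genIdeal_le (fun v hv => ?_) ?_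
    · change χ _ = 0
      rw [hχ, show q (X v) = 0 from hq (X_mem_genIdeal e hv)]
      simp
    · refine maxMinors_le_ker_of_smul (χ : MvPolynomial σ ℂ →+* Polynomial S)
        (Polynomial.C.comp (q : MvPolynomial σ ℂ →+* S)) _ Polynomial.X (fun i c => ?_) ?_
      · simp [genMat, hχ]
      · intro f hf
        have : q f = 0 := hq (maxMinors_le_genIdeal Z e hf)
        simp [RingHom.mem_ker, this]
  have hu0 : (χ u).coeff 0 = 1 := by
    rw [Polynomial.coeff_zero_eq_eval_zero,
      eval_comp_eq χ ((Algebra.ofId ℂ S).comp (aeval fun _ => (0 : ℂ))) 0 (fun v => by simp [hχ])]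
    have : (aeval fun _ => (0 : ℂ)) u = constantCoeff u := by
      rw [← MvPolynomial.eval_zero, MvPolynomial.aeval_eq_eval]
      rfl
    rw [AlgHom.comp_apply, this, hu, map_one]
  have h1 : χ f = 0 := by
    have h3 : (χ u : PowerSeries S) * (χ f : PowerSeries S) = 0 := by
      rw [← Polynomial.coe_mul, ← map_mul, show χ (u * f) = 0 from hI huf, Polynomial.coe_zero]
    have h4 : IsUnit (χ u : PowerSeries S) := by
      rw [PowerSeries.isUnit_iff_constantCoeff]
      simp [hu0]
    exact Polynomial.coe_eq_zero_iff.1 (h4.mul_right_eq_zero.1 h3)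
  rw [← eval_comp_eq χ q 1 (fun v => by simp [hχ]), h1, Polynomial.eval_zero]

/-- Elements congruent to one modulo the variables are nonzerodivisors modulo `genIdeal Z e`. -/
theorem mem_genIdeal_of_mul_mem {Z : Set σ} {e : ι → κ → σ} {u f : MvPolynomial σ ℂ}
    (hu : constantCoeff u = 1) (huf : u * f ∈ genIdeal Z e) : f ∈ genIdeal Z e :=
  Ideal.Quotient.eq_zero_iff_mem.1 (eq_zero_of_mul_mem_genIdeal
    (Ideal.Quotient.mkₐ ℂ (genIdeal Z e)) (fun _ h => Ideal.Quotient.eq_zero_iff_mem.2 h) hu huf)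

/-- Quotients by ideals generated by variables are polynomial rings. -/
theorem span_X_eq_ker (Z : Set σ) [DecidablePred (· ∈ Z)] :
    Ideal.span (X '' Z : Set (MvPolynomial σ ℂ)) = RingHom.ker (aeval fun v : σ =>
      if h : v ∈ Z then 0 else (X ⟨v, h⟩ : MvPolynomial {v // v ∉ Z} ℂ)) := by
  apply le_antisymm
  · refine Ideal.span_le.2 ?_
    rintro _ ⟨v, hv, rfl⟩
    simp [RingHom.mem_ker, hv]
  · intro f hf
    set φ := aeval (R := ℂ) fun v : σ =>
      if h : v ∈ Z then 0 else (X ⟨v, h⟩ : MvPolynomial {v // v ∉ Z} ℂ)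
    set I := Ideal.span (X '' Z : Set (MvPolynomial σ ℂ))
    have h : ((Ideal.Quotient.mkₐ ℂ I).comp (rename Subtype.val)).comp φ =
        Ideal.Quotient.mkₐ ℂ I := by
      refine algHom_ext fun v => ?_
      by_cases hv : v ∈ Z
      · have : Ideal.Quotient.mk I (X v) = 0 :=
          Ideal.Quotient.eq_zero_iff_mem.2 (Ideal.subset_span ⟨v, hv, rfl⟩)
        simp [φ, hv, this]
      · simp [φ, hv]
    have h' := congrArg (fun g => g f) h
    have hf' : φ f = 0 := hf
    simp only [AlgHom.comp_apply, hf', map_zero] at h'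
    exact Ideal.Quotient.eq_zero_iff_mem.1 h'.symm

theorem isPrime_span_X (Z : Set σ) : (Ideal.span (X '' Z : Set (MvPolynomial σ ℂ))).IsPrime := by
  classical
  rw [span_X_eq_ker]
  exact RingHom.ker_isPrime _

theorem X_mem_span_X_iff {Z : Set σ} {v : σ} :
    (X v : MvPolynomial σ ℂ) ∈ Ideal.span (X '' Z : Set (MvPolynomial σ ℂ)) ↔ v ∈ Z := by
  classical
  refine ⟨fun h => ?_, fun h => Ideal.subset_span ⟨v, h, rfl⟩⟩
  rw [span_X_eq_ker] at h
  by_contra hv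
  simp [RingHom.mem_ker, hv] at h

theorem isIntegrallyClosed_quotient_span_X (Z : Set σ) :
    IsIntegrallyClosed (MvPolynomial σ ℂ ⧸ Ideal.span (X '' Z : Set (MvPolynomial σ ℂ))) := by
  classical
  have hs : Function.Surjective (aeval (R := ℂ) fun v : σ =>
      if h : v ∈ Z then 0 else (X ⟨v, h⟩ : MvPolynomial {v // v ∉ Z} ℂ)) := by
    rw [← AlgHom.range_eq_top, eq_top_iff, ← MvPolynomial.adjoin_range_X]
    refine Algebra.adjoin_le ?_
    rintro _ ⟨⟨v, hv⟩, rfl⟩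
    exact ⟨X v, by simp [hv]⟩
  rw [span_X_eq_ker]
  exact IsIntegrallyClosed.of_equiv (RingHom.quotientKerEquivOfSurjective hs).symm

theorem genIdeal_of_card_lt (Z : Set σ) (e : ι → κ → σ) (h : Fintype.card κ < Fintype.card ι) :
    genIdeal Z e = Ideal.span (X '' Z) := by
  rw [genIdeal, maxMinors_eq_bot_of_card_lt _ h, sup_bot_eq]

theorem genIdeal_of_card_eq_one (Z : Set σ) (e : ι → κ → σ) (h : Fintype.card ι = 1) :
    genIdeal Z e = Ideal.span (X '' (Z ∪ Set.range fun q : ι × κ => e q.1 q.2)) := by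
  obtain ⟨i, hi⟩ := Fintype.card_eq_one_iff.1 h
  let _ : Unique ι := ⟨⟨i⟩, hi⟩
  rw [genIdeal, maxMinors_eq_span_of_unique, Set.image_union, Ideal.span_union, ← Set.range_comp]
  rfl

end GenericMatrix

section Pivot

variable {σ ι κ : Type} [Fintype ι] [Fintype κ] [DecidableEq ι] [DecidableEq κ]

/-- Ring homomorphism shifting the variables not in the pivot row and column. -/
theorem exists_pivotHom {S : Type*} [CommRing S] [Algebra ℂ S] (x : σ → S) (w : S)
    (e : ι → κ → σ) (he : Function.Injective fun q : ι × κ => e q.1 q.2) (i₀ : ι) (c₀ : κ) (ε : ℤ) :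
    ∃ q : σ → S, (∀ i c, i ≠ i₀ → c ≠ c₀ → q (e i c) = x (e i c) + (ε : S) * (x (e i c₀) * w * x (e i₀ c))) ∧
      ∀ v, (∀ i c, i ≠ i₀ → c ≠ c₀ → e i c ≠ v) → q v = x v := by
  classical
  refine ⟨fun v => if h : ∃ r : ι × κ, r.1 ≠ i₀ ∧ r.2 ≠ c₀ ∧ e r.1 r.2 = v then
    x v + (ε : S) * (x (e h.choose.1 c₀) * w * x (e i₀ h.choose.2)) else x v, ?_, ?_⟩
  · intro i c hi hc
    have h : ∃ r : ι × κ, r.1 ≠ i₀ ∧ r.2 ≠ c₀ ∧ e r.1 r.2 = e i c := ⟨(i, c), hi, hc, rfl⟩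
    have h2 : h.choose = (i, c) := he h.choose_spec.2.2
    simp only [dif_pos h]
    rw [h2]
  · intro v hv
    refine dif_neg ?_
    rintro ⟨r, h1, h2, h3⟩
    exact hv _ _ h1 h2 h3

/-- After inverting the entry `e i₀ c₀`, a generic determinantal ideal becomes, up to an
automorphism, the one of the submatrix complementary to this entry. -/
theorem exists_pivotEquiv (S : Type) [CommRing S] [Algebra (MvPolynomial σ ℂ) S] [Algebra ℂ S]
    [IsScalarTower ℂ (MvPolynomial σ ℂ) S] {Z : Set σ}
    {e : ι → κ → σ} (he : Function.Injective fun q : ι × κ => e q.1 q.2) (i₀ : ι) (c₀ : κ)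
    [IsLocalization.Away (X (e i₀ c₀) : MvPolynomial σ ℂ) S]
    (hZ : ∀ i c, i ≠ i₀ → c ≠ c₀ → e i c ∉ Z) :
    ∃ T : S ≃+* S,
      ((genIdeal Z fun (i : {i // i ≠ i₀}) (c : {c // c ≠ c₀}) => e i c).map
        (algebraMap (MvPolynomial σ ℂ) S)).map (T : S →+* S) =
      (genIdeal Z e).map (algebraMap (MvPolynomial σ ℂ) S) := by
  set g := algebraMap (MvPolynomial σ ℂ) S
  set w : S := IsLocalization.Away.invSelf (X (e i₀ c₀) : MvPolynomial σ ℂ)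
  have hw : g (X (e i₀ c₀)) * w = 1 := IsLocalization.Away.mul_invSelf _
  choose q hq1 hq2 using exists_pivotHom (fun v => g (X v)) w e he i₀ c₀
  have hrow : ∀ ε i, q ε (e i c₀) = g (X (e i c₀)) := fun ε i =>
    hq2 ε _ fun i' c' _ hc h => hc (congrArg Prod.snd (@he (i', c') (i, c₀) h))
  have hcol : ∀ ε c, q ε (e i₀ c) = g (X (e i₀ c)) := fun ε c =>
    hq2 ε _ fun i' c' hi _ h => hi (congrArg Prod.fst (@he (i', c') (i₀, c) h))
  let Ψ : ℤ → MvPolynomial σ ℂ →+* S := fun ε => (aeval (R := ℂ) (q ε) : _ →ₐ[ℂ] S)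
  have hΨX : ∀ ε v, Ψ ε (X v) = q ε v := fun ε v => aeval_X _ v
  have hΨC : ∀ ε a, Ψ ε (C a) = g (C a) := fun ε a => by
    have h1 : Ψ ε (C a) = algebraMap ℂ S a := (aeval (R := ℂ) (q ε)).commutes a
    rw [h1, IsScalarTower.algebraMap_apply ℂ (MvPolynomial σ ℂ) S]
    rfl
  have hu : ∀ ε, IsUnit (Ψ ε (X (e i₀ c₀))) := fun ε => by
    rw [hΨX, hrow]
    exact IsUnit.of_mul_eq_one _ hw
  let L : ℤ → S →+* S := fun ε => IsLocalization.Away.lift (X (e i₀ c₀) : MvPolynomial σ ℂ) (hu ε)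
  have hL : ∀ ε f, L ε (g f) = Ψ ε f := fun ε f => IsLocalization.Away.lift_eq _ _ f
  have hLw : ∀ ε, L ε w = w := fun ε => by
    have h1 : L ε (g (X (e i₀ c₀)) * w) = 1 := by rw [hw, map_one]
    rw [map_mul, hL, hΨX, hrow] at h1
    calc L ε w = (g (X (e i₀ c₀)) * w) * L ε w := by rw [hw, one_mul]
      _ = w * (g (X (e i₀ c₀)) * L ε w) := by ring
      _ = w := by rw [h1, mul_one]
  have hLq : ∀ ε δ, ε + δ = 0 → ∀ v, L ε (q δ v) = g (X v) := by
    intro ε δ h v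
    by_cases hv : ∀ i c, i ≠ i₀ → c ≠ c₀ → e i c ≠ v
    · rw [hq2 _ _ hv, hL, hΨX, hq2 _ _ hv]
    · push Not at hv
      obtain ⟨i, c, hi, hc, rfl⟩ := hv
      rw [hq1 _ _ _ hi hc]
      have hδ : (δ : S) = -(ε : S) := by
        have : ((ε + δ : ℤ) : S) = 0 := by rw [h, Int.cast_zero]
        push_cast at this
        exact eq_neg_of_add_eq_zero_right this
      simp only [map_add, map_mul, map_neg, map_intCast, hL, hLw, hΨX, hrow, hcol, hq1 _ _ _ hi hc, hδ]
      ring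
  have hcomp : ∀ ε δ, ε + δ = 0 → (L ε).comp (L δ) = RingHom.id S := by
    intro ε δ h
    refine IsLocalization.ringHom_ext (Submonoid.powers (X (e i₀ c₀) : MvPolynomial σ ℂ)) ?_
    refine MvPolynomial.ringHom_ext (fun a => ?_) fun v => ?_
    · change L ε (L δ (g (C a))) = g (C a)
      rw [hL, hΨC, hL, hΨC]
    · change L ε (L δ (g (X v))) = g (X v)
      rw [hL, hΨX, hLq _ _ h]
  let T : S ≃+* S := RingEquiv.ofRingHom (L (-1)) (L 1) (hcomp _ _ (by norm_num))
    (hcomp _ _ (by norm_num))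
  have hT : (T : S →+* S) = L (-1) := rfl
  refine ⟨T, ?_⟩
  rw [hT, genIdeal, genIdeal, Ideal.map_sup, Ideal.map_sup, Ideal.map_sup]
  congr 1
  · simp only [Ideal.map_span, ← Set.image_comp]
    congr 1
    refine Set.image_congr fun v hv => ?_
    simp only [Function.comp_apply, hL, hΨX]
    exact hq2 _ _ fun i c hi hc h => hZ i c hi hc (h ▸ hv)
  · have hc : IsUnit ((Fintype.card ι).factorial : S) := isUnit_natCast_factorial S _
    rw [← maxMinors_map, ← maxMinors_map, ← maxMinors_map,
      maxMinors_pivot hc ((genMat e).map g) i₀ c₀ w hw]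
    congr 1
    ext i c
    simp only [Matrix.map_apply, genMat, Matrix.of_apply, hL, hΨX, hq1 _ _ _ i.2 c.2]
    push_cast
    ring

theorem exists_prime_saturation {Z : Set σ}
    {e : ι → κ → σ} (he : Function.Injective fun q : ι × κ => e q.1 q.2) (i₀ : ι) (c₀ : κ)
    (hZ : ∀ i c, i ≠ i₀ → c ≠ c₀ → e i c ∉ Z)
    (hQ : (genIdeal Z fun (i : {i // i ≠ i₀}) (c : {c // c ≠ c₀}) => e i c).IsPrime)
    (hy : X (e i₀ c₀) ∉ genIdeal Z fun (i : {i // i ≠ i₀}) (c : {c // c ≠ c₀}) => e i c) :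
    ∃ P : Ideal (MvPolynomial σ ℂ), P.IsPrime ∧ genIdeal Z e ≤ P ∧ X (e i₀ c₀) ∉ P ∧
      ∀ f ∈ P, ∃ N : ℕ, X (e i₀ c₀) ^ N * f ∈ genIdeal Z e := by
  set y : MvPolynomial σ ℂ := X (e i₀ c₀)
  let S := Localization.Away y
  obtain ⟨T, hT⟩ := exists_pivotEquiv S he i₀ c₀ hZ
  set Q := genIdeal Z fun (i : {i // i ≠ i₀}) (c : {c // c ≠ c₀}) => e i c
  set g := algebraMap (MvPolynomial σ ℂ) S
  have h1 : (Q.map g).IsPrime := by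
    refine IsLocalization.isPrime_of_isPrime_disjoint (Submonoid.powers y) S Q hQ ?_
    rw [Set.disjoint_left]
    rintro _ ⟨k, rfl⟩ hk
    exact hy (hQ.mem_of_pow_mem _ hk)
  have h2 : ((genIdeal Z e).map g).IsPrime := by
    rw [← hT]
    exact Ideal.map_isPrime_of_equiv T
  refine ⟨((genIdeal Z e).map g).comap g, Ideal.comap_isPrime _ _, Ideal.le_comap_map, ?_, ?_⟩
  · intro h
    exact h2.ne_top (Ideal.eq_top_of_isUnit_mem _ h (IsLocalization.Away.algebraMap_isUnit y))
  · intro f hf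
    have hf' : g f ∈ (genIdeal Z e).map g := hf
    obtain ⟨m, hm, hmf⟩ := (IsLocalization.algebraMap_mem_map_algebraMap_iff
      (Submonoid.powers y) S _ _).1 hf'
    obtain ⟨k, rfl⟩ := hm
    exact ⟨k, hmf⟩

end Pivot

section Primality

variable {σ ι κ : Type} [Fintype ι] [Fintype κ] [DecidableEq ι] [DecidableEq κ]

theorem X_notMem_genIdeal [Nonempty ι] {Z : Set σ} {e : ι → κ → σ}
    (he : Function.Injective fun q : ι × κ => e q.1 q.2) {v : σ} (hv : v ∉ Z)
    (h : (∀ i c, e i c ≠ v) ∨ 2 ≤ Fintype.card ι) : X v ∉ genIdeal Z e := by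
  classical
  have key : ∃ i' : ι, ∀ c, e i' c ≠ v := by
    rcases h with h | h
    · exact ⟨Classical.arbitrary ι, h _⟩
    · by_cases hx : ∃ i c, e i c = v
      · obtain ⟨i, c, rfl⟩ := hx
        obtain ⟨i', hi'⟩ := Fintype.exists_ne_of_one_lt_card h i
        exact ⟨i', fun c' hc' => hi' (congrArg Prod.fst (@he (i', c') (i, c) hc'))⟩
      · push Not at hx
        exact ⟨Classical.arbitrary ι, hx _⟩
  obtain ⟨i', hi'⟩ := key
  intro hmem
  have := genIdeal_le_ker (eval (Pi.single v (1 : ℂ))) (Z := Z) (e := e)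
    (fun u hu => by
      rw [eval_X]
      have huv : u ≠ v := fun hh => hv (hh ▸ hu)
      exact Pi.single_eq_of_ne huv _)
    (Pi.single i' 1) (by simp) (fun c => by
      rw [Finset.sum_eq_single i' (fun b _ hb => by simp [hb]) (by simp)]
      rw [eval_X, Pi.single_eq_of_ne (hi' c), mul_zero]) hmem
  rw [RingHom.mem_ker, eval_X, Pi.single_eq_same] at this
  exact one_ne_zero this

/-- The left kernel vector of cofactors of a generic matrix modulo its maximal minors. -/
theorem exists_kernelVector {Z : Set σ} {e : ι → κ → σ}
    (he : Function.Injective fun q : ι × κ => e q.1 q.2) (hZ : ∀ i c, e i c ∉ Z)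
    (hcard : Fintype.card ι ≤ Fintype.card κ + 1) (i₁ : ι) :
    ∃ l : ι → MvPolynomial σ ℂ, (∀ c, ∑ i, l i * X (e i c) ∈ genIdeal Z e) ∧
      l i₁ ∉ genIdeal Z e := by
  classical
  have hemb : Fintype.card {i // i ≠ i₁} ≤ Fintype.card κ := by
    rw [Fintype.card_subtype_compl, Fintype.card_subtype_eq]
    omega
  obtain ⟨g⟩ := Function.Embedding.nonempty_of_card_le hemb
  let B : Matrix ι ι (MvPolynomial σ ℂ) := Matrix.of fun i k =>
    if hk : k = i₁ then 0 else X (e i (g ⟨k, hk⟩))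
  have hsum : ∀ w : ι → MvPolynomial σ ℂ,
      ∑ i, B.adjugate i₁ i * w i = (B.updateCol i₁ w).det := by
    intro w
    rw [← Matrix.cramer_apply, Matrix.cramer_eq_adjugate_mulVec]
    rfl
  refine ⟨fun i => B.adjugate i₁ i, fun c => ?_, fun hmem => ?_⟩
  · rw [hsum]
    refine maxMinors_le_genIdeal Z e ?_
    rw [maxMinors_eq_span_submatrix]
    refine Ideal.subset_span ⟨fun k => if hk : k = i₁ then c else g ⟨k, hk⟩, ?_⟩
    change Matrix.det _ = _
    congr 1
    ext1 i k
    by_cases hk : k = i₁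
    · subst hk
      simp [genMat]
    · simp [genMat, B, hk]
  · let x : σ → ℂ := fun v => if ∃ k : {i // i ≠ i₁}, e k (g k) = v then 1 else 0
    have hx : ∀ i (k : {i // i ≠ i₁}), x (e i (g k)) = if i = k then 1 else 0 := by
      intro i k
      by_cases hik : i = k
      · subst hik
        simp only [x, if_true]
        exact if_pos ⟨k, rfl⟩
      · rw [if_neg hik]
        refine if_neg ?_
        rintro ⟨k', hk'⟩
        have h1 := @he (k', g k') (i, g k) hk'
        have h2 : k' = k := g.injective (congrArg Prod.snd h1)
        exact hik ((congrArg Prod.fst h1).symm.trans (congrArg Subtype.val h2))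
    have hx1 : ∀ c, x (e i₁ c) = 0 := by
      intro c
      refine if_neg ?_
      rintro ⟨k', hk'⟩
      exact k'.2 (congrArg Prod.fst (@he (k', g k') (i₁, c) hk'))
    have := genIdeal_le_ker (eval x) (Z := Z) (e := e)
      (fun u hu => by
        rw [eval_X]
        refine if_neg ?_
        rintro ⟨k', rfl⟩
        exact hZ _ _ hu)
      (Pi.single i₁ 1) (by simp) (fun c => by
        rw [Finset.sum_eq_single i₁ (fun b _ hb => by simp [hb]) (by simp)]
        rw [eval_X, hx1, mul_zero]) hmem
    rw [RingHom.mem_ker] at this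
    have h2 := hsum (Pi.single i₁ 1)
    rw [Finset.sum_eq_single i₁ (fun b _ hb => by simp [hb]) (by simp), Pi.single_eq_same,
      mul_one] at h2
    change eval x (B.adjugate i₁ i₁) = 0 at this
    rw [h2, RingHom.map_det] at this
    have h3 : (eval x).mapMatrix (B.updateCol i₁ (Pi.single i₁ 1)) = 1 := by
      ext i k
      by_cases hk : k = i₁
      · subst hk
        by_cases hi : i = k
        · subst hi; simp
        · simp [hi]
      · simp [B, hk, hx, Matrix.one_apply]
    rw [h3, Matrix.det_one] at this
    exact one_ne_zero this

/-- Adding a multiple of row `i₁` to row `i₀` moves off `{X (e i₀ c₀) = 0}`. -/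
theorem eq_zero_of_rowArc {S : Type*} [CommRing S] [IsDomain S] [Algebra ℂ S]
    (q : MvPolynomial σ ℂ →ₐ[ℂ] S) {Z : Set σ} {e : ι → κ → σ}
    (he : Function.Injective fun q : ι × κ => e q.1 q.2) {i₀ i₁ : ι} (hi : i₁ ≠ i₀) (c₀ : κ)
    (hZ : ∀ c, e i₀ c ∉ Z) (hq : genIdeal Z e ≤ RingHom.ker q) (hy : q (X (e i₀ c₀)) = 0)
    (hz : q (X (e i₁ c₀)) ≠ 0) {f : MvPolynomial σ ℂ} {N : ℕ}
    (hf : X (e i₀ c₀) ^ N * f ∈ genIdeal Z e) : q f = 0 := by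
  classical
  let u : σ → Polynomial S := fun v => if h : ∃ c, e i₀ c = v then
    Polynomial.X * Polynomial.C (q (X (e i₁ h.choose))) else 0
  have hu1 : ∀ c, u (e i₀ c) = Polynomial.X * Polynomial.C (q (X (e i₁ c))) := by
    intro c
    have h : ∃ c', e i₀ c' = e i₀ c := ⟨c, rfl⟩
    have h2 : h.choose = c := congrArg Prod.snd (@he (i₀, h.choose) (i₀, c) h.choose_spec)
    simp only [u, dif_pos h, h2]
  have hu2 : ∀ v, (∀ c, e i₀ c ≠ v) → u v = 0 := fun v hv => dif_neg (by simpa using hv)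
  let χ : MvPolynomial σ ℂ →ₐ[ℂ] Polynomial S := aeval fun v => Polynomial.C (q (X v)) + u v
  have hχ : ∀ v, χ (X v) = Polynomial.C (q (X v)) + u v := fun v => aeval_X _ v
  refine eq_zero_of_arc q χ (genIdeal_le (fun v hv => ?_) ?_) (fun v => ?_) ?_ hf
  · change χ _ = 0
    rw [hχ, hu2 _ fun c hc => hZ c (hc ▸ hv), show q (X v) = 0 from hq (X_mem_genIdeal e hv)]
    simp
  · refine maxMinors_le_ker_of_mul_left (χ : MvPolynomial σ ℂ →+* Polynomial S)
      (Polynomial.C.comp (q : MvPolynomial σ ℂ →+* S)) (genMat e)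
      (Matrix.transvection i₀ i₁ Polynomial.X) ?_ fun f hf => ?_
    · ext1 i c
      by_cases h : i = i₀
      · subst h
        rw [Matrix.transvection_mul_apply_same]
        simp [genMat, hχ, hu1]
      · rw [Matrix.transvection_mul_apply_of_ne _ _ _ _ h]
        have := hu2 (e i c) fun c' hc' => h (congrArg Prod.fst (@he (i₀, c') (i, c) hc')).symm
        simp [genMat, hχ, this]
    · have : q f = 0 := hq (maxMinors_le_genIdeal Z e hf)
      simp [RingHom.mem_ker, this]
  · rw [hχ]
    by_cases h : ∃ c, e i₀ c = v
    · obtain ⟨c, rfl⟩ := h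
      simp [hu1]
    · rw [hu2 v (by simpa using h)]
      simp
  · rw [hχ, hy, hu1]
    simpa using hz

/-- If column `c₀` has exactly two nonzero entries, these can be deformed along a left kernel
vector of the remaining columns. -/
theorem eq_zero_of_columnArc {S : Type*} [CommRing S] [IsDomain S] [Algebra ℂ S]
    (q : MvPolynomial σ ℂ →ₐ[ℂ] S) {Z : Set σ} {e : ι → κ → σ}
    (he : Function.Injective fun q : ι × κ => e q.1 q.2) {i₀ i₁ : ι} (hi : i₁ ≠ i₀) (c₀ : κ)
    (h₀ : e i₀ c₀ ∉ Z) (h₁ : e i₁ c₀ ∉ Z) (hZ : ∀ i, i ≠ i₀ → i ≠ i₁ → e i c₀ ∈ Z)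
    (hq : ∀ v ∈ Z, q (X v) = 0) (hy : q (X (e i₀ c₀)) = 0) (hz : q (X (e i₁ c₀)) = 0)
    (l : ι → S) (hl : l i₁ ≠ 0) (hlc : ∀ c, c ≠ c₀ → ∑ i, l i * q (X (e i c)) = 0)
    {f : MvPolynomial σ ℂ} {N : ℕ} (hf : X (e i₀ c₀) ^ N * f ∈ genIdeal Z e) : q f = 0 := by
  classical
  have hne : e i₁ c₀ ≠ e i₀ c₀ := fun h => hi (congrArg Prod.fst (@he (i₁, c₀) (i₀, c₀) h))
  let u : σ → Polynomial S := fun v => if v = e i₀ c₀ then Polynomial.X * Polynomial.C (l i₁) else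
    if v = e i₁ c₀ then -(Polynomial.X * Polynomial.C (l i₀)) else Polynomial.C (q (X v))
  let χ : MvPolynomial σ ℂ →ₐ[ℂ] Polynomial S := aeval u
  have hχ : ∀ v, χ (X v) = u v := fun v => aeval_X _ v
  have hχ0 : χ (X (e i₀ c₀)) = Polynomial.X * Polynomial.C (l i₁) := by
    rw [hχ]; exact if_pos rfl
  have hχ1 : χ (X (e i₁ c₀)) = -(Polynomial.X * Polynomial.C (l i₀)) := by
    rw [hχ]; exact (if_neg hne).trans (if_pos rfl)
  have hχ2 : ∀ v, v ≠ e i₀ c₀ → v ≠ e i₁ c₀ → χ (X v) = Polynomial.C (q (X v)) := by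
    intro v h h'
    rw [hχ]; exact (if_neg h).trans (if_neg h')
  have hχZ : ∀ v ∈ Z, χ (X v) = 0 := by
    intro v hv
    rw [hχ2 v (fun h => h₀ (h ▸ hv)) (fun h => h₁ (h ▸ hv)), hq v hv, map_zero]
  refine eq_zero_of_arc q χ (genIdeal_le_ker (χ : MvPolynomial σ ℂ →+* Polynomial S) hχZ
    (fun i => Polynomial.C (l i)) ?_ fun c => ?_) (fun v => ?_) ?_ hf
  · intro h
    exact hl (by simpa using congrFun h i₁)
  · by_cases hc : c = c₀
    · subst hc
      rw [← Finset.add_sum_erase _ _ (Finset.mem_univ i₀), ← Finset.add_sum_erase _ _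
        (Finset.mem_erase.2 ⟨hi, Finset.mem_univ i₁⟩), Finset.sum_eq_zero]
      · simp only [RingHom.coe_coe, hχ0, hχ1]
        ring
      · intro i hmem
        simp only [Finset.mem_erase, Finset.mem_univ, and_true] at hmem
        simp only [RingHom.coe_coe, hχZ _ (hZ i hmem.2 hmem.1), mul_zero]
    · have h1 : ∀ i, χ (X (e i c)) = Polynomial.C (q (X (e i c))) := fun i =>
        hχ2 _ (fun h => hc (congrArg Prod.snd (@he (i, c) (i₀, c₀) h)))
          (fun h => hc (congrArg Prod.snd (@he (i, c) (i₁, c₀) h)))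
      simp only [RingHom.coe_coe, h1, ← map_mul, ← map_sum]
      rw [hlc c hc, map_zero]
  · by_cases h : v = e i₀ c₀
    · subst h
      rw [hχ0, hy]; simp
    · by_cases h' : v = e i₁ c₀
      · subst h'
        rw [hχ1, hz]; simp
      · rw [hχ2 v h h']; simp
  · rw [hχ0]
    simpa using hl

end Primality

section SingleColumn

variable {σ ι κ : Type} [Fintype ι] [Fintype κ] [DecidableEq ι] [DecidableEq κ]

/-- A column whose only nonzero entry lies in the deleted row can be dropped. -/
theorem genIdeal_le_deleteRow {Z : Set σ} {e : ι → κ → σ} {i₁ : ι} {c₀ : κ}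
    (hZ : ∀ i, i ≠ i₁ → e i c₀ ∈ Z) :
    genIdeal Z e ≤ genIdeal Z fun (i : {i // i ≠ i₁}) (c : {c // c ≠ c₀}) => e i c := by
  set A := genIdeal Z fun (i : {i // i ≠ i₁}) (c : {c // c ≠ c₀}) => e i c with hA
  refine genIdeal_le (fun v hv => X_mem_genIdeal _ hv) ?_
  have h := maxMinors_le_ker_of_rows (Ideal.Quotient.mk A) (isUnit_natCast_factorial _ _)
    (genMat e) (genMat fun (i : {i // i ≠ i₁}) (c : {c // c ≠ c₀}) => e i c)
    Subtype.val Subtype.val_injective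
    (Matrix.of fun c' c => if (c' : κ) = c then 1 else 0) (fun i c => ?_) ?_
  · rwa [Ideal.mk_ker] at h
  · by_cases hc : c = c₀
    · subst hc
      rw [Finset.sum_eq_zero fun c' _ => by simp [c'.2]]
      exact Ideal.Quotient.eq_zero_iff_mem.2 (X_mem_genIdeal _ (hZ i i.2))
    · rw [Finset.sum_eq_single ⟨c, hc⟩]
      · simp [genMat]
      · intro b _ hb
        have : (b : κ) ≠ c := fun h => hb (Subtype.ext h)
        simp [this]
      · simp
  · rw [Ideal.mk_ker]
    exact maxMinors_le_genIdeal _ _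

theorem genIdeal_le_deleteColumn {Z : Set σ} {e : ι → κ → σ} {c₀ : κ}
    (hZ : ∀ i, e i c₀ ∈ Z) :
    genIdeal Z e ≤ genIdeal Z fun (i : ι) (c : {c // c ≠ c₀}) => e i c := by
  set A := genIdeal Z fun (i : ι) (c : {c // c ≠ c₀}) => e i c with hA
  refine genIdeal_le (fun v hv => X_mem_genIdeal _ hv) ?_
  have h := maxMinors_le_ker_of_rows (Ideal.Quotient.mk A) (isUnit_natCast_factorial _ _)
    (genMat e) (genMat fun (i : ι) (c : {c // c ≠ c₀}) => e i c)
    id Function.injective_id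
    (Matrix.of fun c' c => if (c' : κ) = c then 1 else 0) (fun i c => ?_) ?_
  · rwa [Ideal.mk_ker] at h
  · by_cases hc : c = c₀
    · subst hc
      rw [Finset.sum_eq_zero fun c' _ => by simp [c'.2]]
      exact Ideal.Quotient.eq_zero_iff_mem.2 (X_mem_genIdeal _ (hZ i))
    · rw [Finset.sum_eq_single ⟨c, hc⟩]
      · simp [genMat]
      · intro b _ hb
        have : (b : κ) ≠ c := fun h => hb (Subtype.ext h)
        simp [this]
      · simp
  · rw [Ideal.mk_ker]
    exact maxMinors_le_genIdeal _ _

theorem genIdeal_columns_le {κ' : Type} [Fintype κ'] [DecidableEq κ'] (Z : Set σ)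
    (e : ι → κ → σ) (g : κ' → κ) :
    genIdeal Z (fun i c => e i (g c)) ≤ genIdeal Z e := by
  refine genIdeal_le (fun v hv => X_mem_genIdeal _ hv) (le_trans ?_ (maxMinors_le_genIdeal Z e))
  have : genMat (fun i c => e i (g c)) = (genMat e).submatrix id g := rfl
  rw [this, submatrix_eq_mul_selection]
  exact maxMinors_mul_right_le _ _

/-- Adding the last nonzero entry of a column removes the column. -/
theorem genIdeal_insert_eq_deleteColumn {Z : Set σ} {e : ι → κ → σ} {i₁ : ι} {c₀ : κ}
    (hZ : ∀ i, i ≠ i₁ → e i c₀ ∈ Z) :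
    (genIdeal (insert (e i₁ c₀) Z) fun (i : ι) (c : {c // c ≠ c₀}) => e i c) =
      genIdeal Z e ⊔ Ideal.span {X (e i₁ c₀)} := by
  rw [← genIdeal_insert]
  refine le_antisymm (genIdeal_columns_le _ _ _) (genIdeal_le_deleteColumn fun i => ?_)
  by_cases h : i = i₁
  · exact h ▸ Set.mem_insert _ _
  · exact Set.mem_insert_of_mem _ (hZ i h)

theorem mul_mem_genIdeal_of_mem_deleteRow {Z : Set σ} {e : ι → κ → σ} {i₁ : ι} {c₀ : κ}
    (hZ : ∀ i, i ≠ i₁ → e i c₀ ∈ Z) {h : MvPolynomial σ ℂ}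
    (hh : h ∈ genIdeal Z fun (i : {i // i ≠ i₁}) (c : {c // c ≠ c₀}) => e i c) :
    X (e i₁ c₀) * h ∈ genIdeal Z e := by
  obtain ⟨a, ha, b, hb, rfl⟩ := Submodule.mem_sup.1 hh
  rw [mul_add]
  refine add_mem (Ideal.mul_mem_left _ _ (Ideal.mem_sup_left ha)) ?_
  have := map_mul_eq_zero_of_corner (Ideal.Quotient.mk (genIdeal Z e)) (genMat e) i₁ c₀
    (fun i hi => Ideal.Quotient.eq_zero_iff_mem.2 (X_mem_genIdeal e (hZ i hi)))
    (by rw [Ideal.mk_ker]; exact maxMinors_le_genIdeal _ _) hb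
  exact Ideal.Quotient.eq_zero_iff_mem.1 this

theorem inf_le_genIdeal {Z : Set σ} {e : ι → κ → σ} {i₁ : ι} {c₀ : κ}
    (hZ : ∀ i, i ≠ i₁ → e i c₀ ∈ Z)
    (hA : (genIdeal Z fun (i : {i // i ≠ i₁}) (c : {c // c ≠ c₀}) => e i c).IsPrime)
    (hz : X (e i₁ c₀) ∉ genIdeal Z fun (i : {i // i ≠ i₁}) (c : {c // c ≠ c₀}) => e i c)
    {f : MvPolynomial σ ℂ}
    (hfA : f ∈ genIdeal Z fun (i : {i // i ≠ i₁}) (c : {c // c ≠ c₀}) => e i c)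
    (hfC : f ∈ genIdeal (insert (e i₁ c₀) Z) fun (i : ι) (c : {c // c ≠ c₀}) => e i c) :
    f ∈ genIdeal Z e := by
  rw [genIdeal_insert_eq_deleteColumn hZ] at hfC
  obtain ⟨b, hb, w, hw, rfl⟩ := Submodule.mem_sup.1 hfC
  obtain ⟨h, rfl⟩ := Ideal.mem_span_singleton.1 hw
  refine add_mem hb (mul_mem_genIdeal_of_mem_deleteRow hZ ?_)
  have h1 := (Ideal.add_mem_iff_right _ (genIdeal_le_deleteRow hZ hb)).1 hfA
  exact (hA.mem_or_mem h1).resolve_left hz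

end SingleColumn

section Prime

/-- Graded Nakayama: the saturation with respect to a variable is trivial as soon as it is
trivial modulo the variable. -/
theorem le_genIdeal_of_le_insert {σ ι κ : Type} [Fintype ι] [Fintype κ] [DecidableEq ι]
    [DecidableEq κ] [Finite σ] {Z : Set σ} {e : ι → κ → σ} {v : σ}
    {P : Ideal (MvPolynomial σ ℂ)} (hP : P.IsPrime) (hle : genIdeal Z e ≤ P) (hv : X v ∉ P)
    (h : P ≤ genIdeal (insert v Z) e) : P ≤ genIdeal Z e := by
  have h1 : P ≤ genIdeal Z e ⊔ Ideal.span {(X v : MvPolynomial σ ℂ)} • P := by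
    intro f hf
    have := h hf
    rw [genIdeal_insert] at this
    obtain ⟨b, hb, w, hw, rfl⟩ := Submodule.mem_sup.1 this
    obtain ⟨g, rfl⟩ := Ideal.mem_span_singleton.1 hw
    refine add_mem (Ideal.mem_sup_left hb) (Ideal.mem_sup_right ?_)
    refine Ideal.mul_mem_mul (Ideal.mem_span_singleton_self _) ?_
    exact (hP.mem_or_mem ((Ideal.add_mem_iff_right _ (hle hb)).1 hf)).resolve_left hv
  obtain ⟨r, hr, hrP⟩ := Submodule.exists_sub_one_mem_and_smul_le_of_fg_of_le_sup
    (IsNoetherian.noetherian P) (le_refl P) h1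
  intro f hf
  refine mem_genIdeal_of_mul_mem (u := r) ?_ (hrP (Submodule.smul_mem_pointwise_smul _ _ _ hf))
  obtain ⟨g, hg⟩ := Ideal.mem_span_singleton.1 hr
  have : r = 1 + X v * g := by rw [← hg]; ring
  simp [this]

end Prime

section Prime

variable {σ ι κ : Type} [Fintype ι] [Fintype κ] [DecidableEq ι] [DecidableEq κ]

theorem injective_submatrix {ι' κ' : Type} {e : ι → κ → σ}
    (he : Function.Injective fun q : ι × κ => e q.1 q.2) {f : ι' → ι} {g : κ' → κ}
    (hf : Function.Injective f) (hg : Function.Injective g) :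
    Function.Injective fun q : ι' × κ' => e (f q.1) (g q.2) := by
  intro a b h
  have := @he (f a.1, g a.2) (f b.1, g b.2) h
  exact Prod.ext (hf (congrArg Prod.fst this)) (hg (congrArg Prod.snd this))

theorem genIdeal_isPrime_of_saturated [Finite σ] {Z : Set σ} {e : ι → κ → σ}
    (he : Function.Injective fun q : ι × κ => e q.1 q.2) {i₀ i₁ : ι} (hi : i₁ ≠ i₀) (c₀ : κ)
    (hZ : ∀ i c, c ≠ c₀ → e i c ∉ Z) (h₀ : e i₀ c₀ ∉ Z)
    (hQ : (genIdeal Z fun (i : {i // i ≠ i₀}) (c : {c // c ≠ c₀}) => e i.1 c).IsPrime)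
    (h : ∀ (f : MvPolynomial σ ℂ) (N : ℕ), X (e i₀ c₀) ^ N * f ∈ genIdeal Z e →
      f ∈ genIdeal (insert (e i₀ c₀) Z) e) : (genIdeal Z e).IsPrime := by
  have : Nonempty {i // i ≠ i₀} := ⟨⟨i₁, hi⟩⟩
  obtain ⟨P, hP, hle, hv, hsat⟩ := exists_prime_saturation he i₀ c₀ (fun i c _ hc => hZ i c hc) hQ
    (X_notMem_genIdeal (injective_submatrix he Subtype.val_injective Subtype.val_injective) h₀
      (Or.inl fun i c hic => i.2 (congrArg Prod.fst (@he (i.1, c.1) (i₀, c₀) hic))))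
  have h1 : P ≤ genIdeal Z e := le_genIdeal_of_le_insert hP hle hv fun f hf => by
    obtain ⟨N, hN⟩ := hsat f hf
    exact h f N hN
  rwa [← le_antisymm h1 hle]

theorem genIdeal_isPrime_of_column [Finite σ] {e : ι → κ → σ}
    (he : Function.Injective fun q : ι × κ => e q.1 q.2)
    (c₀ : κ) (hcard : Fintype.card ι ≤ Fintype.card κ)
    (hA : ∀ Z i₀, (∀ i c, c ≠ c₀ → e i c ∉ Z) → 2 ≤ Fintype.card ι →
      (genIdeal Z fun (i : {i // i ≠ i₀}) (c : {c // c ≠ c₀}) => e i.1 c).IsPrime)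
    (hC : ∀ Z, (∀ i c, c ≠ c₀ → e i c ∉ Z) →
      (genIdeal Z fun (i : ι) (c : {c // c ≠ c₀}) => e i c).IsPrime) (r : ℕ) :
    ∀ Z : Set σ, (∀ i c, c ≠ c₀ → e i c ∉ Z) →
      {i | e i c₀ ∉ Z}.ncard = r + 2 →
      (genIdeal Z e).IsPrime := by
  classical
  have hval : Function.Injective (Subtype.val : {c // c ≠ c₀} → κ) := Subtype.val_injective
  induction r with
  | zero =>
    intro Z hZ hr
    obtain ⟨i₀, i₁, hne, hS⟩ := Set.ncard_eq_two.1 hr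
    have h₀ : e i₀ c₀ ∉ Z := by
      have : i₀ ∈ {i | e i c₀ ∉ Z} := hS ▸ Set.mem_insert _ _
      exact this
    have h₁ : e i₁ c₀ ∉ Z := by
      have : i₁ ∈ {i | e i c₀ ∉ Z} := hS ▸ Set.mem_insert_of_mem _ rfl
      exact this
    have h2 : ∀ i, i ≠ i₀ → i ≠ i₁ → e i c₀ ∈ Z := by
      intro i hi hi'
      by_contra hc
      have : i ∈ ({i₀, i₁} : Set ι) := hS ▸ hc
      rcases this with h | h
      · exact hi h
      · exact hi' h
    have hcard2 : 2 ≤ Fintype.card ι := Fintype.one_lt_card_iff.2 ⟨i₀, i₁, hne⟩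
    refine genIdeal_isPrime_of_saturated he hne.symm c₀ hZ h₀ (hA Z i₀ hZ hcard2) fun f N hf => ?_
    set Z' := insert (e i₀ c₀) Z with hZ'
    have hne' : ∀ i c i', (i ≠ i' ∨ c ≠ c₀) → e i c ≠ e i' c₀ := by
      intro i c i' h hh
      have := @he (i, c) (i', c₀) hh
      rcases h with h | h
      · exact h (congrArg Prod.fst this)
      · exact h (congrArg Prod.snd this)
    have hZc : ∀ i c, c ≠ c₀ → e i c ∉ Z' := by
      intro i c hc hmem
      rcases hmem with h | h
      · exact hne' _ _ _ (Or.inr hc) h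
      · exact hZ i c hc h
    have hz : e i₁ c₀ ∉ Z' := by
      rintro (h | h)
      · exact hne' _ _ _ (Or.inl hne.symm) h
      · exact h₁ h
    have hcol : ∀ i, i ≠ i₁ → e i c₀ ∈ Z' := by
      intro i hi
      by_cases h : i = i₀
      · exact h ▸ Set.mem_insert _ _
      · exact Set.mem_insert_of_mem _ (h2 i h hi)
    have hpA := hA Z' i₁ hZc hcard2
    have : Nonempty {i // i ≠ i₁} := ⟨⟨i₀, hne⟩⟩
    have hzA := X_notMem_genIdeal (e := fun (i : {i // i ≠ i₁}) (c : {c // c ≠ c₀}) => e i.1 c)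
      (injective_submatrix he Subtype.val_injective Subtype.val_injective) hz
      (Or.inl fun i c => hne' _ _ _ (Or.inr c.2))
    refine inf_le_genIdeal hcol hpA hzA ?_ ?_
    · let q := Ideal.Quotient.mkₐ ℂ (genIdeal Z' fun (i : {i // i ≠ i₁}) (c : {c // c ≠ c₀}) => e i.1 c)
      refine Ideal.Quotient.eq_zero_iff_mem.1 (eq_zero_of_rowArc q he hne.symm c₀ (fun c => ?_)
        (fun f hf => Ideal.Quotient.eq_zero_iff_mem.2 (genIdeal_le_deleteRow hcol
          (genIdeal_mono (Set.subset_insert _ _) e hf)))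
        (Ideal.Quotient.eq_zero_iff_mem.2 (X_mem_genIdeal _ (Set.mem_insert _ _)))
        (fun h => hzA (Ideal.Quotient.eq_zero_iff_mem.1 h)) hf)
      by_cases hc : c = c₀
      · exact hc ▸ h₀
      · exact hZ i₀ c hc
    · have hZ2 : ∀ i c, c ≠ c₀ → e i c ∉ insert (e i₁ c₀) Z' := by
        intro i c hc hmem
        rcases hmem with h | h
        · exact hne' _ _ _ (Or.inr hc) h
        · exact hZc i c hc h
      have hpC := hC (insert (e i₁ c₀) Z') hZ2
      let q := Ideal.Quotient.mkₐ ℂ (genIdeal (insert (e i₁ c₀) Z') fun (i : ι) (c : {c // c ≠ c₀}) => e i c)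
      have hqZ : ∀ v ∈ insert (e i₁ c₀) Z', q (X v) = 0 := fun v hv =>
        Ideal.Quotient.eq_zero_iff_mem.2 (X_mem_genIdeal _ hv)
      obtain ⟨l, hl, hl1⟩ := exists_kernelVector (Z := insert (e i₁ c₀) Z')
        (e := fun (i : ι) (c : {c // c ≠ c₀}) => e i c)
        (injective_submatrix he Function.injective_id Subtype.val_injective)
        (fun i c => hZ2 i c c.2) (by
          rw [Fintype.card_subtype_compl, Fintype.card_subtype_eq]; omega) i₁
      refine Ideal.Quotient.eq_zero_iff_mem.1 (eq_zero_of_columnArc q he hne.symm c₀ h₀ h₁ h2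
        (fun v hv => hqZ v (Set.mem_insert_of_mem _ (Set.mem_insert_of_mem _ hv)))
        (hqZ _ (Set.mem_insert_of_mem _ (Set.mem_insert _ _))) (hqZ _ (Set.mem_insert _ _))
        (fun i => q (l i)) (fun h => hl1 (Ideal.Quotient.eq_zero_iff_mem.1 h)) (fun c hc => ?_) hf)
      have := hl ⟨c, hc⟩
      rw [← Ideal.Quotient.eq_zero_iff_mem, map_sum] at this
      simp only [map_mul] at this
      exact this
  | succ r ih =>
    intro Z hZ hr
    obtain ⟨i₀, h₀, i₁, h₁, hne⟩ := (Set.one_lt_ncard (Set.toFinite _)).1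
      (show 1 < {i | e i c₀ ∉ Z}.ncard by omega)
    have hcard2 : 2 ≤ Fintype.card ι := Fintype.one_lt_card_iff.2 ⟨i₀, i₁, hne⟩
    refine genIdeal_isPrime_of_saturated he hne.symm c₀ hZ h₀ (hA Z i₀ hZ hcard2) fun f N hf => ?_
    have hp := ih (insert (e i₀ c₀) Z) (fun i c hc hmem => by
      rcases hmem with h | h
      · exact hc (congrArg Prod.snd (@he (i, c) (i₀, c₀) h))
      · exact hZ i c hc h) (by
      have : {i | e i c₀ ∉ insert (e i₀ c₀) Z} = {i | e i c₀ ∉ Z} \ {i₀} := by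
        ext i
        simp only [Set.mem_insert_iff, not_or, Set.mem_ofPred_eq, Set.mem_sdiff,
          Set.mem_singleton_iff]
        refine ⟨fun h => ⟨h.2, fun hi => h.1 (hi ▸ rfl)⟩, fun h => ⟨fun hh => h.2 ?_, h.1⟩⟩
        exact congrArg Prod.fst (@he (i, c₀) (i₀, c₀) hh)
      rw [this, Set.ncard_sdiff_singleton_of_mem h₀]
      omega)
    have : Nonempty ι := ⟨i₀⟩
    have hz : X (e i₁ c₀) ∉ genIdeal (insert (e i₀ c₀) Z) e := X_notMem_genIdeal he (by
      rintro (h | h)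
      · exact hne (congrArg Prod.fst (@he (i₁, c₀) (i₀, c₀) h)).symm
      · exact h₁ h) (Or.inr hcard2)
    let q := Ideal.Quotient.mkₐ ℂ (genIdeal (insert (e i₀ c₀) Z) e)
    refine Ideal.Quotient.eq_zero_iff_mem.1 (eq_zero_of_rowArc q he hne.symm c₀ (fun c => ?_)
        (fun f hf => Ideal.Quotient.eq_zero_iff_mem.2
          (genIdeal_mono (Set.subset_insert _ _) e hf))
        (Ideal.Quotient.eq_zero_iff_mem.2 (X_mem_genIdeal _ (Set.mem_insert _ _)))
        (fun h => hz (Ideal.Quotient.eq_zero_iff_mem.1 h)) hf)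
    by_cases hc : c = c₀
    · exact hc ▸ h₀
    · exact hZ i₀ c hc

theorem genIdeal_isPrime_aux [Finite σ] (N : ℕ) : ∀ (ι κ : Type) [Fintype ι] [Fintype κ]
    [DecidableEq ι] [DecidableEq κ] (Z : Set σ) (e : ι → κ → σ),
    (Function.Injective fun q : ι × κ => e q.1 q.2) → (∀ i c, e i c ∉ Z) → 1 ≤ Fintype.card ι →
    Fintype.card ι ≤ Fintype.card κ + 1 → Fintype.card ι + Fintype.card κ ≤ N →
    (genIdeal Z e).IsPrime := by
  induction N with
  | zero => intro ι κ _ _ _ _ Z e _ _ h1 _ h3; omega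
  | succ N ih =>
    intro ι κ _ _ _ _ Z e he hZ h1 h2 h3
    rcases h1.eq_or_lt with h1' | h1'
    · rw [genIdeal_of_card_eq_one Z e h1'.symm]
      exact isPrime_span_X _
    rcases h2.eq_or_lt with h2' | h2'
    · rw [genIdeal_of_card_lt Z e (by omega)]
      exact isPrime_span_X _
    have : Nonempty κ := Fintype.card_pos_iff.1 (by omega)
    obtain ⟨c₀⟩ := this
    have hκ : Fintype.card {c // c ≠ c₀} = Fintype.card κ - 1 := by
      rw [Fintype.card_subtype_compl, Fintype.card_subtype_eq]
    refine genIdeal_isPrime_of_column he c₀ (by omega) (fun Z i₀ hZ' _ => ?_) (fun Z hZ' => ?_)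
      (Fintype.card ι - 2) Z (fun i c _ => hZ i c) ?_
    · have hι : Fintype.card {i // i ≠ i₀} = Fintype.card ι - 1 := by
        rw [Fintype.card_subtype_compl, Fintype.card_subtype_eq]
      exact ih _ _ _ _ (injective_submatrix he Subtype.val_injective Subtype.val_injective)
        (fun i c => hZ' i c c.2) (by omega) (by omega) (by omega)
    · exact ih _ _ _ _ (injective_submatrix he Function.injective_id Subtype.val_injective)
        (fun i c => hZ' i c c.2) (by omega) (by omega) (by omega)
    · have : {i | e i c₀ ∉ Z} = Set.univ := Set.eq_univ_of_forall fun i => hZ i c₀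
      rw [this, Set.ncard_univ, Nat.card_eq_fintype_card]
      omega

theorem genIdeal_isPrime [Finite σ] {Z : Set σ} {e : ι → κ → σ}
    (he : Function.Injective fun q : ι × κ => e q.1 q.2) (hZ : ∀ i c, e i c ∉ Z)
    (h1 : 1 ≤ Fintype.card ι) (h2 : Fintype.card ι ≤ Fintype.card κ + 1) :
    (genIdeal Z e).IsPrime :=
  genIdeal_isPrime_aux _ ι κ Z e he hZ h1 h2 le_rfl

/-- One column may be partially zero as long as two nonzero entries remain. -/
theorem genIdeal_isPrime_of_two_le_ncard [Finite σ] {Z : Set σ} {e : ι → κ → σ}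
    (he : Function.Injective fun q : ι × κ => e q.1 q.2) (c₀ : κ)
    (hZ : ∀ i c, c ≠ c₀ → e i c ∉ Z) (hr : 2 ≤ {i | e i c₀ ∉ Z}.ncard)
    (hcard : Fintype.card ι ≤ Fintype.card κ) : (genIdeal Z e).IsPrime := by
  have hκ : Fintype.card {c // c ≠ c₀} = Fintype.card κ - 1 := by
    rw [Fintype.card_subtype_compl, Fintype.card_subtype_eq]
  have hκ0 : 0 < Fintype.card κ := Fintype.card_pos_iff.2 ⟨c₀⟩
  obtain ⟨i, -, -⟩ := (Set.one_lt_ncard (Set.toFinite _)).1 hr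
  have hι0 : 0 < Fintype.card ι := Fintype.card_pos_iff.2 ⟨i⟩
  refine genIdeal_isPrime_of_column he c₀ hcard (fun Z i₀ hZ' h2 => ?_) (fun Z hZ' => ?_)
    ({i | e i c₀ ∉ Z}.ncard - 2) Z hZ (by omega)
  · have hι : Fintype.card {i // i ≠ i₀} = Fintype.card ι - 1 := by
      rw [Fintype.card_subtype_compl, Fintype.card_subtype_eq]
    exact genIdeal_isPrime (injective_submatrix he Subtype.val_injective Subtype.val_injective)
      (fun i c => hZ' i c c.2) (by omega) (by omega)
  · exact genIdeal_isPrime (injective_submatrix he Function.injective_id Subtype.val_injective)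
      (fun i c => hZ' i c c.2) (by omega) (by omega)

end Prime

section Normality

theorem exists_eq_mul_pow_of_isIntegral {A S K : Type*} [CommRing A] [IsDomain A] [CommRing S]
    [Algebra A S] [Field K] [Algebra A K] [IsFractionRing A K] {y : A} (hy : y ≠ 0)
    [IsLocalization.Away y S] [IsIntegrallyClosed S] {x : K} (hx : IsIntegral A x) :
    ∃ (a : A) (N : ℕ), x * algebraMap A K (y ^ N) = algebraMap A K a := by
  have hM : Submonoid.powers y ≤ nonZeroDivisors A :=
    powers_le_nonZeroDivisors_of_noZeroDivisors hy
  let _ : Algebra S K := IsLocalization.localizationAlgebraOfSubmonoidLe S K _ _ hM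
  have _ : IsScalarTower A S K :=
    IsLocalization.localization_isScalarTower_of_submonoid_le S K _ _ hM
  have _ := IsFractionRing.isFractionRing_of_isDomain_of_isLocalization (Submonoid.powers y) S K
  obtain ⟨s, rfl⟩ := IsIntegrallyClosed.isIntegral_iff.1 (hx.tower_top (A := S))
  obtain ⟨⟨a, ⟨_, N, rfl⟩⟩, h⟩ := IsLocalization.surj (Submonoid.powers y) s
  refine ⟨a, N, ?_⟩
  rw [IsScalarTower.algebraMap_apply A S K, IsScalarTower.algebraMap_apply A S K, ← h, map_mul]

theorem isIntegrallyClosed_of_regular_pair {A S S' : Type*} [CommRing A] [IsDomain A] [CommRing S]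
    [Algebra A S] [CommRing S'] [Algebra A S'] {y z : A} (hy : y ≠ 0) (hz : z ≠ 0)
    [IsLocalization.Away y S] [IsLocalization.Away z S'] [IsIntegrallyClosed S]
    [IsIntegrallyClosed S'] (hyz : ∀ b, y ∣ z * b → y ∣ b) : IsIntegrallyClosed A := by
  have h1 : ∀ M b, y ∣ z ^ M * b → y ∣ b := by
    intro M
    induction M with
    | zero => simp
    | succ M ih =>
      intro b h
      refine ih b (hyz _ ?_)
      rwa [← mul_assoc, ← pow_succ']
  have h2 : ∀ N M b, y ^ N ∣ z ^ M * b → y ^ N ∣ b := by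
    intro N M
    induction N with
    | zero => simp
    | succ N ih =>
      intro b h
      obtain ⟨b, rfl⟩ := h1 M b ((dvd_pow_self y N.succ_ne_zero).trans h)
      rw [pow_succ'] at h ⊢
      refine mul_dvd_mul_left y (ih b ?_)
      rw [← mul_assoc, mul_comm (z ^ M), mul_assoc] at h
      exact (mul_dvd_mul_iff_left hy).1 h
  refine (isIntegrallyClosed_iff (FractionRing A)).2 fun {x} hx => ?_
  obtain ⟨a, N, ha⟩ := exists_eq_mul_pow_of_isIntegral (S := S) hy hx
  obtain ⟨b, M, hb⟩ := exists_eq_mul_pow_of_isIntegral (S := S') hz hx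
  have hinj := IsFractionRing.injective A (FractionRing A)
  have h3 : z ^ M * a = y ^ N * b := by
    apply hinj
    rw [map_mul, map_mul, ← ha, ← hb]
    ring
  obtain ⟨d, rfl⟩ := h2 N M a ⟨b, h3⟩
  refine ⟨d, ?_⟩
  rw [map_mul, mul_comm] at ha
  have : algebraMap A (FractionRing A) (y ^ N) ≠ 0 := by
    rw [Ne, map_eq_zero_iff _ hinj]
    exact pow_ne_zero N hy
  exact (mul_left_cancel₀ this ha).symm

theorem exists_isIntegrallyClosed_localization {R : Type} [CommRing R] {I Q : Ideal R} {y : R}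
    (T : Localization.Away y ≃+* Localization.Away y)
    (hT : (Q.map (algebraMap R (Localization.Away y))).map
      (T : Localization.Away y →+* Localization.Away y) = I.map (algebraMap R (Localization.Away y)))
    (hQ : Q.IsPrime) (hy : y ∉ Q) (hQc : IsIntegrallyClosed (R ⧸ Q)) :
    ∃ (S : Type) (_ : CommRing S) (_ : Algebra (R ⧸ I) S),
      IsLocalization.Away (Ideal.Quotient.mk I y) S ∧ IsIntegrallyClosed S := by
  have key : ∀ J : Ideal R, IsLocalization.Away (Ideal.Quotient.mk J y)
      (Localization.Away y ⧸ J.map (algebraMap R (Localization.Away y))) := by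
    intro J
    have : IsLocalization (Algebra.algebraMapSubmonoid (R ⧸ J) (Submonoid.powers y))
      (Localization.Away y ⧸ J.map (algebraMap R (Localization.Away y))) := inferInstance
    rw [Algebra.algebraMapSubmonoid, Submonoid.map_powers] at this
    exact this
  refine ⟨_, inferInstance, inferInstance, key I, ?_⟩
  have h1 := key Q
  have h2 : IsIntegrallyClosed (Localization.Away y ⧸ Q.map (algebraMap R (Localization.Away y))) :=
    isIntegrallyClosed_of_isLocalization _ (Submonoid.powers (Ideal.Quotient.mk Q y))
      (powers_le_nonZeroDivisors_of_noZeroDivisors fun h => hy (Ideal.Quotient.eq_zero_iff_mem.1 h))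
  exact IsIntegrallyClosed.of_equiv (Ideal.quotientEquiv _ _ T hT.symm)

theorem isIntegrallyClosed_quotient_of_pivots {R : Type} [CommRing R] {I Q Q' : Ideal R} {y z : R}
    (hI : I.IsPrime) (hyI : y ∉ I) (hzI : z ∉ I)
    (hQ : Q.IsPrime) (hy : y ∉ Q) (hQc : IsIntegrallyClosed (R ⧸ Q))
    (hT : ∃ T : Localization.Away y ≃+* Localization.Away y,
      (Q.map (algebraMap R (Localization.Away y))).map
      (T : Localization.Away y →+* Localization.Away y) = I.map (algebraMap R (Localization.Away y)))
    (hQ' : Q'.IsPrime) (hz : z ∉ Q') (hQc' : IsIntegrallyClosed (R ⧸ Q'))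
    (hT' : ∃ T : Localization.Away z ≃+* Localization.Away z,
      (Q'.map (algebraMap R (Localization.Away z))).map
      (T : Localization.Away z →+* Localization.Away z) = I.map (algebraMap R (Localization.Away z)))
    (hyz : ∀ f, z * f ∈ I ⊔ Ideal.span {y} → f ∈ I ⊔ Ideal.span {y}) :
    IsIntegrallyClosed (R ⧸ I) := by
  obtain ⟨T, hT⟩ := hT
  obtain ⟨T', hT'⟩ := hT'
  obtain ⟨S, _, _, _, _⟩ := exists_isIntegrallyClosed_localization T hT hQ hy hQc
  obtain ⟨S', _, _, _, _⟩ := exists_isIntegrallyClosed_localization T' hT' hQ' hz hQc'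
  have hdvd : ∀ f, Ideal.Quotient.mk I y ∣ Ideal.Quotient.mk I f ↔ f ∈ I ⊔ Ideal.span {y} := by
    intro f
    rw [sup_comm, Ideal.mem_span_singleton_sup]
    constructor
    · rintro ⟨g, hg⟩
      obtain ⟨g, rfl⟩ := Ideal.Quotient.mk_surjective g
      rw [← map_mul, Ideal.Quotient.eq] at hg
      exact ⟨g, f - y * g, hg, by ring⟩
    · rintro ⟨a, b, hb, rfl⟩
      rw [map_add, Ideal.Quotient.eq_zero_iff_mem.2 hb, add_zero, map_mul]
      exact dvd_mul_left _ _
  refine isIntegrallyClosed_of_regular_pair (S := S) (S' := S')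
    (fun h => hyI (Ideal.Quotient.eq_zero_iff_mem.1 h))
    (fun h => hzI (Ideal.Quotient.eq_zero_iff_mem.1 h)) fun b hb => ?_
  obtain ⟨f, rfl⟩ := Ideal.Quotient.mk_surjective b
  rw [← map_mul, hdvd] at hb
  exact (hdvd f).2 (hyz f hb)

variable {σ ι κ : Type} [Fintype ι] [Fintype κ] [DecidableEq ι] [DecidableEq κ]

theorem mem_genIdeal_insert_of_mul_mem [Finite σ] {Z : Set σ} {e : ι → κ → σ}
    (he : Function.Injective fun q : ι × κ => e q.1 q.2) (hZ : ∀ i c, e i c ∉ Z)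
    {i₀ i₁ : ι} (hi : i₁ ≠ i₀) {c₀ c₁ : κ} (hc : c₁ ≠ c₀)
    (hcard : Fintype.card ι ≤ Fintype.card κ) {f : MvPolynomial σ ℂ}
    (hf : X (e i₁ c₁) * f ∈ genIdeal (insert (e i₀ c₀) Z) e) :
    f ∈ genIdeal (insert (e i₀ c₀) Z) e := by
  have hne : ∀ i c i' c', (i ≠ i' ∨ c ≠ c') → e i c ≠ e i' c' := by
    intro i c i' c' h hh
    have := @he (i, c) (i', c') hh
    rcases h with h | h
    · exact h (congrArg Prod.fst this)
    · exact h (congrArg Prod.snd this)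
  have hcard2 : 2 ≤ Fintype.card ι := Fintype.one_lt_card_iff.2 ⟨i₁, i₀, hi⟩
  have : Nonempty ι := ⟨i₀⟩
  have hz : e i₁ c₁ ∉ insert (e i₀ c₀) Z := by
    rintro (h | h)
    · exact hne _ _ _ _ (Or.inl hi) h
    · exact hZ _ _ h
  have hZc : ∀ i c, (i ≠ i₀ ∨ c ≠ c₀) → e i c ∉ insert (e i₀ c₀) Z := by
    rintro i c hc (h | h)
    · exact hne _ _ _ _ hc h
    · exact hZ _ _ h
  rcases hcard2.eq_or_lt with h2 | h3
  · have huniv : ∀ i, i ≠ i₁ → i = i₀ := by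
      intro i hii
      by_contra h
      have := Fintype.two_lt_card_iff.2 ⟨i₁, i₀, i, hi, Ne.symm hii, Ne.symm h⟩
      omega
    have hcol : ∀ i, i ≠ i₁ → e i c₀ ∈ insert (e i₀ c₀) Z := fun i hi =>
      huniv i hi ▸ Set.mem_insert _ _
    have hι : Fintype.card {i // i ≠ i₁} = Fintype.card ι - 1 := by
      rw [Fintype.card_subtype_compl, Fintype.card_subtype_eq]
    have hκ : Fintype.card {c // c ≠ c₀} = Fintype.card κ - 1 := by
      rw [Fintype.card_subtype_compl, Fintype.card_subtype_eq]
    have heA := injective_submatrix he (f := (Subtype.val : {i // i ≠ i₁} → ι))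
      (g := (Subtype.val : {c // c ≠ c₀} → κ)) Subtype.val_injective Subtype.val_injective
    have heC := injective_submatrix he (f := (id : ι → ι))
      (g := (Subtype.val : {c // c ≠ c₀} → κ)) Function.injective_id Subtype.val_injective
    have hA := genIdeal_isPrime (Z := insert (e i₀ c₀) Z) heA
      (fun (i : {i // i ≠ i₁}) (c : {c // c ≠ c₀}) => hZc i c (Or.inr c.2))
      (by omega) (by omega)
    have hZC : ∀ i c, c ≠ c₀ → e i c ∉ insert (e i₁ c₀) (insert (e i₀ c₀) Z) := by
      rintro i c hc (h | h)
      · exact hne _ _ _ _ (Or.inr hc) h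
      · exact hZc _ _ (Or.inr hc) h
    have hC := genIdeal_isPrime (Z := insert (e i₁ c₀) (insert (e i₀ c₀) Z)) heC
      (fun (i : ι) (c : {c // c ≠ c₀}) => hZC i c c.2) (by omega) (by omega)
    have : Nonempty {i // i ≠ i₁} := ⟨⟨i₀, hi.symm⟩⟩
    have hzA := X_notMem_genIdeal
      (e := fun (i : {i // i ≠ i₁}) (c : {c // c ≠ c₀}) => e i c) heA hz (Or.inl fun i c => hne _ _ _ _ (Or.inl i.2))
    have hzC := X_notMem_genIdeal (e := fun (i : ι) (c : {c // c ≠ c₀}) => e i c)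
      heC (hZC i₁ c₁ hc) (Or.inr hcard2)
    have hzA' := X_notMem_genIdeal
      (e := fun (i : {i // i ≠ i₁}) (c : {c // c ≠ c₀}) => e i c) heA (hZc i₁ c₀ (Or.inl hi))
      (Or.inl fun i c => hne _ _ _ _ (Or.inl i.2))
    have hfC : X (e i₁ c₁) * f ∈ genIdeal (insert (e i₁ c₀) (insert (e i₀ c₀) Z))
        fun (i : ι) (c : {c // c ≠ c₀}) => e i c := by
      rw [genIdeal_insert_eq_deleteColumn hcol]
      exact Ideal.mem_sup_left hf
    exact inf_le_genIdeal hcol hA hzA'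
      ((hA.mem_or_mem (genIdeal_le_deleteRow hcol hf)).resolve_left hzA)
      ((hC.mem_or_mem hfC).resolve_left hzC)
  · have hp := genIdeal_isPrime_of_two_le_ncard (Z := insert (e i₀ c₀) Z) he c₀
      (fun i c hc => hZc i c (Or.inr hc)) (by
        have : {i | e i c₀ ∉ insert (e i₀ c₀) Z} = {i₀}ᶜ := by
          ext i
          refine ⟨fun h hi => h (hi ▸ Set.mem_insert _ _), fun h => hZc _ _ (Or.inl h)⟩
        rw [this, Set.ncard_compl, Set.ncard_singleton, Nat.card_eq_fintype_card]
        omega) hcard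
    exact (hp.mem_or_mem hf).resolve_left (X_notMem_genIdeal he hz (Or.inr hcard2))

theorem genIdeal_isIntegrallyClosed_aux [Finite σ] (N : ℕ) : ∀ (ι κ : Type) [Fintype ι] [Fintype κ]
    [DecidableEq ι] [DecidableEq κ] (Z : Set σ) (e : ι → κ → σ),
    (Function.Injective fun q : ι × κ => e q.1 q.2) → (∀ i c, e i c ∉ Z) →
    Fintype.card ι ≤ Fintype.card κ + 1 → Fintype.card ι = N + 1 →
    IsIntegrallyClosed (MvPolynomial σ ℂ ⧸ genIdeal Z e) := by
  induction N with
  | zero =>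
    intro ι κ _ _ _ _ Z e _ _ _ h3
    rw [genIdeal_of_card_eq_one Z e h3]
    exact isIntegrallyClosed_quotient_span_X _
  | succ N ih =>
    intro ι κ _ _ _ _ Z e he hZ h2 h3
    rcases h2.eq_or_lt with h2' | h2'
    · rw [genIdeal_of_card_lt Z e (by omega)]
      exact isIntegrallyClosed_quotient_span_X _
    obtain ⟨i₀, i₁, hi⟩ := Fintype.one_lt_card_iff.1 (show 1 < Fintype.card ι by omega)
    obtain ⟨c₀, c₁, hc⟩ := Fintype.one_lt_card_iff.1 (show 1 < Fintype.card κ by omega)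
    have : Nonempty ι := ⟨i₀⟩
    have hι : ∀ j, Fintype.card {i : ι // i ≠ j} = Fintype.card ι - 1 := fun j => by
      rw [Fintype.card_subtype_compl, Fintype.card_subtype_eq]
    have hκ : ∀ j, Fintype.card {i : κ // i ≠ j} = Fintype.card κ - 1 := fun j => by
      rw [Fintype.card_subtype_compl, Fintype.card_subtype_eq]
    have hS : ∀ i c, Function.Injective
        fun q : {i' : ι // i' ≠ i} × {c' : κ // c' ≠ c} => e q.1.1 q.2.1 := fun i c =>
      injective_submatrix he Subtype.val_injective Subtype.val_injective
    have hI := genIdeal_isPrime he hZ (by omega) h2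
    have hQ : ∀ i c, (genIdeal Z fun (i' : {i' : ι // i' ≠ i}) (c' : {c' : κ // c' ≠ c}) =>
        e i' c').IsPrime := fun i c => genIdeal_isPrime (hS i c) (fun i c => hZ _ _)
      (by rw [hι]; omega) (by rw [hι, hκ]; omega)
    have hyI : ∀ i c, X (e i c) ∉ genIdeal Z e := fun i c => X_notMem_genIdeal he (hZ i c)
      (Or.inr (by omega))
    have hyQ : ∀ i c, X (e i c) ∉ (genIdeal Z fun (i' : {i' : ι // i' ≠ i})
        (c' : {c' : κ // c' ≠ c}) => e i' c') := fun i c => by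
      have : Nonempty {i' : ι // i' ≠ i} := Fintype.card_pos_iff.1 (by rw [hι]; omega)
      exact X_notMem_genIdeal (hS i c) (hZ i c)
        (Or.inl fun i' c' h => i'.2 (congrArg Prod.fst (@he (i'.1, c'.1) (i, c) h)))
    have hQc : ∀ i c, IsIntegrallyClosed (MvPolynomial σ ℂ ⧸
        (genIdeal Z fun (i' : {i' : ι // i' ≠ i}) (c' : {c' : κ // c' ≠ c}) => e i' c')) :=
      fun i c => ih _ _ _ _ (hS i c) (fun i c => hZ _ _) (by rw [hι, hκ]; omega)
        (by rw [hι]; omega)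
    have hT : ∀ i c, ∃ T : Localization.Away (X (e i c) : MvPolynomial σ ℂ) ≃+*
        Localization.Away (X (e i c) : MvPolynomial σ ℂ), _ := fun i c =>
      exists_pivotEquiv (Localization.Away (X (e i c) : MvPolynomial σ ℂ)) he i c
        fun i c _ _ => hZ i c
    refine isIntegrallyClosed_quotient_of_pivots hI (hyI i₀ c₀) (hyI i₁ c₁) (hQ i₀ c₀) (hyQ i₀ c₀)
      (hQc i₀ c₀) (hT i₀ c₀) (hQ i₁ c₁) (hyQ i₁ c₁) (hQc i₁ c₁) (hT i₁ c₁) fun f hf => ?_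
    rw [← genIdeal_insert] at hf ⊢
    exact mem_genIdeal_insert_of_mul_mem he hZ hi.symm hc.symm (by omega) hf

theorem genIdeal_isIntegrallyClosed [Finite σ] {Z : Set σ} {e : ι → κ → σ}
    (he : Function.Injective fun q : ι × κ => e q.1 q.2) (hZ : ∀ i c, e i c ∉ Z)
    (h1 : 1 ≤ Fintype.card ι) (h2 : Fintype.card ι ≤ Fintype.card κ + 1) :
    IsIntegrallyClosed (MvPolynomial σ ℂ ⧸ genIdeal Z e) :=
  genIdeal_isIntegrallyClosed_aux (Fintype.card ι - 1) ι κ Z e he hZ h2 (by omega)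

end Normality

section Depth

open CategoryTheory Abelian
open scoped Pointwise

variable {R : Type} [CommRing R]

/-- The ideal `m` contains an `R ⧸ I`-regular sequence of length `n`. -/
def HasRegSeq (m I : Ideal R) (n : ℕ) : Prop :=
  ∃ rs : List R, rs.length = n ∧ (∀ r ∈ rs, r ∈ m) ∧ RingTheory.Sequence.IsRegular (R ⧸ I) rs

theorem smul_top_quotient_lt_top {m I : Ideal R} (hI : I ≤ m) (hm : m ≠ ⊤) :
    m • (⊤ : Submodule R (R ⧸ I)) < ⊤ := by
  refine lt_top_iff_ne_top.2 fun h => hm ?_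
  have h1 : (⊤ : Submodule R (R ⧸ I)) = Submodule.map I.mkQ ⊤ := by
    rw [Submodule.map_top, Submodule.range_mkQ]
  have h2 : m • (⊤ : Submodule R (R ⧸ I)) = Submodule.map I.mkQ m := by
    rw [h1, ← Submodule.map_smul'']
    simp
  have h3 : Submodule.comap I.mkQ (m • (⊤ : Submodule R (R ⧸ I))) = m := by
    rw [h2, Submodule.comap_map_mkQ, sup_eq_right.2 hI]
  rw [← h3, h, Submodule.comap_top]

theorem HasRegSeq.of_exact [IsNoetherianRing R] {m A B C : Ideal R} {z : R} {n : ℕ}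
    (hm : m ≠ ⊤) (hAm : A ≤ m) (hCm : C ≤ m)
    (hBC : C = B ⊔ Ideal.span {z}) (hzA : ∀ h, z * h ∈ B ↔ h ∈ A)
    (hA : HasRegSeq m A n) (hC : HasRegSeq m C n) : HasRegSeq m B n := by
  have hBC' : B ≤ C := hBC ▸ le_sup_left
  let f : (R ⧸ A) →ₗ[R] (R ⧸ B) := Submodule.mapQ A B (LinearMap.mulLeft R z)
    fun h hh => (hzA h).2 hh
  let g : (R ⧸ B) →ₗ[R] (R ⧸ C) := Submodule.factor hBC'
  have hf : Function.Injective f := by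
    rw [← LinearMap.ker_eq_bot, LinearMap.ker_eq_bot']
    intro x hx
    obtain ⟨h, rfl⟩ := Ideal.Quotient.mk_surjective x
    exact Ideal.Quotient.eq_zero_iff_mem.2 ((hzA h).1 (Ideal.Quotient.eq_zero_iff_mem.1 hx))
  have hg : Function.Surjective g := Submodule.factor_surjective hBC'
  have hfg : Function.Exact f g := by
    intro x
    obtain ⟨h, rfl⟩ := Ideal.Quotient.mk_surjective x
    constructor
    · intro hx
      have : h ∈ C := Ideal.Quotient.eq_zero_iff_mem.1 hx
      rw [hBC] at this
      obtain ⟨b, hb, w, hw, rfl⟩ := Submodule.mem_sup.1 this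
      obtain ⟨k, rfl⟩ := Ideal.mem_span_singleton.1 hw
      refine ⟨Ideal.Quotient.mk A k, ?_⟩
      change Ideal.Quotient.mk B (z * k) = _
      rw [map_add, Ideal.Quotient.eq_zero_iff_mem.2 hb, zero_add]
    · rintro ⟨y, hy⟩
      obtain ⟨k, rfl⟩ := Ideal.Quotient.mk_surjective y
      rw [← hy]
      change Ideal.Quotient.mk C (z * k) = 0
      rw [Ideal.Quotient.eq_zero_iff_mem, hBC]
      exact Ideal.mem_sup_right (Ideal.mul_mem_right _ _ (Ideal.mem_span_singleton_self z))
  let S : ShortComplex (ModuleCat R) := ShortComplex.mk (ModuleCat.ofHom f) (ModuleCat.ofHom g)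
    (ModuleCat.hom_ext (LinearMap.ext fun x => hfg.apply_apply_eq_zero x))
  have hS : S.ShortExact := by
    have _ : Mono S.f := (ModuleCat.mono_iff_injective _).2 hf
    have _ : Epi S.g := (ModuleCat.epi_iff_surjective _).2 hg
    exact ShortComplex.ShortExact.mk ((ShortComplex.ShortExact.moduleCat_exact_iff_function_exact S).2 hfg)
  have hA' := ((ModuleCat.exists_isRegular_tfae m n (ModuleCat.of R (R ⧸ A))
    (smul_top_quotient_lt_top hAm hm)).out 3 1).1 hA
  have hC' := ((ModuleCat.exists_isRegular_tfae m n (ModuleCat.of R (R ⧸ C))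
    (smul_top_quotient_lt_top hCm hm)).out 3 1).1 hC
  refine ((ModuleCat.exists_isRegular_tfae m n (ModuleCat.of R (R ⧸ B))
    (smul_top_quotient_lt_top (hBC'.trans hCm) hm)).out 1 3).1 fun i hi => ?_
  have h1 := hA' i hi
  have h3 := hC' i hi
  refine subsingleton_of_forall_eq 0 fun x => ?_
  obtain ⟨x₁, rfl⟩ := Ext.covariant_sequence_exact₂ _ hS x (h3.elim _ _)
  rw [show x₁ = 0 from h1.elim _ _, Ext.zero_comp]

theorem HasRegSeq.cons {m I : Ideal R} {v : R} {n : ℕ} (hv : v ∈ m)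
    (hreg : ∀ f, v * f ∈ I → f ∈ I) (h : HasRegSeq m (I ⊔ Ideal.span {v}) n) :
    HasRegSeq m I (n + 1) := by
  obtain ⟨rs, hlen, hmem, hrs⟩ := h
  refine ⟨v :: rs, by simp [hlen], ?_, ?_⟩
  · intro r hr
    rcases List.mem_cons.1 hr with rfl | h
    · exact hv
    · exact hmem r h
  · rw [RingTheory.Sequence.isRegular_cons_iff]
    constructor
    · rw [isSMulRegular_iff_right_eq_zero_of_smul]
      intro x hx
      obtain ⟨f, rfl⟩ := Ideal.Quotient.mk_surjective x
      exact Ideal.Quotient.eq_zero_iff_mem.2 (hreg f (Ideal.Quotient.eq_zero_iff_mem.1 hx))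
    · have h1 : v • (⊤ : Submodule R (R ⧸ I)) = Submodule.map I.mkQ (Ideal.span {v}) := by
        ext x
        rw [Submodule.mem_smul_pointwise_iff_exists, Submodule.mem_map]
        constructor
        · rintro ⟨y, -, rfl⟩
          obtain ⟨f, rfl⟩ := Ideal.Quotient.mk_surjective y
          exact ⟨v * f, Ideal.mem_span_singleton'.2 ⟨f, mul_comm _ _⟩, rfl⟩
        · rintro ⟨w, hw, rfl⟩
          obtain ⟨f, rfl⟩ := Ideal.mem_span_singleton.1 hw
          exact ⟨Ideal.Quotient.mk I f, trivial, rfl⟩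
      have e : (R ⧸ (I ⊔ Ideal.span {v})) ≃ₗ[R] QuotSMulTop v (R ⧸ I) :=
        (Submodule.quotientQuotientEquivQuotientSup I (Ideal.span {v})).symm.trans
          (Submodule.quotEquivOfEq _ _ h1.symm)
      exact (e.isRegular_congr rs).1 hrs

end Depth

section GenericDepth

variable {σ : Type}

theorem genIdeal_le_span_range_X {ι κ : Type} [Fintype ι] [Fintype κ] [DecidableEq ι]
    [DecidableEq κ] (Z : Set σ) (e : ι → κ → σ) (h1 : 1 ≤ Fintype.card ι) :
    genIdeal Z e ≤ Ideal.span (X '' (Set.univ : Set σ)) := by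
  classical
  have : Nonempty ι := Fintype.card_pos_iff.1 h1
  rw [span_X_eq_ker]
  exact genIdeal_le_ker _ (by simp) (fun _ => 1) (by simp [funext_iff]) (by simp)

theorem span_range_X_ne_top : (Ideal.span (X '' (Set.univ : Set σ)) : Ideal (MvPolynomial σ ℂ)) ≠ ⊤ :=
  (isPrime_span_X Set.univ).ne_top

theorem hasRegSeq_span_X [Finite σ] (r : ℕ) : ∀ Z : Set σ, r + Z.ncard = Nat.card σ →
    HasRegSeq (Ideal.span (X '' (Set.univ : Set σ)) : Ideal (MvPolynomial σ ℂ))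
      (Ideal.span (X '' Z)) r := by
  induction r with
  | zero =>
    intro Z hZ
    have : Z = Set.univ := by
      apply Set.eq_of_subset_of_ncard_le (Set.subset_univ _)
      rw [Set.ncard_univ]; omega
    subst this
    have : Nontrivial (MvPolynomial σ ℂ ⧸ (Ideal.span (X '' (Set.univ : Set σ)) : Ideal (MvPolynomial σ ℂ))) :=
      Ideal.Quotient.nontrivial_iff.2 span_range_X_ne_top
    exact ⟨[], rfl, by simp, RingTheory.Sequence.IsRegular.nil _ _⟩
  | succ r ih =>
    intro Z hZ
    have hne : Z ≠ Set.univ := by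
      rintro rfl
      rw [Set.ncard_univ] at hZ; omega
    obtain ⟨v, hv⟩ := (Set.ne_univ_iff_exists_notMem Z).1 hne
    refine HasRegSeq.cons (v := X v) (Ideal.subset_span ⟨v, trivial, rfl⟩) (fun f hf => ?_) ?_
    · exact ((isPrime_span_X Z).mem_or_mem hf).resolve_left fun h => hv (X_mem_span_X_iff.1 h)
    · have := ih (insert v Z) (by rw [Set.ncard_insert_of_notMem hv]; omega)
      rwa [Set.image_insert_eq, Ideal.span_insert, sup_comm] at this

theorem hasRegSeq_genIdeal_aux [Finite σ] (N : ℕ) : ∀ (ι κ : Type) [Fintype ι] [Fintype κ]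
    [DecidableEq ι] [DecidableEq κ] (Z : Set σ) (e : ι → κ → σ) (ℓ : ℕ),
    (Function.Injective fun q : ι × κ => e q.1 q.2) → (∀ i c, e i c ∉ Z) → 1 ≤ Fintype.card ι →
    Fintype.card ι ≤ Fintype.card κ + 1 → Fintype.card ι + Fintype.card κ ≤ N →
    ℓ + Fintype.card κ + 1 + Z.ncard = Nat.card σ + Fintype.card ι →
    HasRegSeq (Ideal.span (X '' (Set.univ : Set σ))) (genIdeal Z e) ℓ := by
  induction N with
  | zero => intro ι κ _ _ _ _ Z e _ _ _ h1 _ h3; omega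
  | succ N ih =>
    intro ι κ _ _ _ _ Z e ℓ he hZ h1 h2 h3 hℓ
    by_cases hs : Fintype.card ι = 1
    · rw [genIdeal_of_card_eq_one Z e hs]
      refine hasRegSeq_span_X _ _ ?_
      have hr : (Set.range fun q : ι × κ => e q.1 q.2).ncard = Fintype.card κ := by
        rw [Set.ncard_range_of_injective he]
        simp [hs]
      have hd : Disjoint Z (Set.range fun q : ι × κ => e q.1 q.2) := by
        rw [Set.disjoint_right]
        rintro _ ⟨q, rfl⟩
        exact hZ _ _
      rw [Set.ncard_union_eq hd, hr]
      omega
    by_cases hst : Fintype.card κ < Fintype.card ι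
    · rw [genIdeal_of_card_lt Z e hst]
      exact hasRegSeq_span_X _ _ (by omega)
    have hκ0 : 0 < Fintype.card κ := by omega
    obtain ⟨c₀⟩ := Fintype.card_pos_iff.1 hκ0
    have hι : Nonempty ι := Fintype.card_pos_iff.1 h1
    have hκ : Fintype.card {c // c ≠ c₀} = Fintype.card κ - 1 := by
      rw [Fintype.card_subtype_compl, Fintype.card_subtype_eq]
    have hinj : ∀ {i c i' c'}, e i c = e i' c' → i = i' ∧ c = c' := fun {i c i' c'} h =>
      Prod.ext_iff.1 (@he (i, c) (i', c') h)
    have key : ∀ (r : ℕ) (Z : Set σ) (ℓ : ℕ), (∀ i c, c ≠ c₀ → e i c ∉ Z) →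
        {i | e i c₀ ∉ Z}.ncard = r + 1 →
        ℓ + Fintype.card κ + 1 + Z.ncard = Nat.card σ + Fintype.card ι →
        HasRegSeq (Ideal.span (X '' (Set.univ : Set σ))) (genIdeal Z e) ℓ := by
      intro r
      induction r with
      | zero =>
        intro Z ℓ hZ hr hℓ
        obtain ⟨i₁, hi₁⟩ := Set.ncard_eq_one.1 hr
        have hmem : ∀ i, e i c₀ ∉ Z ↔ i = i₁ := fun i => by
          simpa using Set.ext_iff.1 hi₁ i
        have hZ' : ∀ i, i ≠ i₁ → e i c₀ ∈ Z := fun i hi => by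
          by_contra h
          exact hi ((hmem i).1 h)
        have h₁ : e i₁ c₀ ∉ Z := (hmem i₁).2 rfl
        have hιA : Fintype.card {i // i ≠ i₁} = Fintype.card ι - 1 := by
          rw [Fintype.card_subtype_compl, Fintype.card_subtype_eq]
        have hAinj := injective_submatrix he (Subtype.val_injective (p := fun i => i ≠ i₁))
          (Subtype.val_injective (p := fun c => c ≠ c₀))
        have hAne : Nonempty {i // i ≠ i₁} := Fintype.card_pos_iff.1 (by omega)
        have hAprime := genIdeal_isPrime (e := fun (i : {i // i ≠ i₁}) (c : {c // c ≠ c₀}) => e i c)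
          hAinj (fun i c => hZ i c c.2) (by omega) (by omega)
        have hzA := X_notMem_genIdeal (e := fun (i : {i // i ≠ i₁}) (c : {c // c ≠ c₀}) => e i c)
          hAinj h₁ (Or.inl fun i c h => c.2 (hinj h).2)
        refine HasRegSeq.of_exact span_range_X_ne_top
          (genIdeal_le_span_range_X _ (fun (i : {i // i ≠ i₁}) (c : {c // c ≠ c₀}) => e i c) (by omega))
          (genIdeal_le_span_range_X _ (fun (i : ι) (c : {c // c ≠ c₀}) => e i c) (by omega))
          (genIdeal_insert_eq_deleteColumn hZ') (fun h => ⟨fun hh => ?_, fun hh => ?_⟩)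
          (ih _ _ Z _ ℓ hAinj (fun i c => hZ i c c.2) (by omega) (by omega) (by omega) (by omega))
          (ih _ _ (insert (e i₁ c₀) Z) (fun (i : ι) (c : {c // c ≠ c₀}) => e i c) ℓ
            (injective_submatrix he Function.injective_id Subtype.val_injective)
            ?_ h1 (by omega) (by omega)
            (by rw [Set.ncard_insert_of_notMem h₁]; omega))
        · exact (hAprime.mem_or_mem (genIdeal_le_deleteRow hZ' hh)).resolve_left hzA
        · exact mul_mem_genIdeal_of_mem_deleteRow hZ' hh
        · rintro i c (h | h)
          · exact c.2 (hinj h).2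
          · exact hZ i c c.2 h
      | succ r ihr =>
        intro Z ℓ hZ hr hℓ
        obtain ⟨i, hi⟩ : {i | e i c₀ ∉ Z}.Nonempty := by
          rw [Set.nonempty_iff_ne_empty]
          intro h
          rw [h] at hr
          simp at hr
        have hi' : e i c₀ ∉ Z := hi
        have hset : {j | e j c₀ ∉ insert (e i c₀) Z} = {i | e i c₀ ∉ Z} \ {i} := by
          ext j
          simp only [Set.mem_ofPred_eq, Set.mem_insert_iff, not_or, Set.mem_sdiff,
            Set.mem_singleton_iff]
          constructor
          · rintro ⟨h, h'⟩
            exact ⟨h', fun hj => h (hj ▸ rfl)⟩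
          · rintro ⟨h, h'⟩
            exact ⟨fun hj => h' (hinj hj).1, h⟩
        have hpos : 0 < ℓ := by
          have h5 : (insert (e i c₀) Z ∪ Set.range fun c : {c // c ≠ c₀} => e i c).ncard ≤ Nat.card σ :=
            (Set.ncard_le_card _)
          have h6 : Disjoint (insert (e i c₀) Z) (Set.range fun c : {c // c ≠ c₀} => e i c) := by
            rw [Set.disjoint_right]
            rintro _ ⟨c, rfl⟩ (h | h)
            · exact c.2 (hinj h).2
            · exact hZ i c c.2 h
          rw [Set.ncard_union_eq h6, Set.ncard_insert_of_notMem hi',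
            Set.ncard_range_of_injective (fun c c' h => Subtype.ext (hinj h).2),
            Nat.card_eq_fintype_card, hκ] at h5
          omega
        obtain ⟨ℓ, rfl⟩ : ∃ k, ℓ = k + 1 := ⟨ℓ - 1, by omega⟩
        have hprime := genIdeal_isPrime_of_two_le_ncard he c₀ hZ (by omega) (by omega)
        refine HasRegSeq.cons (v := X (e i c₀)) (Ideal.subset_span ⟨_, trivial, rfl⟩)
          (fun f hf => ?_) ?_
        · exact (hprime.mem_or_mem hf).resolve_left
            (X_notMem_genIdeal he hi' (Or.inr (by omega)))
        · rw [← genIdeal_insert]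
          refine ihr _ ℓ ?_ ?_ ?_
          · rintro i' c hc (h | h)
            · exact hc (hinj h).2
            · exact hZ i' c hc h
          · rw [hset, Set.ncard_sdiff_singleton_of_mem hi, hr]
            omega
          · rw [Set.ncard_insert_of_notMem hi']
            omega
    refine key (Fintype.card ι - 1) Z ℓ (fun i c _ => hZ i c) ?_ hℓ
    have : {i | e i c₀ ∉ Z} = Set.univ := Set.eq_univ_of_forall fun i => hZ i c₀
    rw [this, Set.ncard_univ, Nat.card_eq_fintype_card]
    omega

/-- The quotient by the ideal generated by the maximal minors of a generic matrix and by further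
variables has depth equal to the number of variables minus the expected codimension. -/
theorem hasRegSeq_genIdeal [Finite σ] {ι κ : Type} [Fintype ι] [Fintype κ] [DecidableEq ι]
    [DecidableEq κ] {Z : Set σ} {e : ι → κ → σ} {ℓ : ℕ}
    (he : Function.Injective fun q : ι × κ => e q.1 q.2) (hZ : ∀ i c, e i c ∉ Z)
    (h1 : 1 ≤ Fintype.card ι) (h2 : Fintype.card ι ≤ Fintype.card κ + 1)
    (hℓ : ℓ + Fintype.card κ + 1 + Z.ncard = Nat.card σ + Fintype.card ι) :
    HasRegSeq (Ideal.span (X '' (Set.univ : Set σ))) (genIdeal Z e) ℓ :=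
  hasRegSeq_genIdeal_aux _ ι κ Z e ℓ he hZ h1 h2 le_rfl hℓ

end GenericDepth

section EtaleCoordinates

open KaehlerDifferential TensorProduct

/-- Polynomials with invertible Jacobian determinant are étale coordinates. -/
theorem etale_of_isUnit_jacobian {σ τ T : Type} [Fintype σ] [DecidableEq σ] [Finite τ] (ε : σ ≃ τ)
    (φ : σ → MvPolynomial τ ℂ) [CommRing T] [Algebra ℂ T]
    [Algebra (MvPolynomial τ ℂ) T] [IsScalarTower ℂ (MvPolynomial τ ℂ) T]
    [Algebra (MvPolynomial σ ℂ) T] [IsScalarTower ℂ (MvPolynomial σ ℂ) T]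
    (g : MvPolynomial τ ℂ) [IsLocalization.Away g T]
    (hφ : ∀ v, algebraMap (MvPolynomial σ ℂ) T (X v) = algebraMap (MvPolynomial τ ℂ) T (φ v))
    (hdet : IsUnit (Matrix.of fun v w : σ =>
      algebraMap (MvPolynomial τ ℂ) T (pderiv (ε w) (φ v))).det) :
    Algebra.Etale (MvPolynomial σ ℂ) T := by
  classical
  have _ : Algebra.FormallyEtale (MvPolynomial τ ℂ) T :=
    Algebra.FormallyEtale.of_isLocalization (Submonoid.powers g)
  have _ : Algebra.FinitePresentation (MvPolynomial τ ℂ) T :=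
    IsLocalization.Away.finitePresentation g
  have _ : Algebra.FinitePresentation ℂ T :=
    Algebra.FinitePresentation.trans ℂ (MvPolynomial τ ℂ) T
  have _ : Algebra.FormallySmooth ℂ T := Algebra.FormallySmooth.comp ℂ (MvPolynomial τ ℂ) T
  have hfp : Algebra.FinitePresentation (MvPolynomial σ ℂ) T :=
    Algebra.FinitePresentation.of_restrict_scalars_finitePresentation ℂ _ _
  let b₁ : Module.Basis σ T (T ⊗[MvPolynomial σ ℂ] Ω[MvPolynomial σ ℂ⁄ℂ]) :=
    (mvPolynomialBasis ℂ σ).baseChange T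
  let E := tensorKaehlerEquivOfFormallyEtale ℂ (MvPolynomial τ ℂ) T
  let b₂ : Module.Basis σ T (Ω[T⁄ℂ]) :=
    (((mvPolynomialBasis ℂ τ).baseChange T).map E).reindex ε.symm
  have hM : (LinearMap.toMatrix b₁ b₂ (mapBaseChange ℂ (MvPolynomial σ ℂ) T)) =
      (Matrix.of fun v w : σ => algebraMap (MvPolynomial τ ℂ) T (pderiv (ε w) (φ v))).transpose := by
    ext w v
    have h1 : mapBaseChange ℂ (MvPolynomial σ ℂ) T (b₁ v) =
        E (1 ⊗ₜ D ℂ (MvPolynomial τ ℂ) (φ v)) := by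
      simp only [b₁, E, Module.Basis.baseChange_apply, mvPolynomialBasis_apply,
        mapBaseChange_tmul, tensorKaehlerEquivOfFormallyEtale_apply, one_smul, map_D, hφ]
    rw [LinearMap.toMatrix_apply, h1]
    simp [b₂, Module.Basis.baseChange_repr_tmul, Algebra.smul_def]
  have hdet' : IsUnit (LinearMap.toMatrix b₁ b₂ (mapBaseChange ℂ (MvPolynomial σ ℂ) T)).det := by
    rwa [hM, Matrix.det_transpose]
  have hbij : Function.Bijective (mapBaseChange ℂ (MvPolynomial σ ℂ) T) :=
    (LinearEquiv.ofIsUnitDet hdet').bijective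
  have h1 : Subsingleton (Algebra.H1Cotangent (MvPolynomial σ ℂ) T) := by
    refine subsingleton_of_forall_eq 0 fun x => ?_
    have hδ : Algebra.H1Cotangent.δ ℂ (MvPolynomial σ ℂ) T x = 0 :=
      hbij.1 ((Algebra.H1Cotangent.exact_δ_mapBaseChange ℂ (MvPolynomial σ ℂ) T).apply_apply_eq_zero
        x |>.trans (map_zero _).symm)
    obtain ⟨y, rfl⟩ := (Algebra.H1Cotangent.exact_map_δ ℂ (MvPolynomial σ ℂ) T x).1 hδ
    rw [Subsingleton.elim y 0, map_zero]
  have h2 : Subsingleton (Ω[T⁄MvPolynomial σ ℂ]) := by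
    refine subsingleton_of_forall_eq 0 fun x => ?_
    obtain ⟨y, rfl⟩ := map_surjective ℂ (MvPolynomial σ ℂ) T x
    obtain ⟨z, rfl⟩ := hbij.2 y
    exact (exact_mapBaseChange_map ℂ (MvPolynomial σ ℂ) T).apply_apply_eq_zero z
  have h3 : Algebra.FormallyEtale (MvPolynomial σ ℂ) T := ⟨h2, h1⟩
  exact ⟨h3, hfp⟩

end EtaleCoordinates

section EtaleNormal

open TensorProduct

theorem exists_algebraMap_eq_of_isIntegral_of_etale {B C K : Type*} [CommRing B] [IsDomain B]
    [IsIntegrallyClosed B] [CommRing C] [Algebra B C] [Algebra.Etale B C] [Field K] [Algebra B K]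
    [IsFractionRing B K] {y : C ⊗[B] K} (hy : IsIntegral C y) :
    ∃ c : C, c ⊗ₜ[B] (1 : K) = y := by
  obtain ⟨z, hz⟩ := (TensorProduct.toIntegralClosure_bijective_of_smooth
    (R := B) (S := C) (B := K)).2 ⟨y, hy⟩
  have hz' : (Algebra.TensorProduct.map (AlgHom.id C C) (integralClosure B K).val) z = y :=
    congrArg Subtype.val hz
  rw [← hz']
  clear hz hz' hy
  induction z with
  | zero => exact ⟨0, by simp⟩
  | add a b ha hb =>
    obtain ⟨c, hc⟩ := ha
    obtain ⟨c', hc'⟩ := hb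
    exact ⟨c + c', by rw [TensorProduct.add_tmul, hc, hc', map_add]⟩
  | tmul c k =>
    obtain ⟨b, hb⟩ := IsIntegrallyClosed.isIntegral_iff.1 k.2
    refine ⟨b • c, ?_⟩
    rw [Algebra.TensorProduct.map_tmul, TensorProduct.smul_tmul, Algebra.smul_def, mul_one, hb]
    rfl

/-- A ring which is integrally closed in a finite product of fields has normal local rings. -/
theorem isIntegrallyClosed_atPrime_of_pi {C I : Type*} [Finite I] [CommRing C] {k : I → Type*}
    [∀ i, Field (k i)] (f : C →+* Π i, k i) (hf : Function.Injective f)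
    (hidem : ∀ y : Π i, k i, f.IsIntegralElem y → ∃ c, f c = y) (m : Ideal C) [m.IsPrime]
    (A : Type*) [CommRing A] [Algebra C A] [IsLocalization.AtPrime A m] :
    IsDomain A ∧ IsIntegrallyClosed A := by
  classical
  have _ := Fintype.ofFinite I
  have hidem : ∀ i, ∃ c, f c = Pi.single i 1 := fun i => by
    refine hidem _ ⟨Polynomial.X ^ 2 - Polynomial.X, ?_, ?_⟩
    · exact Polynomial.monic_X_pow_sub (Polynomial.degree_X_le.trans_lt (by norm_num))
    · simp [pow_two, ← Pi.single_mul]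
  choose u hu using hidem
  obtain ⟨i, hi⟩ : ∃ i, u i ∉ m := by
    by_contra! h
    have h1 : ∑ i, u i = 1 := hf (by
      rw [map_sum, map_one]
      simp only [hu]
      exact Finset.univ_sum_single (1 : Π i, k i))
    exact (inferInstance : m.IsPrime).ne_top
      ((Ideal.eq_top_iff_one m).2 (h1 ▸ Ideal.sum_mem _ fun i _ => h i))
  let g : C →+* k i := (Pi.evalRingHom k i).comp f
  have hg : ∀ c, g c = 0 → c * u i = 0 := fun c hc => hf (by
    rw [map_mul, hu, map_zero]
    ext j
    by_cases hj : j = i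
    · subst hj
      have : f c j = 0 := hc
      simp [this]
    · simp [hj])
  have hgs : ∀ s, s ∉ m → g s ≠ 0 := fun s hs h => by
    rcases (inferInstance : m.IsPrime).mem_or_mem (hg s h ▸ m.zero_mem : s * u i ∈ m) with h | h
    · exact hs h
    · exact hi h
  let G : A →+* k i := IsLocalization.lift (M := m.primeCompl) (g := g) fun s =>
    (isUnit_iff_ne_zero.2 (hgs s s.2))
  have hG : ∀ c, G (algebraMap C A c) = g c := fun c => IsLocalization.lift_eq _ c
  have hGinj : Function.Injective G := by
    rw [injective_iff_map_eq_zero]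
    intro a ha
    obtain ⟨c, s, rfl⟩ := IsLocalization.exists_mk'_eq m.primeCompl a
    have h1 : g c = 0 := by
      rw [← hG, ← IsLocalization.mk'_spec' A c s, map_mul, ha, mul_zero]
    rw [IsLocalization.mk'_eq_zero_iff]
    exact ⟨⟨u i, hi⟩, by rw [mul_comm]; exact hg c h1⟩
  have hdom : IsDomain A := hGinj.isDomain G
  refine ⟨hdom, (isIntegrallyClosed_iff (FractionRing A)).2 fun {x} hx => ?_⟩
  let _ : Algebra A (k i) := G.toAlgebra
  have _ : FaithfulSMul A (k i) := (faithfulSMul_iff_algebraMap_injective A (k i)).2 hGinj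
  let H : FractionRing A →ₐ[A] k i := IsFractionRing.liftAlgHom (g := Algebra.ofId A (k i)) hGinj
  have hHx : IsIntegral A (H x) := hx.map H
  let _ : Algebra C (k i) := g.toAlgebra
  have _ : IsScalarTower C A (k i) := IsScalarTower.of_algebraMap_eq fun c => (hG c).symm
  obtain ⟨s, hs⟩ := IsIntegral.exists_multiple_integral_of_isLocalization m.primeCompl _ hHx
  have hs' : IsIntegral C (g s * H x) := by
    have := hs
    rwa [Submonoid.smul_def, Algebra.smul_def] at this
  obtain ⟨P, hP, hP0⟩ := hs'
  obtain ⟨c, hc⟩ := hidem (Pi.single i (g s * H x)) ⟨P * Polynomial.X,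
    hP.mul Polynomial.monic_X, by
      ext j
      rw [Polynomial.eval₂_mul, Polynomial.eval₂_X, Pi.mul_apply]
      by_cases hj : j = i
      · subst hj
        have h3 : (P.eval₂ f (Pi.single j (g s * H x))) j = P.eval₂ g (g s * H x) := by
          have := Polynomial.hom_eval₂ P f (Pi.evalRingHom k j) (Pi.single j (g s * H x))
          simpa using this
        rw [h3]
        have : P.eval₂ g (g s * H x) = 0 := hP0
        rw [this]
        simp
      · simp [hj]⟩
  have hgc : g c = g s * H x := by
    change f c i = _
    rw [hc, Pi.single_eq_same]
  refine ⟨IsLocalization.mk' A c s, H.toRingHom.injective ?_⟩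
  change H (algebraMap A _ _) = H x
  rw [AlgHom.commutes]
  change G _ = _
  have h4 : g s ≠ 0 := hgs s s.2
  refine mul_left_cancel₀ h4 ?_
  rw [← hgc, ← hG, ← hG, ← map_mul, IsLocalization.mk'_spec']

theorem isIntegrallyClosed_atPrime_of_etale {B C : Type} [CommRing B] [IsDomain B]
    [IsIntegrallyClosed B] [CommRing C] [Algebra B C] [Algebra.Etale B C] (m : Ideal C) [m.IsPrime]
    (A : Type*) [CommRing A] [Algebra C A] [IsLocalization.AtPrime A m] :
    IsDomain A ∧ IsIntegrallyClosed A := by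
  let K := FractionRing B
  have hE : Algebra.Etale K (K ⊗[B] C) := inferInstance
  obtain ⟨I, _, k, _, _, e, -⟩ := (Algebra.Etale.iff_exists_algEquiv_prod (K := K) (A := K ⊗[B] C)).1 hE
  let e' : C ⊗[B] K ≃+* Π i, k i :=
    ((Algebra.TensorProduct.comm B C K).toRingEquiv).trans e.toRingEquiv
  let f₀ : C →+* C ⊗[B] K := (Algebra.TensorProduct.includeLeft (R := B) (S := C)).toRingHom
  have hf₀ : Function.Injective f₀ := by
    have := Algebra.Smooth.flat B C
    exact Algebra.TensorProduct.includeLeft_injective (IsFractionRing.injective B K)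
  refine isIntegrallyClosed_atPrime_of_pi (e'.toRingHom.comp f₀) (e'.injective.comp hf₀)
    (fun y hy => ?_) m A
  obtain ⟨P, hP, hP0⟩ := hy
  obtain ⟨c, hc⟩ := exists_algebraMap_eq_of_isIntegral_of_etale (B := B) (C := C) (K := K)
    (y := e'.symm y) ⟨P, hP, by
      have := Polynomial.hom_eval₂ P (e'.toRingHom.comp f₀) e'.symm.toRingHom y
      rw [hP0, map_zero] at this
      rw [this]
      congr 1
      ext c
      simp [f₀]⟩
  exact ⟨c, by
    change e' (c ⊗ₜ 1) = y
    rw [hc, RingEquiv.apply_symm_apply]⟩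

end EtaleNormal

section GenericHeight

theorem ringKrullDim_quotient_add_height_le {A : Type*} [CommRing A] (P : Ideal A) [P.IsPrime] :
    ringKrullDim (A ⧸ P) + (P.height : WithBot ℕ∞) ≤ ringKrullDim A := by
  let x : PrimeSpectrum A := ⟨P, inferInstance⟩
  have h1 : ringKrullDim (A ⧸ P) = Order.coheight x := by
    rw [ringKrullDim_quotient, Order.coheight_eq_krullDim_Ici]
    exact Order.krullDim_eq_of_orderIso (OrderIso.setCongr _ _ (by ext y; rfl))
  have h2 : P.height = Order.height x := PrimeSpectrum.height_eq_orderHeight x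
  have : Nonempty (PrimeSpectrum A) := ⟨x⟩
  rw [h1, h2, ringKrullDim, Order.krullDim_eq_iSup_height_add_coheight_of_nonempty]
  rw [add_comm, ← WithBot.coe_add]
  exact WithBot.coe_le_coe.2 (le_iSup (fun a => Order.height a + Order.coheight a) x)

variable {σ : Type}

theorem natCast_le_height_span_X [Finite σ] (r : ℕ) : ∀ Z : Set σ, Z.ncard = r →
    (r : ℕ∞) ≤ (Ideal.span (X '' Z) : Ideal (MvPolynomial σ ℂ)).height := by
  induction r with
  | zero => intro Z _; exact zero_le
  | succ r ih =>
    intro Z hZ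
    obtain ⟨v, hv⟩ : Z.Nonempty := by
      rw [Set.nonempty_iff_ne_empty]
      rintro rfl
      simp at hZ
    have h1 := ih (Z \ {v}) (by rw [Set.ncard_sdiff_singleton_of_mem hv, hZ]; omega)
    have := isPrime_span_X (Z \ {v})
    have := isPrime_span_X Z
    have h2 := Ideal.height_add_one_le_of_lt_of_isPrime
      (I := (Ideal.span (X '' (Z \ {v})) : Ideal (MvPolynomial σ ℂ))) (J := Ideal.span (X '' Z))
      (lt_of_le_of_ne (Ideal.span_mono (Set.image_mono Set.sdiff_subset)) fun h => by
        have h3 : (X v : MvPolynomial σ ℂ) ∈ Ideal.span (X '' (Z \ {v})) := by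
          rw [h]; exact X_mem_span_X_iff.2 hv
        exact (X_mem_span_X_iff.1 h3).2 rfl)
    refine le_trans ?_ h2
    rw [Nat.cast_succ]
    gcongr

theorem genIdeal_deleteColumn_lt {ι κ : Type} [Fintype ι] [Fintype κ] [DecidableEq ι]
    [DecidableEq κ] {Z : Set σ} {e : ι → κ → σ}
    (he : Function.Injective fun q : ι × κ => e q.1 q.2) (hZ : ∀ i c, e i c ∉ Z) [Nonempty ι]
    (h2 : Fintype.card ι ≤ Fintype.card κ) (c₀ : κ) :
    (genIdeal Z fun (i : ι) (c : {c // c ≠ c₀}) => e i c) < genIdeal Z e := by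
  classical
  refine lt_of_le_of_ne (genIdeal_columns_le Z e _) fun heq => ?_
  let i₀ : ι := Classical.arbitrary ι
  obtain ⟨g₀⟩ := Function.Embedding.nonempty_of_card_le h2
  let g : ι ↪ κ := g₀.trans (Equiv.swap (g₀ i₀) c₀).toEmbedding
  have hg : g i₀ = c₀ := by simp [g]
  let a : σ → ℂ := fun v => if ∃ i, e i (g i) = v then 1 else 0
  have ha : ∀ i c, a (e i c) = if g i = c then 1 else 0 := by
    intro i c
    simp only [a]
    congr 1
    refine propext ⟨?_, fun h => ⟨i, by rw [h]⟩⟩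
    rintro ⟨j, hj⟩
    have := @he (j, g j) (i, c) hj
    simp only [Prod.mk.injEq] at this
    rw [← this.1, this.2]
  have haZ : ∀ v ∈ Z, eval a (X v) = 0 := by
    intro v hv
    rw [eval_X]
    refine if_neg ?_
    rintro ⟨i, rfl⟩
    exact hZ _ _ hv
  have h1 : (genIdeal Z fun (i : ι) (c : {c // c ≠ c₀}) => e i c) ≤ RingHom.ker (eval a) := by
    refine genIdeal_le_ker (e := fun (i : ι) (c : {c // c ≠ c₀}) => e i c) (eval a) haZ
      (Pi.single i₀ 1) (by simp) fun c => ?_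
    rw [Finset.sum_eq_single i₀ (fun i _ hi => by simp [hi]) (by simp)]
    rw [eval_X, ha, hg, if_neg (Ne.symm c.2), mul_zero]
  let V : Matrix κ ι (MvPolynomial σ ℂ) := Matrix.of fun c i => if g i = c then 1 else 0
  have h3 : (genMat e * V).det ∈ genIdeal Z e :=
    maxMinors_le_genIdeal Z e (det_mul_mem_maxMinors _ _)
  rw [← heq] at h3
  have h4 : eval a (genMat e * V).det = 0 := h1 h3
  have h5 : (eval a).mapMatrix (genMat e * V) = 1 := by
    ext i j
    simp only [RingHom.mapMatrix_apply, Matrix.map_apply, Matrix.mul_apply, map_sum, map_mul, V,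
      Matrix.of_apply, genMat, eval_X, ha]
    simp [Matrix.one_apply, apply_ite (eval a), g.injective.eq_iff]
  rw [RingHom.map_det, h5, Matrix.det_one] at h4
  exact one_ne_zero h4

theorem natCast_le_height_genIdeal_aux [Finite σ] (k : ℕ) : ∀ (ι κ : Type) [Fintype ι] [Fintype κ]
    [DecidableEq ι] [DecidableEq κ] (Z : Set σ) (e : ι → κ → σ),
    (Function.Injective fun q : ι × κ => e q.1 q.2) → (∀ i c, e i c ∉ Z) → 1 ≤ Fintype.card ι →
    Fintype.card κ + 1 = Fintype.card ι + k →
    ((Z.ncard + k : ℕ) : ℕ∞) ≤ (genIdeal Z e).height := by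
  induction k with
  | zero =>
    intro ι κ _ _ _ _ Z e he hZ h1 h2
    rw [genIdeal_of_card_lt Z e (by omega)]
    exact natCast_le_height_span_X _ _ rfl
  | succ k ih =>
    intro ι κ _ _ _ _ Z e he hZ h1 h2
    have hι : Nonempty ι := Fintype.card_pos_iff.1 h1
    have hκ0 : 0 < Fintype.card κ := by omega
    obtain ⟨c₀⟩ := Fintype.card_pos_iff.1 hκ0
    have hκ : Fintype.card {c // c ≠ c₀} = Fintype.card κ - 1 := by
      rw [Fintype.card_subtype_compl, Fintype.card_subtype_eq]
    have hinj : Function.Injective fun q : ι × {c // c ≠ c₀} => e q.1 q.2 :=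
      injective_submatrix he Function.injective_id Subtype.val_injective
    have h3 := ih ι {c // c ≠ c₀} Z (fun i c => e i c) hinj (fun i c => hZ i c) h1 (by omega)
    have := genIdeal_isPrime he hZ h1 (by omega)
    have := genIdeal_isPrime (e := fun (i : ι) (c : {c // c ≠ c₀}) => e i c) (Z := Z) hinj
      (fun i c => hZ i c) h1 (by omega)
    have h4 := Ideal.height_add_one_le_of_lt_of_isPrime
      (genIdeal_deleteColumn_lt he hZ (by omega) c₀)
    refine le_trans ?_ h4
    rw [← add_assoc, Nat.cast_succ]
    gcongr

theorem natCast_le_height_genIdeal [Finite σ] {ι κ : Type} [Fintype ι] [Fintype κ]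
    [DecidableEq ι] [DecidableEq κ] {Z : Set σ} {e : ι → κ → σ} {ℓ : ℕ}
    (he : Function.Injective fun q : ι × κ => e q.1 q.2) (hZ : ∀ i c, e i c ∉ Z)
    (h1 : 1 ≤ Fintype.card ι) (h2 : Fintype.card ι ≤ Fintype.card κ + 1)
    (hℓ : ℓ + Fintype.card κ + 1 + Z.ncard = Nat.card σ + Fintype.card ι) :
    (Nat.card σ : ℕ∞) ≤ (genIdeal Z e).height + ℓ := by
  have := natCast_le_height_genIdeal_aux (Fintype.card κ + 1 - Fintype.card ι) ι κ Z e he hZ h1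
    (by omega)
  calc (Nat.card σ : ℕ∞) = ((Z.ncard + (Fintype.card κ + 1 - Fintype.card ι) : ℕ) : ℕ∞) + ℓ := by
        norm_cast; omega
    _ ≤ _ := by gcongr

end GenericHeight

section EtaleLocal

open TensorProduct RingTheory.Sequence

theorem isRegSeq_of_isRegular {R : Type*} [CommRing R] {rs : List R} (h : IsRegular R rs) :
    IsRegSeq rs := by
  refine ⟨fun h0 => h.top_ne_smul ?_, fun j hj b hb => ?_⟩
  · rw [smul_eq_mul, Ideal.mul_top]
    exact h0.symm
  · have h1 := h.regular_mod_prev j hj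
    have h2 : (Submodule.Quotient.mk b : R ⧸ (Ideal.ofList (rs.take j) • ⊤ : Submodule R R)) = 0 := by
      refine h1.right_eq_zero_of_smul ?_
      rw [← Submodule.Quotient.mk_smul, Submodule.Quotient.mk_eq_zero, smul_eq_mul, smul_eq_mul,
        Ideal.mul_top]
      rw [List.getD_eq_getElem _ _ hj] at hb
      exact hb
    rwa [Submodule.Quotient.mk_eq_zero, smul_eq_mul, Ideal.mul_top] at h2

theorem isWeaklyRegular_quotient_map {B A : Type*} [CommRing B] [CommRing A] [Algebra B A]
    [Module.Flat B A] (I : Ideal B) {rs : List B} (h : IsWeaklyRegular (B ⧸ I) rs) :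
    IsWeaklyRegular (A ⧸ I.map (algebraMap B A))
      ((rs.map (algebraMap B A)).map (algebraMap A (A ⧸ I.map (algebraMap B A)))) := by
  rw [isWeaklyRegular_map_algebraMap_iff]
  refine (LinearEquiv.isWeaklyRegular_congr
    (Algebra.TensorProduct.quotIdealMapEquivTensorQuot A I).toLinearEquiv _).2 ?_
  exact h.of_flat_of_isBaseChange (TensorProduct.isBaseChange B (B ⧸ I) A)

/-- The quotient of a localization at a prime `m ⊇ K` is the localization of the quotient. -/
theorem isLocalization_atPrime_quotient {R A : Type*} [CommRing R] [CommRing A] [Algebra R A]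
    (m : Ideal R) [m.IsPrime] [IsLocalization.AtPrime A m] {K : Ideal R} (hK : K ≤ m)
    [hm : (m.map (Ideal.Quotient.mk K)).IsPrime] :
    IsLocalization.AtPrime (A ⧸ K.map (algebraMap R A)) (m.map (Ideal.Quotient.mk K)) := by
  have hs : (m.map (Ideal.Quotient.mk K)).primeCompl =
      Algebra.algebraMapSubmonoid (R ⧸ K) m.primeCompl := by
    ext y
    have hc : ∀ c, Ideal.Quotient.mk K c ∈ m.map (Ideal.Quotient.mk K) ↔ c ∈ m := fun c => by
      rw [← Ideal.mem_comap, Ideal.comap_map_of_surjective _ Ideal.Quotient.mk_surjective,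
        ← RingHom.ker_eq_comap_bot, Ideal.mk_ker, sup_eq_left.2 hK]
    refine ⟨fun h => ?_, ?_⟩
    · obtain ⟨c, rfl⟩ := Ideal.Quotient.mk_surjective y
      exact ⟨c, fun h' => h ((hc c).2 h'), rfl⟩
    · rintro ⟨d, hd, rfl⟩ h
      exact hd ((hc d).1 h)
  change IsLocalization (m.map (Ideal.Quotient.mk K)).primeCompl _
  rw [hs]
  infer_instance

theorem isPrime_map_quotient_mk {R : Type*} [CommRing R] {K m : Ideal R} [m.IsPrime] (hK : K ≤ m) :
    (m.map (Ideal.Quotient.mk K)).IsPrime :=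
  Ideal.map_isPrime_of_surjective Ideal.Quotient.mk_surjective (by rwa [Ideal.mk_ker])

theorem isIntegrallyClosed_quotient_map_of_etale {B C A : Type} [CommRing B] [CommRing C] [CommRing A]
    [Algebra B C] [Algebra.Etale B C] [Algebra C A] [Algebra B A] [IsScalarTower B C A]
    (m : Ideal C) [m.IsPrime] [IsLocalization.AtPrime A m] (I : Ideal B) [I.IsPrime]
    [IsIntegrallyClosed (B ⧸ I)] (hIm : I.map (algebraMap B C) ≤ m) :
    IsDomain (A ⧸ I.map (algebraMap B A)) ∧ IsIntegrallyClosed (A ⧸ I.map (algebraMap B A)) := by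
  have hmap : I.map (algebraMap B A) = (I.map (algebraMap B C)).map (algebraMap C A) := by
    rw [Ideal.map_map, ← IsScalarTower.algebraMap_eq]
  rw [hmap]
  have _ : Algebra.Etale (B ⧸ I) (C ⧸ I.map (algebraMap B C)) :=
    .of_equiv (Algebra.TensorProduct.quotIdealMapEquivQuotTensor C I).symm
  let K := I.map (algebraMap B C)
  have hm' : (m.map (Ideal.Quotient.mk K)).IsPrime := isPrime_map_quotient_mk hIm
  have hloc := isLocalization_atPrime_quotient (A := A) m hIm
  exact isIntegrallyClosed_atPrime_of_etale (B := B ⧸ I) (m.map (Ideal.Quotient.mk K)) _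

theorem quotient_map_of_etale {B C A : Type} [CommRing B] [CommRing C] [CommRing A]
    [Algebra B C] [Algebra.Etale B C] [Algebra C A] [Algebra B A] [IsScalarTower B C A]
    [IsNoetherianRing B] [IsNoetherianRing A] (m : Ideal C) [m.IsPrime] [IsLocalization.AtPrime A m] {I mB : Ideal B}
    [I.IsPrime] [IsIntegrallyClosed (B ⧸ I)] (hImB : I ≤ mB) (hmB : mB.map (algebraMap B C) ≤ m)
    {ℓ n : ℕ} (hrs : HasRegSeq mB I ℓ) (hI : (n : ℕ∞) ≤ I.height + ℓ)
    (hA : ringKrullDim A ≤ n) :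
    IsDomain (A ⧸ I.map (algebraMap B A)) ∧ IsIntegrallyClosed (A ⧸ I.map (algebraMap B A)) ∧
      IsCMLocalRing (A ⧸ I.map (algebraMap B A)) ∧
      ringKrullDim (A ⧸ I.map (algebraMap B A)) = ℓ := by
  have hIm : I.map (algebraMap B C) ≤ m := (Ideal.map_mono hImB).trans hmB
  obtain ⟨hdom, hic⟩ := isIntegrallyClosed_quotient_map_of_etale (A := A) m I hIm
  set J := I.map (algebraMap B A) with hJ
  have hJp : J.IsPrime := (Ideal.Quotient.isDomain_iff_prime J).1 hdom
  have : IsLocalRing A := IsLocalization.AtPrime.isLocalRing A m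
  have : IsLocalRing (A ⧸ J) :=
    IsLocalRing.of_surjective' (Ideal.Quotient.mk J) Ideal.Quotient.mk_surjective
  have : Module.Flat B C := Algebra.Smooth.flat B C
  have : Module.Flat C A := IsLocalization.flat A m.primeCompl
  have : Module.Flat B A := Module.Flat.trans B C A
  obtain ⟨rs, hlen, hmem, hreg⟩ := hrs
  have hw := isWeaklyRegular_quotient_map (A := A) I hreg.toIsWeaklyRegular
  set rs' := (rs.map (algebraMap B A)).map (algebraMap A (A ⧸ J)) with hrs'
  have hmem' : ∀ r ∈ rs', r ∈ IsLocalRing.maximalIdeal (A ⧸ J) := by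
    intro r hr
    rw [hrs', List.map_map, List.mem_map] at hr
    obtain ⟨b, hb, rfl⟩ := hr
    have h1 : algebraMap B A b ∈ IsLocalRing.maximalIdeal A := by
      rw [IsScalarTower.algebraMap_apply B C A, IsLocalization.AtPrime.to_map_mem_maximal_iff A m]
      exact hmB (Ideal.mem_map_of_mem _ (hmem b hb))
    have h2 : IsLocalHom (Ideal.Quotient.mk J) :=
      IsLocalHom.of_surjective _ Ideal.Quotient.mk_surjective
    rw [IsLocalRing.mem_maximalIdeal, mem_nonunits_iff] at h1 ⊢
    exact fun h => h1 (isUnit_of_map_unit (Ideal.Quotient.mk J) _ h)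
  have hreg' : IsRegular (A ⧸ J) rs' :=
    (IsLocalRing.isRegular_iff_isWeaklyRegular_of_subset_maximalIdeal hmem').2 hw
  have hlen' : rs'.length = ℓ := by rw [hrs', List.length_map, List.length_map, hlen]
  have hdim : ringKrullDim (A ⧸ J) = ℓ := by
    refine le_antisymm ?_ ?_
    · have h1 := (ringKrullDim_quotient_add_height_le J).trans hA
      have hunder : I ≤ J.under B := Ideal.le_comap_map
      have h2 := Ideal.height_eq_height_add_of_liesOver_of_hasGoingDown (J.under B) J
      have h3 : I.height ≤ J.height := (Ideal.height_mono hunder).trans (h2 ▸ le_self_add)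
      have h4 : (n : ℕ∞) ≤ J.height + ℓ := hI.trans (by gcongr)
      have h5 : J.height ≠ ⊤ := Ideal.height_ne_top hJp.ne_top
      obtain ⟨h, hh⟩ := ENat.ne_top_iff_exists.1 h5
      rw [← hh] at h1 h4
      have h6 : n ≤ h + ℓ := by exact_mod_cast h4
      generalize ringKrullDim (A ⧸ J) = D at h1
      induction D using WithBot.recBotCoe with
      | bot => exact bot_le
      | coe D =>
        have h7 : D + (h : ℕ∞) ≤ n := by exact_mod_cast h1
        obtain ⟨k, rfl⟩ := ENat.ne_top_iff_exists.1 (show D ≠ ⊤ by rintro rfl; simp at h7)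
        have h8 : k + h ≤ n := by exact_mod_cast h7
        have h9 : k ≤ ℓ := by omega
        exact_mod_cast h9
    · rw [← ringKrullDim_add_length_eq_ringKrullDim_of_isRegular rs' hreg', hlen']
      have : Nontrivial ((A ⧸ J) ⧸ Ideal.ofList rs') := by
        refine Ideal.Quotient.nontrivial_iff.2 fun h => hreg'.top_ne_smul ?_
        rw [smul_eq_mul, Ideal.mul_top, h]
      exact le_add_of_nonneg_left (ringKrullDim_nonneg_of_nontrivial)
  refine ⟨hdom, hic, ⟨rs', fun r hr h => hmem' r hr h, isRegSeq_of_isRegular hreg', ?_⟩, hdim⟩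
  rw [hdim, hlen']
  rfl

end EtaleLocal

section LocalStructure

theorem IsRegSeq.map_ringEquiv {R S : Type*} [CommRing R] [CommRing S] (e : R ≃+* S) {rs : List R}
    (h : IsRegSeq rs) : IsRegSeq (rs.map e) := by
  have hspan : ∀ l : List R, Ideal.span {x | x ∈ l.map e} = (Ideal.span {x | x ∈ l}).map e := by
    intro l
    rw [Ideal.map_span]
    congr 1
    ext y
    simp
  refine ⟨fun h0 => h.1 ?_, fun j hj b hb => ?_⟩
  · rw [hspan] at h0
    have := congrArg (Ideal.comap e) h0
    rwa [Ideal.comap_map_of_bijective _ e.bijective, Ideal.comap_top] at this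
  · rw [← List.map_take, hspan] at hb ⊢
    rw [List.length_map] at hj
    obtain ⟨b, rfl⟩ := e.surjective b
    refine Ideal.mem_map_of_mem _ (h.2 j hj b ?_)
    have h2 : (rs.map e).getD j 0 * e b = e (rs.getD j 0 * b) := by
      rw [List.getD_eq_getElem _ _ hj, List.getD_eq_getElem _ _ (by simpa using hj),
        List.getElem_map, map_mul]
    rw [h2] at hb
    have := Ideal.mem_comap.2 hb
    rwa [Ideal.comap_map_of_bijective _ e.bijective] at this

/-- A Cohen–Macaulay normal domain of dimension `d`. -/
structure IsNormalCM (R : Type) [CommRing R] (d : ℕ) : Prop where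
  isDomain : IsDomain R
  isIntegrallyClosed : IsIntegrallyClosed R
  isCM : IsCMLocalRing R
  dim_eq : ringKrullDim R = d

theorem IsNormalCM.of_ringEquiv {R S : Type} [CommRing R] [CommRing S] {d : ℕ} (e : R ≃+* S)
    (h : IsNormalCM R d) : IsNormalCM S d := by
  have := h.isDomain
  have := h.isIntegrallyClosed
  obtain ⟨rs, hu, hreg, hlen⟩ := h.isCM
  refine ⟨e.symm.toMulEquiv.isDomain R, IsIntegrallyClosed.of_equiv e, ⟨rs.map e, fun r hr => ?_,
    hreg.map_ringEquiv e, ?_⟩, ?_⟩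
  · obtain ⟨r', hr', rfl⟩ := List.mem_map.1 hr
    exact fun h => hu r' hr' ((MulEquiv.isUnit_map e).1 h)
  · rw [List.length_map, hlen, ringKrullDim_eq_of_ringEquiv e]
  · rw [← ringKrullDim_eq_of_ringEquiv e, h.dim_eq]

theorem mem_vanishingIdeal_singleton {τ : Type} {x : τ → ℂ} {f : MvPolynomial τ ℂ} :
    f ∈ vanishingIdeal ℂ {x} ↔ eval x f = 0 := by
  simp [mem_vanishingIdeal_iff]

instance isPrime_vanishingIdeal_singleton {τ : Type} (x : τ → ℂ) :
    (vanishingIdeal ℂ {x}).IsPrime := by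
  have : (vanishingIdeal ℂ {x}) = RingHom.ker (eval x) := by
    ext f; rw [mem_vanishingIdeal_singleton, RingHom.mem_ker]
  rw [this]
  exact RingHom.ker_isPrime _

/-- If `φ` is a system of local coordinates at `x`, then the pullback along `φ` of a generic
determinantal ideal defines a normal Cohen–Macaulay local ring at `x`. -/
theorem isNormalCM_quotient_map_genIdeal {σ τ : Type} [Fintype σ] [DecidableEq σ] [Finite τ]
    (ε : σ ≃ τ) (φ : σ → MvPolynomial τ ℂ) (x : τ → ℂ) (hx : ∀ v, eval x (φ v) = 0)
    (hdet : (Matrix.of fun v w : σ => eval x (pderiv (ε w) (φ v))).det ≠ 0)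
    {ι κ : Type} [Fintype ι] [Fintype κ]
    [DecidableEq ι] [DecidableEq κ] {Z : Set σ} {e : ι → κ → σ} {ℓ : ℕ}
    (he : Function.Injective fun q : ι × κ => e q.1 q.2) (hZ : ∀ i c, e i c ∉ Z)
    (h1 : 1 ≤ Fintype.card ι) (h2 : Fintype.card ι ≤ Fintype.card κ + 1)
    (hℓ : ℓ + Fintype.card κ + 1 + Z.ncard = Nat.card σ + Fintype.card ι)
    (A : Type) [CommRing A] [Algebra (MvPolynomial τ ℂ) A]
    [IsLocalization.AtPrime A (vanishingIdeal ℂ {x})] :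
    IsNormalCM (A ⧸ ((genIdeal Z e).map (aeval φ : MvPolynomial σ ℂ →ₐ[ℂ] MvPolynomial τ ℂ)).map
      (algebraMap (MvPolynomial τ ℂ) A)) ℓ := by
  classical
  let R := MvPolynomial τ ℂ
  let B := MvPolynomial σ ℂ
  let jac : Matrix σ σ R := Matrix.of fun v w : σ => pderiv (ε w) (φ v)
  let g : R := jac.det
  have hg : eval x g ≠ 0 := by
    simp only [g, RingHom.map_det]
    exact hdet
  let C := Localization.Away g
  let f : B →+* C := (algebraMap R C).comp (aeval φ : B →ₐ[ℂ] R).toRingHom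
  let _ : Algebra B C := f.toAlgebra
  have hf : ∀ b : B, algebraMap B C b = algebraMap R C (aeval φ b) := fun b => rfl
  have _ : IsScalarTower ℂ B C := IsScalarTower.of_algebraMap_eq fun z => by
    rw [hf, AlgHom.commutes, ← IsScalarTower.algebraMap_apply]
  have hE : Algebra.Etale B C := by
    refine etale_of_isUnit_jacobian ε φ g (fun v => by rw [hf, aeval_X]) ?_
    have h3 : (Matrix.of fun v w : σ => algebraMap R C (pderiv (ε w) (φ v))) =
        (algebraMap R C).mapMatrix jac := rfl
    rw [h3, ← RingHom.map_det]
    exact IsLocalization.Away.algebraMap_isUnit g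
  have hdisj : Disjoint (Submonoid.powers g : Set R) (vanishingIdeal ℂ {x} : Ideal R) := by
    rw [Set.disjoint_left]
    rintro _ ⟨k, rfl⟩ hk
    have hk' := mem_vanishingIdeal_singleton.1 hk
    rw [map_pow] at hk'
    exact hg (eq_zero_of_pow_eq_zero hk')
  let m : Ideal C := (vanishingIdeal ℂ {x} : Ideal R).map (algebraMap R C)
  have hm : m.IsPrime := IsLocalization.isPrime_of_isPrime_disjoint (Submonoid.powers g) C _
    inferInstance hdisj
  have hmc : m.comap (algebraMap R C) = vanishingIdeal ℂ {x} :=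
    IsLocalization.under_map_of_isPrime_disjoint (Submonoid.powers g) C inferInstance hdisj
  let A₀ := Localization.AtPrime m
  have hA₀ : IsLocalization.AtPrime A₀ (vanishingIdeal ℂ {x} : Ideal R) := by
    have := IsLocalization.isLocalization_isLocalization_atPrime_isLocalization
      (Submonoid.powers g) (S := C) A₀ m
    convert this
    exact hmc.symm
  have hA₀dim : ringKrullDim A₀ ≤ Nat.card σ := by
    rw [IsLocalization.AtPrime.ringKrullDim_eq_height (vanishingIdeal ℂ {x} : Ideal R) A₀]
    refine (Ideal.height_le_ringKrullDim_of_isPrime).trans ?_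
    rw [MvPolynomial.ringKrullDim_of_isNoetherianRing, ringKrullDim_eq_zero_of_field, zero_add,
      Nat.card_congr ε]
  have _ : (genIdeal Z e).IsPrime := genIdeal_isPrime he hZ h1 h2
  have _ := genIdeal_isIntegrallyClosed he hZ h1 h2
  have _ : IsNoetherianRing A₀ := IsLocalization.isNoetherianRing m.primeCompl A₀
    (IsLocalization.isNoetherianRing (Submonoid.powers g) C inferInstance)
  have h4 := quotient_map_of_etale (B := B) (C := C) (A := A₀) m
    (genIdeal_le_span_range_X Z e h1) (by
      rw [Ideal.map_le_iff_le_comap, Ideal.span_le]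
      rintro _ ⟨v, -, rfl⟩
      change algebraMap B C (X v) ∈ m
      rw [hf, aeval_X]
      exact Ideal.mem_map_of_mem _ (mem_vanishingIdeal_singleton.2 (hx v)))
    (hasRegSeq_genIdeal he hZ h1 h2 hℓ) (natCast_le_height_genIdeal he hZ h1 h2 hℓ) hA₀dim
  have h5 : (genIdeal Z e).map (algebraMap B A₀) =
      ((genIdeal Z e).map (aeval φ : B →ₐ[ℂ] R)).map (algebraMap R A₀) := by
    rw [IsScalarTower.algebraMap_eq B C A₀, ← Ideal.map_map, IsScalarTower.algebraMap_eq R C A₀,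
      ← Ideal.map_map]
    congr 1
    exact (Ideal.map_map (aeval φ : B →ₐ[ℂ] R).toRingHom (algebraMap R C)).symm
  rw [h5] at h4
  let E : A₀ ≃ₐ[R] A := IsLocalization.algEquiv (vanishingIdeal ℂ {x} : Ideal R).primeCompl A₀ A
  refine IsNormalCM.of_ringEquiv (Ideal.quotientEquiv _ _ E.toRingEquiv ?_)
    ⟨h4.1, h4.2.1, h4.2.2.1, h4.2.2.2⟩
  rw [Ideal.map_map (algebraMap R A₀)]
  congr 1
  exact RingHom.ext fun r => (E.commutes r).symm

end LocalStructure

section Elimination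

open TensorProduct KaehlerDifferential

theorem exists_derivation_extending {k R L : Type} [CommRing k] [CommRing R] [Field L] [Algebra k R]
    [Algebra k L] [Algebra R L] [IsScalarTower k R L] [Algebra.FormallySmooth R L]
    (d : Derivation k R L) : ∃ D : Derivation k L L, ∀ r, D (algebraMap R L r) = d r := by
  have hinj : LinearMap.ker (mapBaseChange k R L) = ⊥ := by
    refine (Submodule.eq_bot_iff _).2 fun x hx => ?_
    obtain ⟨y, rfl⟩ := (Algebra.H1Cotangent.exact_δ_mapBaseChange k R L x).1 hx
    rw [Subsingleton.elim y 0, map_zero]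
  obtain ⟨s, hs⟩ := LinearMap.exists_leftInverse_of_injective _ hinj
  let t : L ⊗[R] Ω[R⁄k] →ₗ[L] L := LinearMap.liftBaseChange L d.liftKaehlerDifferential
  refine ⟨(t ∘ₗ s).compDer (KaehlerDifferential.D k L), fun r => ?_⟩
  have h1 : mapBaseChange k R L (1 ⊗ₜ KaehlerDifferential.D k R r) =
      KaehlerDifferential.D k L (algebraMap R L r) := by simp
  change t (s (KaehlerDifferential.D k L (algebraMap R L r))) = d r
  rw [← h1, ← LinearMap.comp_apply s, hs]
  simp [t]

theorem exists_derivation_extending_of_injective {k R L : Type} [Field k] [CharZero k] [CommRing R]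
    [IsDomain R] [Field L] [Algebra k R] [Algebra k L] [Algebra R L] [IsScalarTower k R L]
    [Algebra.EssFiniteType k L] (hinj : Function.Injective (algebraMap R L))
    (d : Derivation k R L) : ∃ D : Derivation k L L, ∀ r, D (algebraMap R L r) = d r := by
  have _ : FaithfulSMul R L := (faithfulSMul_iff_algebraMap_injective _ _).2 hinj
  let K := FractionRing R
  let _ : Algebra K L := FractionRing.liftAlgebra R L
  have _ : IsScalarTower R K L := FractionRing.isScalarTower_liftAlgebra _ _
  have _ : IsScalarTower k K L := IsScalarTower.of_algebraMap_eq fun r => by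
    rw [IsScalarTower.algebraMap_apply k R L, IsScalarTower.algebraMap_apply k R K,
      ← IsScalarTower.algebraMap_apply R K L]
  have _ : Algebra.EssFiniteType K L := .of_comp k K L
  have _ : CharZero K := charZero_of_injective_algebraMap (algebraMap k K).injective
  have _ : Algebra.FormallyEtale R K := .of_isLocalization (nonZeroDivisors R)
  have _ : Algebra.FormallySmooth R L := .comp _ K L
  exact exists_derivation_extending d

theorem exists_derivation_fractionField {α P L : Type} [CommRing P] [IsDomain P] [Algebra ℂ P]
    [Algebra.FiniteType ℂ P] [Field L] [Algebra ℂ L] [Algebra P L] [IsScalarTower ℂ P L]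
    [IsFractionRing P L] (f : MvPolynomial α ℂ →ₐ[ℂ] P) (hf : Function.Injective f) (d : α → L) :
    ∃ D : Derivation ℂ L L, ∀ a, D (algebraMap P L (f (X a))) = d a := by
  let _ : Algebra (MvPolynomial α ℂ) L := ((algebraMap P L).comp f.toRingHom).toAlgebra
  have hL : ∀ r, algebraMap (MvPolynomial α ℂ) L r = algebraMap P L (f r) := fun r => rfl
  have _ : IsScalarTower ℂ (MvPolynomial α ℂ) L := IsScalarTower.of_algebraMap_eq fun r => by
    rw [hL, AlgHom.commutes, ← IsScalarTower.algebraMap_apply]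
  have _ : Algebra.EssFiniteType P L := .of_isLocalization L (nonZeroDivisors P)
  have _ : Algebra.EssFiniteType ℂ L := .comp ℂ P L
  have hinj : Function.Injective (algebraMap (MvPolynomial α ℂ) L) := fun r s hrs =>
    hf (IsFractionRing.injective P L hrs)
  obtain ⟨D, hD⟩ := exists_derivation_extending_of_injective hinj (mkDerivation ℂ d)
  exact ⟨D, fun a => by rw [← hL, hD, mkDerivation_X]⟩

/-- A polynomial ideal in variables `α ⊕ β` either contains a nonzero polynomial in the variables
`α`, or it has a zero in a field in which the partial derivatives with respect to the variables
`α` exist. -/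
theorem exists_eliminant_or_field {α β : Type} [Finite α] [Finite β]
    (I : Ideal (MvPolynomial (α ⊕ β) ℂ)) :
    (∃ h : MvPolynomial α ℂ, h ≠ 0 ∧ rename Sum.inl h ∈ I) ∨
    ∃ (L : Type) (_ : Field L) (_ : Algebra ℂ L) (z : α ⊕ β → L), (∀ f ∈ I, aeval z f = 0) ∧
      ∀ d : α → L, ∃ D : Derivation ℂ L L, ∀ a, D (z (Sum.inl a)) = d a := by
  classical
  refine or_iff_not_imp_left.2 fun hI => ?_
  push Not at hI
  let S : Submonoid (MvPolynomial (α ⊕ β) ℂ) :=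
    (nonZeroDivisors (MvPolynomial α ℂ)).map (rename (R := ℂ) (Sum.inl : α → α ⊕ β))
  obtain ⟨q, hq, hIq, hqS⟩ := Ideal.exists_le_prime_disjoint I S (by
    rw [Set.disjoint_left]
    rintro f hf ⟨h, hh, rfl⟩
    exact hI h (nonZeroDivisors.ne_zero hh) hf)
  let P := MvPolynomial (α ⊕ β) ℂ ⧸ q
  let f : MvPolynomial α ℂ →ₐ[ℂ] P := (Ideal.Quotient.mkₐ ℂ q).comp (rename Sum.inl)
  have hinj : Function.Injective f := by
    rw [injective_iff_map_eq_zero]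
    intro h hh
    by_contra h0
    exact Set.disjoint_left.1 hqS (Ideal.Quotient.eq_zero_iff_mem.1 hh)
      ⟨h, mem_nonZeroDivisors_of_ne_zero h0, rfl⟩
  refine ⟨FractionRing P, inferInstance, inferInstance,
    fun v => algebraMap P _ (Ideal.Quotient.mk q (X v)), fun g hg => ?_, fun d => ?_⟩
  · have h1 : aeval (fun v => algebraMap P (FractionRing P) (Ideal.Quotient.mk q (X v))) =
        (IsScalarTower.toAlgHom ℂ P (FractionRing P)).comp (Ideal.Quotient.mkₐ ℂ q) :=
      algHom_ext fun v => by rw [aeval_X]; rfl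
    rw [h1]
    change algebraMap P (FractionRing P) (Ideal.Quotient.mk q g) = 0
    rw [Ideal.Quotient.eq_zero_iff_mem.2 (hIq hg), map_zero]
  · obtain ⟨D, hD⟩ := exists_derivation_fractionField (L := FractionRing P) f hinj d
    refine ⟨D, fun a => ?_⟩
    rw [← hD, AlgHom.comp_apply, rename_X]
    rfl

theorem derivation_aeval {σ L : Type} [Fintype σ] [CommRing L] [Algebra ℂ L]
    (D : Derivation ℂ L L) (x : σ → L) (f : MvPolynomial σ ℂ) :
    D (aeval x f) = ∑ q, D (x q) * aeval x (pderiv q f) := by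
  classical
  induction f using MvPolynomial.induction_on with
  | C r => simp [algHom_C]
  | add f g hf hg => simp only [map_add, hf, hg, mul_add, Finset.sum_add_distrib]
  | mul_X f v hf =>
    rw [map_mul, Derivation.leibniz, hf]
    simp only [Derivation.leibniz, map_add, smul_eq_mul, map_mul, aeval_X, pderiv_X, mul_add,
      Finset.sum_add_distrib, Finset.mul_sum]
    congr 1
    · simp [Pi.single_apply, apply_ite (aeval x), mul_comm]
    · exact Finset.sum_congr rfl fun q _ => by ring

end Elimination

section PolarIncidence

open Matrix

variable {π μ ν T T' : Type} [Fintype π] [Fintype μ] [Fintype ν] [DecidableEq π] [DecidableEq μ]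
  [DecidableEq ν] [CommRing T] [Algebra ℂ T] [CommRing T'] [Algebra ℂ T']

theorem algHom_aeval (f : T →ₐ[ℂ] T') (x : ν → T) (g : MvPolynomial ν ℂ) :
    f (aeval x g) = aeval (fun l => f (x l)) g :=
  congrArg (fun h : MvPolynomial ν ℂ →ₐ[ℂ] T' => h g) (comp_aeval x f)

/-- The Jacobian of `F` with the rows `a_k - c • x` appended. -/
noncomputable def polarMat (F : π → MvPolynomial ν ℂ) (c : ℂ) (a : Matrix μ ν T) (x : ν → T) :
    Matrix (π ⊕ μ) ν T :=
  Matrix.fromRows (Matrix.of fun k l => aeval x (pderiv l (F k)))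
    (Matrix.of fun k l => a k l - algebraMap ℂ T c * x l)

/-- The derivative of `polarMat` with respect to the variable `q`. -/
noncomputable def polarMatDeriv (μ : Type) (F : π → MvPolynomial ν ℂ) (c : ℂ) (x : ν → T) (q : ν) :
    Matrix (π ⊕ μ) ν T :=
  Matrix.fromRows (Matrix.of fun k l => aeval x (pderiv q (pderiv l (F k))))
    (Matrix.of fun _ l => if l = q then -algebraMap ℂ T c else 0)

/-- The variables of the incidence variety of degenerate points. -/
structure PolarPoint (π μ ν T : Type) where
  a : Matrix μ ν T
  x : ν → T
  Q : Matrix ν π T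
  K : Matrix (π ⊕ μ) (π ⊕ μ) T
  V : Matrix ν (π ⊕ μ) T
  τ : π → T
  Y : Matrix (π ⊕ μ) ν T

namespace PolarPoint

/-- The index type of the variables of a `PolarPoint` other than `a`. -/
abbrev Idx (π μ ν : Type) : Type :=
  ν ⊕ (ν × π) ⊕ ((π ⊕ μ) × (π ⊕ μ)) ⊕ (ν × (π ⊕ μ)) ⊕ π ⊕ ((π ⊕ μ) × ν)

/-- The point with given coordinates. -/
def ofFun (w : (μ × ν) ⊕ Idx π μ ν → T) : PolarPoint π μ ν T where
  a := Matrix.of fun k l => w (.inl (k, l))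
  x l := w (.inr (.inl l))
  Q := Matrix.of fun l k => w (.inr (.inr (.inl (l, k))))
  K := Matrix.of fun i j => w (.inr (.inr (.inr (.inl (i, j)))))
  V := Matrix.of fun i j => w (.inr (.inr (.inr (.inr (.inl (i, j))))))
  τ k := w (.inr (.inr (.inr (.inr (.inr (.inl k))))))
  Y := Matrix.of fun i j => w (.inr (.inr (.inr (.inr (.inr (.inr (i, j)))))))

/-- The coordinates of a point. -/
def toFun (z : PolarPoint π μ ν T) : (μ × ν) ⊕ Idx π μ ν → T
  | .inl q => z.a q.1 q.2
  | .inr (.inl l) => z.x l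
  | .inr (.inr (.inl q)) => z.Q q.1 q.2
  | .inr (.inr (.inr (.inl q))) => z.K q.1 q.2
  | .inr (.inr (.inr (.inr (.inl q)))) => z.V q.1 q.2
  | .inr (.inr (.inr (.inr (.inr (.inl k))))) => z.τ k
  | .inr (.inr (.inr (.inr (.inr (.inr q))))) => z.Y q.1 q.2

/-- The equations of the incidence variety: `x` is a zero of `F` at which the Jacobian has a right
inverse, `K` and `V` annihilate the polar matrix, `V * K` is nonzero, and the corresponding
combination of the differentials of the entries of the polar matrix is a combination of the
differentials of `F`. -/
noncomputable def rel (F : π → MvPolynomial ν ℂ) (c : ℂ) (z : PolarPoint π μ ν T) :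
    π ⊕ (π × π) ⊕ ((π ⊕ μ) × ν) ⊕ ((π ⊕ μ) × (π ⊕ μ)) ⊕ ν ⊕ Unit → T
  | .inl k => aeval z.x (F k)
  | .inr (.inl (k, k')) => ∑ l, aeval z.x (pderiv l (F k)) * z.Q l k' - (1 : Matrix π π T) k k'
  | .inr (.inr (.inl (i, l))) => (z.K * polarMat F c z.a z.x) i l
  | .inr (.inr (.inr (.inl (i, j)))) => (polarMat F c z.a z.x * z.V) i j
  | .inr (.inr (.inr (.inr (.inl q)))) =>
      (z.V * z.K * polarMatDeriv μ F c z.x q).trace - ∑ k, z.τ k * aeval z.x (pderiv q (F k))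
  | .inr (.inr (.inr (.inr (.inr _)))) => (z.V * z.K * z.Y).trace - 1

/-- Base change of points. -/
def map (f : T → T') (z : PolarPoint π μ ν T) : PolarPoint π μ ν T' where
  a := z.a.map f
  x l := f (z.x l)
  Q := z.Q.map f
  K := z.K.map f
  V := z.V.map f
  τ k := f (z.τ k)
  Y := z.Y.map f

theorem polarMat_map (F : π → MvPolynomial ν ℂ) (c : ℂ) (f : T →ₐ[ℂ] T') (a : Matrix μ ν T)
    (x : ν → T) : polarMat F c (a.map f) (fun l => f (x l)) = (polarMat F c a x).map f := by
  ext i l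
  rcases i with k | k
  · simp only [polarMat, fromRows_apply_inl, of_apply, map_apply]
    exact (algHom_aeval f x _).symm
  · simp [polarMat]

theorem polarMatDeriv_map (F : π → MvPolynomial ν ℂ) (c : ℂ) (f : T →ₐ[ℂ] T')
    (x : ν → T) (q : ν) :
    polarMatDeriv μ F c (fun l => f (x l)) q = (polarMatDeriv μ F c x q).map f := by
  ext i l
  rcases i with k | k
  · simp only [polarMatDeriv, fromRows_apply_inl, of_apply, map_apply]
    exact (algHom_aeval f x _).symm
  · simp [polarMatDeriv, apply_ite f]

theorem rel_map (F : π → MvPolynomial ν ℂ) (c : ℂ) (f : T →ₐ[ℂ] T') (z : PolarPoint π μ ν T) (i) :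
    rel F c (z.map f) i = f (rel F c z i) := by
  have haev : ∀ g : MvPolynomial ν ℂ, aeval (fun l => f (z.x l)) g = f (aeval z.x g) := fun g =>
    (algHom_aeval f z.x g).symm
  have hmul : ∀ {α β γ : Type} [Fintype β] (M : Matrix α β T) (N : Matrix β γ T),
      M.map f * N.map f = (M * N).map f := fun M N => (Matrix.map_mul (f := f.toRingHom)).symm
  have htr : ∀ {α : Type} [Fintype α] (M : Matrix α α T), (M.map f).trace = f M.trace :=
    fun M => (map_sum f _ _).symm
  rcases i with k | ⟨k, k'⟩ | ⟨i, l⟩ | ⟨i, j⟩ | q | _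
  · exact haev _
  · simp only [rel, map, haev, map_sub, map_sum, map_mul, map_apply, Matrix.one_apply,
      apply_ite f, map_one, map_zero]
  · simp only [rel, map, polarMat_map, hmul, map_apply]
  · simp only [rel, map, polarMat_map, hmul, map_apply]
  · simp only [rel, map, polarMatDeriv_map, hmul, htr, haev, map_sub, map_sum, map_mul]
  · simp only [rel, map, hmul, htr, map_sub, map_one]

end PolarPoint

end PolarIncidence

section PolarIncidence

open Matrix

variable {π μ ν : Type} [Fintype π] [Fintype μ] [Fintype ν] [DecidableEq π] [DecidableEq μ]
  [DecidableEq ν]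

theorem Derivation.map_matrix_mul {L α β γ : Type} [CommRing L] [Algebra ℂ L] [Fintype β]
    (D : Derivation ℂ L L) (M : Matrix α β L) (N : Matrix β γ L) :
    (M * N).map D = M.map D * N + M * N.map D := by
  ext i j
  simp only [Matrix.map_apply, Matrix.mul_apply, map_sum, Derivation.leibniz, Matrix.add_apply,
    smul_eq_mul, ← Finset.sum_add_distrib]
  exact Finset.sum_congr rfl fun k _ => by ring

theorem polarMat_map_derivation {L : Type} [CommRing L] [Algebra ℂ L] (D : Derivation ℂ L L)
    (F : π → MvPolynomial ν ℂ) (c : ℂ) (a : Matrix μ ν L) (x : ν → L) :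
    (polarMat F c a x).map D =
      ∑ q, D (x q) • polarMatDeriv μ F c x q + Matrix.fromRows 0 (a.map D) := by
  ext i l
  rcases i with k | k
  · simp [polarMat, polarMatDeriv, Matrix.sum_apply, derivation_aeval]
  · simp [polarMat, polarMatDeriv, Matrix.sum_apply, Derivation.leibniz]
    ring

namespace PolarPoint

theorem exists_rel_ne_zero {L : Type} [Field L] [Algebra ℂ L] (F : π → MvPolynomial ν ℂ) (c : ℂ)
    (z : PolarPoint π μ ν L)
    (hD : ∀ d : Matrix μ ν L, ∃ D : Derivation ℂ L L, ∀ k l, D (z.a k l) = d k l) :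
    ∃ i, rel F c z i ≠ 0 := by
  by_contra! h
  have hF : ∀ k, aeval z.x (F k) = 0 := fun k => h (.inl k)
  have hQ : ∀ k k', ∑ l, aeval z.x (pderiv l (F k)) * z.Q l k' = (1 : Matrix π π L) k k' :=
    fun k k' => sub_eq_zero.1 (h (.inr (.inl (k, k'))))
  have hK : z.K * polarMat F c z.a z.x = 0 := by
    ext i l; exact h (.inr (.inr (.inl (i, l))))
  have hV : polarMat F c z.a z.x * z.V = 0 := by
    ext i j; exact h (.inr (.inr (.inr (.inl (i, j)))))
  have hτ : ∀ q, (z.V * z.K * polarMatDeriv μ F c z.x q).trace =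
      ∑ k, z.τ k * aeval z.x (pderiv q (F k)) :=
    fun q => sub_eq_zero.1 (h (.inr (.inr (.inr (.inr (.inl q))))))
  have hY : (z.V * z.K * z.Y).trace = 1 :=
    sub_eq_zero.1 (h (.inr (.inr (.inr (.inr (.inr ()))))))
  have htr : ∀ D : Derivation ℂ L L, ∑ l, ∑ k, (z.V * z.K) l (.inr k) * D (z.a k l) = 0 := by
    intro D
    have h1 : z.K * (polarMat F c z.a z.x).map D * z.V = 0 := by
      have h2 := D.map_matrix_mul z.K (polarMat F c z.a z.x)
      rw [hK] at h2
      have h3 : (0 : Matrix (π ⊕ μ) ν L).map D = 0 := by ext; simp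
      rw [h3] at h2
      rw [eq_neg_of_add_eq_zero_right h2.symm, Matrix.neg_mul, Matrix.mul_assoc, hV,
        Matrix.mul_zero, neg_zero]
    have h2 : (z.V * z.K * (polarMat F c z.a z.x).map D).trace = 0 := by
      rw [Matrix.mul_assoc, Matrix.trace_mul_comm, h1, Matrix.trace_zero]
    rw [polarMat_map_derivation, Matrix.mul_add, Matrix.trace_add, Matrix.mul_sum,
      Matrix.trace_sum] at h2
    have h3 : ∑ q, (z.V * z.K * D (z.x q) • polarMatDeriv μ F c z.x q).trace = 0 := by
      calc _ = ∑ q, ∑ k, z.τ k * (D (z.x q) * aeval z.x (pderiv q (F k))) :=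
            Finset.sum_congr rfl fun q _ => by
              rw [Matrix.mul_smul, Matrix.trace_smul, hτ, smul_eq_mul, Finset.mul_sum]
              exact Finset.sum_congr rfl fun k _ => by ring
        _ = ∑ k, z.τ k * D (aeval z.x (F k)) := by
              rw [Finset.sum_comm]
              exact Finset.sum_congr rfl fun k _ => by rw [derivation_aeval, Finset.mul_sum]
        _ = 0 := by simp [hF]
    rw [h3, zero_add] at h2
    rw [← h2]
    simp [Matrix.trace, Matrix.mul_apply]
  have hr : ∀ l k, (z.V * z.K) l (.inr k) = 0 := by
    intro l k
    obtain ⟨D, hd⟩ := hD (Matrix.single k l 1)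
    have h1 := htr D
    rw [Finset.sum_eq_single l, Finset.sum_eq_single k] at h1
    · simpa [hd] using h1
    · intro k' _ hk'
      simp [hd, Matrix.single_apply_of_row_ne hk'.symm]
    · simp
    · intro l' _ hl'
      exact Finset.sum_eq_zero fun k' _ => by simp [hd, Matrix.single_apply_of_col_ne _ _ hl'.symm]
    · simp
  have hl : ∀ l k, (z.V * z.K) l (.inl k) = 0 := by
    intro l k
    have h1 : z.V * z.K * polarMat F c z.a z.x = 0 := by
      rw [Matrix.mul_assoc, hK, Matrix.mul_zero]
    have h2 : ∀ l', ∑ k, (z.V * z.K) l (.inl k) * aeval z.x (pderiv l' (F k)) = 0 := by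
      intro l'
      have := congrFun (congrFun h1 l) l'
      rw [Matrix.mul_apply, Fintype.sum_sum_type] at this
      simpa [hr, polarMat] using this
    calc (z.V * z.K) l (.inl k) = ∑ k', (z.V * z.K) l (.inl k') * (1 : Matrix π π L) k' k := by
          simp [Matrix.one_apply]
      _ = ∑ l', (∑ k', (z.V * z.K) l (.inl k') * aeval z.x (pderiv l' (F k'))) * z.Q l' k := by
          simp only [← hQ, Finset.mul_sum, Finset.sum_mul]
          rw [Finset.sum_comm]
          exact Finset.sum_congr rfl fun _ _ => Finset.sum_congr rfl fun _ _ => by ring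
      _ = 0 := by simp [h2]
  have h0 : z.V * z.K = 0 := by
    ext l (k | k)
    · exact hl l k
    · exact hr l k
  rw [h0, Matrix.zero_mul, Matrix.trace_zero] at hY
  exact zero_ne_one hY

/-- The matrices `a` occurring in a point of the incidence variety satisfy a nontrivial
polynomial equation. -/
theorem exists_eliminant (F : π → MvPolynomial ν ℂ) (c : ℂ) :
    ∃ h : MvPolynomial (μ × ν) ℂ, h ≠ 0 ∧ ∀ z : PolarPoint π μ ν ℂ, (∀ i, rel F c z i = 0) →
      eval (fun q => z.a q.1 q.2) h = 0 := by
  let Z : PolarPoint π μ ν (MvPolynomial ((μ × ν) ⊕ Idx π μ ν) ℂ) := ofFun X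
  rcases exists_eliminant_or_field (Ideal.span (Set.range (rel F c Z))) with
    ⟨h, h0, hh⟩ | ⟨L, _, _, w, hw, hD⟩
  · refine ⟨h, h0, fun z hz => ?_⟩
    have h1 : Z.map (aeval z.toFun : MvPolynomial ((μ × ν) ⊕ Idx π μ ν) ℂ →ₐ[ℂ] ℂ) = z := by
      cases z
      simp only [map, Z, ofFun, Matrix.map, Matrix.of_apply, aeval_X]
      rfl
    have h2 : Ideal.span (Set.range (rel F c Z)) ≤
        RingHom.ker (aeval z.toFun : MvPolynomial ((μ × ν) ⊕ Idx π μ ν) ℂ →ₐ[ℂ] ℂ) := by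
      rw [Ideal.span_le]
      rintro _ ⟨i, rfl⟩
      change aeval z.toFun (rel F c Z i) = 0
      rw [← rel_map, h1, hz]
    have h3 : aeval z.toFun (rename Sum.inl h) = 0 := h2 hh
    rw [aeval_rename] at h3
    exact h3
  · have h1 : ∀ i, rel F c (Z.map (aeval w : _ →ₐ[ℂ] L)) i = 0 := fun i => by
      rw [rel_map]
      exact hw _ (Ideal.subset_span ⟨i, rfl⟩)
    obtain ⟨i, hi⟩ := exists_rel_ne_zero F c (Z.map (aeval w : _ →ₐ[ℂ] L)) fun d => by
      obtain ⟨D, hD⟩ := hD fun q => d q.1 q.2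
      refine ⟨D, fun k l => ?_⟩
      rw [← hD (k, l)]
      simp [map, Z, ofFun]
    exact absurd (h1 i) hi

end PolarPoint

end PolarIncidence

section Pivot

open Matrix

/-- A matrix over a field can be brought, by permuting rows and columns, into a form with an
invertible leading block of zero Schur complement. -/
theorem Matrix.exists_pivot_block {k ρ ν : Type} [Field k] [Fintype ρ] [Fintype ν]
    (M : Matrix ρ ν k) :
    ∃ (r : ℕ) (ι κ : Type) (_ : Fintype ι) (_ : Fintype κ) (f : Fin r ⊕ ι ≃ ρ) (g : Fin r ⊕ κ ≃ ν),
      r ≤ M.rank ∧ (M.submatrix f g).toBlocks₁₁.det ≠ 0 ∧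
      (M.submatrix f g).toBlocks₁₁.det • (M.submatrix f g).toBlocks₂₂ =
        (M.submatrix f g).toBlocks₂₁ * (M.submatrix f g).toBlocks₁₁.adjugate *
          (M.submatrix f g).toBlocks₁₂ := by
  classical
  let P : ℕ → Prop := fun r => ∃ (u : Fin r → ρ) (v : Fin r → ν), (M.submatrix u v).det ≠ 0
  have hinj : ∀ {r : ℕ} {u : Fin r → ρ} {v : Fin r → ν}, (M.submatrix u v).det ≠ 0 →
      Function.Injective u := by
    intro r u v h i j hij
    by_contra hne
    exact h (Matrix.det_zero_of_row_eq hne (by ext l; simp [hij]))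
  have hinj' : ∀ {r : ℕ} {u : Fin r → ρ} {v : Fin r → ν}, (M.submatrix u v).det ≠ 0 →
      Function.Injective v := by
    intro r u v h i j hij
    by_contra hne
    exact h (Matrix.det_zero_of_column_eq hne (by intro l; simp [hij]))
  have hb : ∀ r, P r → r ≤ Fintype.card ρ := by
    rintro r ⟨u, v, h⟩
    simpa using Fintype.card_le_of_injective u (hinj h)
  have h0 : P 0 := ⟨Fin.elim0, Fin.elim0, by simp⟩
  let r := Nat.findGreatest P (Fintype.card ρ)
  obtain ⟨u, v, h⟩ : P r := Nat.findGreatest_spec (Nat.zero_le _) h0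
  have hmax : ¬ P (r + 1) := fun hP =>
    absurd (Nat.le_findGreatest (hb _ hP) hP) (by simp [r])
  let f : Fin r ⊕ {i // i ∉ Set.range u} ≃ ρ :=
    ((Equiv.ofInjective u (hinj h)).sumCongr (Equiv.refl _)).trans
      (Equiv.Set.sumCompl (Set.range u))
  let g : Fin r ⊕ {i // i ∉ Set.range v} ≃ ν :=
    ((Equiv.ofInjective v (hinj' h)).sumCongr (Equiv.refl _)).trans
      (Equiv.Set.sumCompl (Set.range v))
  have hA : (M.submatrix f g).toBlocks₁₁ = M.submatrix u v := by
    ext i j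
    rfl
  refine ⟨r, _, _, inferInstance, inferInstance, f, g, ?_, ?_, ?_⟩
  · have h1 := Matrix.rank_submatrix_le M u v
    rwa [Matrix.rank_of_det_ne_zero h, Fintype.card_fin] at h1
  · rwa [hA]
  · have hA' : (M.submatrix f g).toBlocks₁₁.det ≠ 0 := by rwa [hA]
    have hmax' : ∀ (u' : Fin r ⊕ Fin 1 → ρ) (v' : Fin r ⊕ Fin 1 → ν), (M.submatrix u' v').det = 0 := by
      intro u' v'
      by_contra hne
      refine hmax ⟨u' ∘ finSumFinEquiv.symm, v' ∘ finSumFinEquiv.symm, ?_⟩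
      rwa [← Matrix.submatrix_submatrix, Matrix.det_submatrix_equiv_self]
    have hmax'' : ∀ i j, ((M.submatrix f g).submatrix (Sum.map id fun _ : Fin 1 => i)
        (Sum.map id fun _ : Fin 1 => j)).det = 0 := fun i j => hmax' _ _
    generalize M.submatrix f g = N at hA' hmax''
    ext i j
    have hB := hmax'' i j
    have _ : Invertible N.toBlocks₁₁.det := invertibleOfNonzero hA'
    have _ : Invertible N.toBlocks₁₁ := Matrix.invertibleOfDetInvertible _
    rw [← Matrix.fromBlocks_toBlocks (N.submatrix _ _)] at hB
    have h1 : (N.submatrix (Sum.map id fun _ : Fin 1 => i)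
        (Sum.map id fun _ : Fin 1 => j)).toBlocks₁₁ = N.toBlocks₁₁ := rfl
    rw [h1, Matrix.det_fromBlocks₁₁, mul_eq_zero, or_iff_right hA', Matrix.det_fin_one,
      Matrix.sub_apply, Matrix.invOf_eq, Matrix.mul_smul, Matrix.smul_mul, Matrix.smul_apply,
      sub_eq_zero] at hB
    have hB' : N.toBlocks₂₂ i j = ⅟N.toBlocks₁₁.det • (N.toBlocks₂₁ * N.toBlocks₁₁.adjugate *
          N.toBlocks₁₂) i j := hB
    rw [Matrix.smul_apply, hB', smul_smul, mul_invOf_self, one_smul]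

variable {R S α ι κ : Type} [CommRing R] [CommRing S] [Fintype α] [DecidableEq α] [Fintype ι]
  [DecidableEq ι] [Fintype κ] [DecidableEq κ]

/-- A multiple of the row operation that clears the lower left block of a block matrix. -/
noncomputable def killLeft (M : Matrix (α ⊕ ι) (α ⊕ κ) R) : Matrix ι (α ⊕ ι) R :=
  Matrix.fromCols (-(M.toBlocks₂₁ * M.toBlocks₁₁.adjugate)) (M.toBlocks₁₁.det • 1)

/-- A multiple of the column operation that clears the upper right block of a block matrix. -/
noncomputable def killRight (M : Matrix (α ⊕ ι) (α ⊕ κ) R) : Matrix (α ⊕ κ) κ R :=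
  Matrix.fromRows (-(M.toBlocks₁₁.adjugate * M.toBlocks₁₂)) (M.toBlocks₁₁.det • 1)

/-- A multiple of the Schur complement of the upper left block of a block matrix. -/
noncomputable def schurMultiple (M : Matrix (α ⊕ ι) (α ⊕ κ) R) : Matrix ι κ R :=
  M.toBlocks₁₁.det • M.toBlocks₂₂ - M.toBlocks₂₁ * M.toBlocks₁₁.adjugate * M.toBlocks₁₂

theorem killLeft_mul (M : Matrix (α ⊕ ι) (α ⊕ κ) R) :
    killLeft M * M = Matrix.fromCols 0 (schurMultiple M) := by
  conv_lhs => rw [← Matrix.fromBlocks_toBlocks M]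
  rw [killLeft, schurMultiple, Matrix.fromBlocks_toBlocks, ← Matrix.fromBlocks_toBlocks M]
  simp only [Matrix.toBlocks_fromBlocks₁₁, Matrix.toBlocks_fromBlocks₁₂,
    Matrix.toBlocks_fromBlocks₂₁, Matrix.toBlocks_fromBlocks₂₂]
  rw [Matrix.fromCols_mul_fromBlocks]
  congr 1
  · rw [Matrix.neg_mul, Matrix.mul_assoc, Matrix.adjugate_mul]
    simp
  · simp only [Matrix.neg_mul, Matrix.smul_mul, Matrix.one_mul]
    abel

theorem mul_killRight (M : Matrix (α ⊕ ι) (α ⊕ κ) R) :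
    M * killRight M = Matrix.fromRows 0 (schurMultiple M) := by
  conv_lhs => rw [← Matrix.fromBlocks_toBlocks M]
  rw [killRight, schurMultiple, Matrix.fromBlocks_toBlocks, ← Matrix.fromBlocks_toBlocks M]
  simp only [Matrix.toBlocks_fromBlocks₁₁, Matrix.toBlocks_fromBlocks₁₂,
    Matrix.toBlocks_fromBlocks₂₁, Matrix.toBlocks_fromBlocks₂₂]
  rw [Matrix.fromBlocks_mul_fromRows]
  congr 1
  · rw [Matrix.mul_neg, ← Matrix.mul_assoc, Matrix.mul_adjugate]
    simp
  · simp only [Matrix.mul_neg, Matrix.mul_smul, Matrix.mul_one, Matrix.mul_assoc]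
    abel

theorem killLeft_mul_mul_killRight (M : Matrix (α ⊕ ι) (α ⊕ κ) R) :
    killLeft M * M * killRight M = M.toBlocks₁₁.det • schurMultiple M := by
  rw [killLeft_mul, killRight, Matrix.fromCols_mul_fromRows]
  simp

theorem toBlocks₁₁_map_det (f : R →+* S) (M : Matrix (α ⊕ ι) (α ⊕ κ) R) :
    (M.map f).toBlocks₁₁.det = f M.toBlocks₁₁.det :=
  (f.map_det _).symm

theorem killLeft_map (f : R →+* S) (M : Matrix (α ⊕ ι) (α ⊕ κ) R) :
    killLeft (M.map f) = (killLeft M).map f := by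
  have h : (M.map f).toBlocks₁₁.adjugate = M.toBlocks₁₁.adjugate.map f :=
    (f.map_adjugate M.toBlocks₁₁).symm
  have h' : (M.map f).toBlocks₂₁ = M.toBlocks₂₁.map f := rfl
  ext i (j | j)
  · simp [killLeft, h, h', Matrix.mul_apply]
  · simp [killLeft, toBlocks₁₁_map_det, Matrix.one_apply, apply_ite f]

theorem killRight_map (f : R →+* S) (M : Matrix (α ⊕ ι) (α ⊕ κ) R) :
    killRight (M.map f) = (killRight M).map f := by
  have h : (M.map f).toBlocks₁₁.adjugate = M.toBlocks₁₁.adjugate.map f :=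
    (f.map_adjugate M.toBlocks₁₁).symm
  have h' : (M.map f).toBlocks₁₂ = M.toBlocks₁₂.map f := rfl
  ext (i | i) j
  · simp [killRight, h, h', Matrix.mul_apply]
  · simp [killRight, toBlocks₁₁_map_det, Matrix.one_apply, apply_ite f]

theorem maxMinors_smul_of_isUnit (M : Matrix ι κ R) {u : R} (hu : IsUnit u) :
    maxMinors (u • M) = maxMinors M := by
  obtain ⟨u, rfl⟩ := hu
  have h : (u : R) • M = ((u : R) • (1 : Matrix ι ι R)) * M * (1 : Matrix κ κ R) := by simp
  rw [h, maxMinors_mul_mul (G' := ((u⁻¹ : Rˣ) : R) • (1 : Matrix ι ι R)) (H' := 1)]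
  · simp [smul_smul]
  · simp

/-- The maximal minors of a matrix with an invertible block generate the same ideal as those of
(a multiple of) its Schur complement. -/
theorem maxMinors_killLeft_mul_mul_killRight (hc : IsUnit ((Fintype.card ι).factorial : R))
    (M : Matrix (α ⊕ ι) (α ⊕ κ) R) (hu : IsUnit M.toBlocks₁₁.det) :
    maxMinors (killLeft M * M * killRight M) = maxMinors M := by
  have _ : Invertible M.toBlocks₁₁.det := hu.invertible
  have _ : Invertible M.toBlocks₁₁ := Matrix.invertibleOfDetInvertible _
  conv_rhs => rw [← Matrix.fromBlocks_toBlocks M]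
  rw [killLeft_mul_mul_killRight, maxMinors_smul_of_isUnit _ hu, maxMinors_fromBlocks hc,
    ← maxMinors_smul_of_isUnit (M.toBlocks₂₂ - _) hu, Matrix.invOf_eq, schurMultiple, smul_sub,
    Matrix.mul_smul, Matrix.smul_mul, smul_smul, mul_invOf_self, one_smul]

end Pivot

section PolarLocal

open Matrix

variable {π μ ν : Type} [Fintype π] [Fintype μ] [Fintype ν] [DecidableEq π] [DecidableEq μ]
  [DecidableEq ν]

/-- Polynomials vanishing at `x` with independent differentials extend to local coordinates. -/
theorem exists_coordinates_extending {σ₀ : Type} [Finite σ₀]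
    (φ₀ : σ₀ → MvPolynomial ν ℂ) (x : ν → ℂ) (h0 : ∀ v, eval x (φ₀ v) = 0)
    (hli : LinearIndependent ℂ fun (v : σ₀) (q : ν) => eval x (pderiv q (φ₀ v))) :
    ∃ (ω : Type) (_ : Fintype (σ₀ ⊕ ω)) (_ : DecidableEq (σ₀ ⊕ ω)) (ε : σ₀ ⊕ ω ≃ ν)
      (φ : σ₀ ⊕ ω → MvPolynomial ν ℂ),
      (∀ v, φ (.inl v) = φ₀ v) ∧ (∀ v, eval x (φ v) = 0) ∧
      (Matrix.of fun v w => eval x (pderiv (ε w) (φ v))).det ≠ 0 := by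
  classical
  let b := Module.Basis.sumExtend hli
  have _ : Finite (σ₀ ⊕ Module.Basis.sumExtendIndex hli) := Module.Finite.finite_basis b
  let _ := Fintype.ofFinite (σ₀ ⊕ Module.Basis.sumExtendIndex hli)
  let ε := b.indexEquiv (Pi.basisFun ℂ ν)
  let ψ : Module.Basis.sumExtendIndex hli → MvPolynomial ν ℂ :=
    fun w => ∑ l, C (b (.inr w) l) * (X l - C (x l))
  have hb : ∀ v q, eval x (pderiv q (Sum.elim φ₀ ψ v)) = b v q := by
    rintro (v | w) q
    · have : b (.inl v) = fun q => eval x (pderiv q (φ₀ v)) := by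
        simp [b, Module.Basis.sumExtend]
        rfl
      rw [this]
      rfl
    · simp [ψ, pderiv_X, Pi.single_apply]
  refine ⟨_, inferInstance, inferInstance, ε, Sum.elim φ₀ ψ, fun v => rfl, ?_, ?_⟩
  · rintro (v | w)
    · exact h0 v
    · simp [ψ]
  · rw [← isUnit_iff_ne_zero, ← Matrix.isUnit_iff_isUnit_det,
      ← Matrix.linearIndependent_rows_iff_isUnit]
    have h := b.linearIndependent.map' (LinearEquiv.funCongrLeft ℂ ℂ ε).toLinearMap
      (LinearEquiv.ker _)
    have h' : (Matrix.of fun v w => eval x (pderiv (ε w) (Sum.elim φ₀ ψ v))).row =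
        ⇑(LinearEquiv.funCongrLeft ℂ ℂ ε).toLinearMap ∘ ⇑b := by
      ext v w
      exact hb v (ε w)
    rw [h']
    exact h

theorem polarMat_generic_map (F : π → MvPolynomial ν ℂ) (c : ℂ) (a : Matrix μ ν ℂ) (x : ν → ℂ) :
    (polarMat F c (a.map C) X).map (aeval x : MvPolynomial ν ℂ →ₐ[ℂ] ℂ) = polarMat F c a x := by
  rw [← PolarPoint.polarMat_map]
  congr 1
  · ext i j; simp
  · ext l; simp

theorem polarMat_generic_map_pderiv (F : π → MvPolynomial ν ℂ) (c : ℂ) (a : Matrix μ ν ℂ)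
    (x : ν → ℂ) (q : ν) :
    ((polarMat F c (a.map C) X).map (pderiv q)).map (aeval x : MvPolynomial ν ℂ →ₐ[ℂ] ℂ) =
      polarMatDeriv μ F c x q := by
  have h : (a.map C).map (pderiv q : Derivation ℂ (MvPolynomial ν ℂ) _) = 0 := by
    ext; simp
  rw [polarMat_map_derivation, h, Finset.sum_eq_single q]
  · rw [pderiv_X_self, one_smul, Matrix.fromRows_zero, add_zero, ← PolarPoint.polarMatDeriv_map]
    congr 1
    ext l; simp
  · intro l _ hl
    rw [pderiv_X_of_ne hl, zero_smul]
  · simp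

theorem linearIndependent_differentials {ι κ : Type} [Fintype ι] [Fintype κ] [DecidableEq ι]
    [DecidableEq κ] {F : π → MvPolynomial ν ℂ} {c : ℂ} {a : Matrix μ ν ℂ} {x : ν → ℂ}
    (hgood : ∀ z : PolarPoint π μ ν ℂ, z.a = a → ∃ i, PolarPoint.rel F c z i ≠ 0)
    (hF : ∀ k, aeval x (F k) = 0) {Q : Matrix ν π ℂ}
    (hQ : (Matrix.of fun k l => aeval x (pderiv l (F k))) * Q = 1)
    (K : Matrix ι (π ⊕ μ) (MvPolynomial ν ℂ)) (V : Matrix ν κ (MvPolynomial ν ℂ))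
    (hK : K.map (aeval x : _ →ₐ[ℂ] ℂ) * polarMat F c a x = 0)
    (hV : polarMat F c a x * V.map (aeval x : _ →ₐ[ℂ] ℂ) = 0)
    (hw : ∀ w : Matrix κ ι ℂ,
      V.map (aeval x : _ →ₐ[ℂ] ℂ) * w * K.map (aeval x : _ →ₐ[ℂ] ℂ) = 0 → w = 0)
    {E : Matrix (π ⊕ μ) ι ℂ} {E' : Matrix ι (π ⊕ μ) ℂ} (hE : E' * E = 1) :
    LinearIndependent ℂ fun (v : π ⊕ (ι × κ)) (q : ν) => eval x (pderiv q
      (Sum.elim F (fun y => (K * polarMat F c (a.map C) X * V) y.1 y.2) v)) := by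
  set Kx := K.map (aeval x : _ →ₐ[ℂ] ℂ) with hKx
  set Vx := V.map (aeval x : _ →ₐ[ℂ] ℂ) with hVx
  have hmap : ∀ {α β γ : Type} [Fintype β] (M : Matrix α β (MvPolynomial ν ℂ))
      (N : Matrix β γ (MvPolynomial ν ℂ)), (M * N).map (aeval x : _ →ₐ[ℂ] ℂ) =
        M.map (aeval x : _ →ₐ[ℂ] ℂ) * N.map (aeval x : _ →ₐ[ℂ] ℂ) :=
    fun M N => Matrix.map_mul (f := (aeval x : _ →ₐ[ℂ] ℂ).toRingHom)
  have hadd : ∀ {α β : Type} (M N : Matrix α β (MvPolynomial ν ℂ)),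
      (M + N).map (aeval x : _ →ₐ[ℂ] ℂ) =
        M.map (aeval x : _ →ₐ[ℂ] ℂ) + N.map (aeval x : _ →ₐ[ℂ] ℂ) :=
    fun M N => Matrix.map_add _ (map_add _) M N
  have hN : ∀ q, ((K * polarMat F c (a.map C) X * V).map (pderiv q)).map
      (aeval x : _ →ₐ[ℂ] ℂ) = Kx * polarMatDeriv μ F c x q * Vx := by
    intro q
    rw [Derivation.map_matrix_mul, Derivation.map_matrix_mul, Matrix.add_mul, hadd, hadd]
    simp only [hmap, polarMat_generic_map, polarMat_generic_map_pderiv]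
    rw [← hKx, ← hVx, hK, Matrix.mul_assoc, hV, Matrix.mul_zero, Matrix.zero_mul, zero_add,
      add_zero]
  have hN' : ∀ q i j, eval x (pderiv q ((K * polarMat F c (a.map C) X * V) i j)) =
      (Kx * polarMatDeriv μ F c x q * Vx) i j := by
    intro q i j
    rw [← hN, Matrix.map_apply, Matrix.map_apply, aeval_eq_eval]
  rw [Fintype.linearIndependent_iff]
  intro t ht
  let w : Matrix κ ι ℂ := Matrix.of fun j i => t (.inr (i, j))
  have hq : ∀ q, (Vx * w * Kx * polarMatDeriv μ F c x q).trace =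
      ∑ k, -t (.inl k) * aeval x (pderiv q (F k)) := by
    intro q
    have h1 := congrFun ht q
    simp only [Finset.sum_apply, Pi.smul_apply, smul_eq_mul, Pi.zero_apply,
      Fintype.sum_sum_type, Sum.elim_inl, Sum.elim_inr, hN', Fintype.sum_prod_type] at h1
    have h2 : (Vx * w * Kx * polarMatDeriv μ F c x q).trace =
        ∑ i, ∑ j, t (.inr (i, j)) * (Kx * polarMatDeriv μ F c x q * Vx) i j := by
      rw [Matrix.mul_assoc Vx w, Matrix.mul_assoc Vx, Matrix.trace_mul_comm, Matrix.mul_assoc w,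
        Matrix.mul_assoc w, Matrix.trace, Finset.sum_comm]
      rfl
    rw [h2, eq_neg_of_add_eq_zero_right h1, ← Finset.sum_neg_distrib]
    exact Finset.sum_congr rfl fun k _ => by rw [neg_mul, aeval_eq_eval]
  have hΘ : Vx * w * Kx = 0 := by
    by_contra hne
    obtain ⟨l₀, i₀, hli⟩ : ∃ l i, (Vx * w * Kx) l i ≠ 0 := by
      by_contra! h
      exact hne (by ext l i; exact h l i)
    let z : PolarPoint π μ ν ℂ :=
      { a := a, x := x, Q := Q, K := E * Kx, V := Vx * w * E', τ := fun k => -t (.inl k)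
        Y := Matrix.single i₀ l₀ ((Vx * w * Kx) l₀ i₀)⁻¹ }
    have hVK : Vx * w * E' * (E * Kx) = Vx * w * Kx := by
      rw [Matrix.mul_assoc _ E', ← Matrix.mul_assoc E', hE, Matrix.one_mul]
    obtain ⟨i, hi⟩ := hgood z rfl
    refine hi ?_
    rcases i with k | ⟨k, k'⟩ | ⟨i, l⟩ | ⟨i, j⟩ | q | _
    · exact hF k
    · have := congrFun (congrFun hQ k) k'
      exact sub_eq_zero.2 this
    · change (E * Kx * polarMat F c a x) i l = 0
      rw [Matrix.mul_assoc, hK, Matrix.mul_zero, Matrix.zero_apply]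
    · change (polarMat F c a x * (Vx * w * E')) i j = 0
      rw [← Matrix.mul_assoc, ← Matrix.mul_assoc, hV, Matrix.zero_mul, Matrix.zero_mul,
        Matrix.zero_apply]
    · change (Vx * w * E' * (E * Kx) * polarMatDeriv μ F c x q).trace - _ = 0
      rw [hVK, hq, sub_eq_zero]
    · change (Vx * w * E' * (E * Kx) *
        (Matrix.single i₀ l₀ ((Vx * w * Kx) l₀ i₀)⁻¹ : Matrix (π ⊕ μ) ν ℂ)).trace - 1 = 0
      rw [hVK, Matrix.trace_mul_comm, Matrix.trace_single_mul, smul_eq_mul]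
      rw [inv_mul_cancel₀ hli, sub_self]
  have hw0 : w = 0 := hw w hΘ
  have ht0 : ∀ k, t (.inl k) = 0 := by
    have h1 : ∀ q, ∑ k, t (.inl k) * aeval x (pderiv q (F k)) = 0 := by
      intro q
      have := hq q
      rw [hΘ, Matrix.zero_mul, Matrix.trace_zero] at this
      simpa [neg_mul, Finset.sum_neg_distrib] using this
    have h2 : Matrix.vecMul (fun k => t (.inl k))
        (Matrix.of fun k l => aeval x (pderiv l (F k))) = 0 := by
      ext q; exact h1 q
    have h3 := congrArg (fun u => Matrix.vecMul u Q) h2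
    simp only [Matrix.vecMul_vecMul, hQ, Matrix.vecMul_one, Matrix.zero_vecMul] at h3
    exact fun k => congrFun h3 k
  rintro (k | ⟨i, j⟩)
  · exact ht0 k
  · exact congrFun (congrFun hw0 j) i

end PolarLocal

section PolarLocal

open Matrix

variable {π μ ν : Type} [Fintype π] [Fintype μ] [Fintype ν] [DecidableEq π] [DecidableEq μ]
  [DecidableEq ν]

theorem isNormalCM_quotient_map_polar {A : Type} [CommRing A] [Algebra (MvPolynomial ν ℂ) A]
    {x : ν → ℂ} [IsLocalization.AtPrime A (vanishingIdeal ℂ {x})]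
    {F : π → MvPolynomial ν ℂ} {c : ℂ} {a : Matrix μ ν ℂ}
    (hgood : ∀ z : PolarPoint π μ ν ℂ, z.a = a → ∃ i, PolarPoint.rel F c z i ≠ 0)
    (hF : ∀ k, aeval x (F k) = 0) {Q : Matrix ν π ℂ}
    (hQ : (Matrix.of fun k l => aeval x (pderiv l (F k))) * Q = 1)
    (hrank : (polarMat F c a x).rank < Fintype.card π + Fintype.card μ)
    (hcard : Fintype.card π + Fintype.card μ ≤ Fintype.card ν) {ℓ : ℕ}
    (hℓ : ℓ + 1 = Fintype.card μ) :
    IsNormalCM (A ⧸ (Ideal.span (Set.range F) ⊔ maxMinors (polarMat F c (a.map C) X)).map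
      (algebraMap (MvPolynomial ν ℂ) A)) ℓ := by
  classical
  set M := polarMat F c (a.map C) X with hM
  obtain ⟨r, ι, κ, _, _, f, g, hr, hdet, hschur⟩ := (polarMat F c a x).exists_pivot_block
  let ev : MvPolynomial ν ℂ →+* ℂ := (aeval x : MvPolynomial ν ℂ →ₐ[ℂ] ℂ).toRingHom
  set M' : Matrix (Fin r ⊕ ι) (Fin r ⊕ κ) (MvPolynomial ν ℂ) := M.submatrix f g with hM'
  have hMx : M'.map ev = (polarMat F c a x).submatrix f g := by
    rw [← polarMat_generic_map]; rfl
  have hsx : schurMultiple (M'.map ev) = 0 := by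
    rw [hMx, schurMultiple, hschur, sub_self]
  let K : Matrix ι (π ⊕ μ) (MvPolynomial ν ℂ) := (killLeft M').submatrix id f.symm
  let V : Matrix ν κ (MvPolynomial ν ℂ) := (killRight M').submatrix g.symm id
  let E : Matrix (π ⊕ μ) ι ℂ := (Matrix.fromRows 0 1 : Matrix (Fin r ⊕ ι) ι ℂ).submatrix f.symm id
  let E' : Matrix ι (π ⊕ μ) ℂ :=
    (Matrix.fromCols 0 1 : Matrix ι (Fin r ⊕ ι) ℂ).submatrix id f.symm
  have hE : E' * E = 1 := by
    simp only [E, E']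
    rw [Matrix.submatrix_mul_equiv, Matrix.fromCols_mul_fromRows]
    simp
  have hMback : polarMat F c a x = (M'.map ev).submatrix f.symm g.symm := by
    rw [hMx]; ext i j; simp
  have hKmap : K.map (aeval x : MvPolynomial ν ℂ →ₐ[ℂ] ℂ) =
      (killLeft (M'.map ev)).submatrix id f.symm := by
    rw [killLeft_map]; rfl
  have hVmap : V.map (aeval x : MvPolynomial ν ℂ →ₐ[ℂ] ℂ) =
      (killRight (M'.map ev)).submatrix g.symm id := by
    rw [killRight_map]; rfl
  have hK0 : K.map (aeval x : MvPolynomial ν ℂ →ₐ[ℂ] ℂ) * polarMat F c a x = 0 := by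
    rw [hKmap, hMback, Matrix.submatrix_mul_equiv, killLeft_mul, hsx]
    ext i j; simp
  have hV0 : polarMat F c a x * V.map (aeval x : MvPolynomial ν ℂ →ₐ[ℂ] ℂ) = 0 := by
    rw [hVmap, hMback, Matrix.submatrix_mul_equiv, mul_killRight, hsx]
    ext i j; simp
  have hdet' : (M'.map ev).toBlocks₁₁.det ≠ 0 := by rwa [hMx]
  have hw : ∀ w : Matrix κ ι ℂ, V.map (aeval x : MvPolynomial ν ℂ →ₐ[ℂ] ℂ) * w *
      K.map (aeval x : MvPolynomial ν ℂ →ₐ[ℂ] ℂ) = 0 → w = 0 := by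
    intro w hw
    ext j i
    have h1 := congrFun (congrFun hw (g (.inr j))) (f (.inr i))
    rw [hVmap, hKmap] at h1
    simpa [Matrix.mul_apply, killLeft, killRight, Matrix.one_apply, hdet'] using h1
  have hli := linearIndependent_differentials hgood hF hQ K V hK0 hV0 hw hE
  set N : Matrix ι κ (MvPolynomial ν ℂ) := K * polarMat F c (a.map C) X * V with hN
  have hN' : N = killLeft M' * M' * killRight M' := by
    have h1 : polarMat F c (a.map C) X = M'.submatrix f.symm g.symm := by
      ext i j; simp [hM', hM]
    rw [hN, h1, Matrix.submatrix_mul_equiv, Matrix.submatrix_mul_equiv]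
    rfl
  have hφ₀ : ∀ v, eval x (Sum.elim F (fun y : ι × κ => N y.1 y.2) v) = 0 := by
    rintro (k | ⟨i, j⟩)
    · rw [Sum.elim_inl, ← aeval_eq_eval]; exact hF k
    · have h1 : N.map ev = 0 := by
        have h2 : N.map ev = killLeft (M'.map ev) * M'.map ev * killRight (M'.map ev) := by
          rw [hN', killLeft_map, killRight_map, Matrix.map_mul, Matrix.map_mul]
        rw [h2, killLeft_mul_mul_killRight, hsx, smul_zero]
      have h2 := congrFun (congrFun h1 i) j
      rw [Sum.elim_inr, ← aeval_eq_eval]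
      exact h2
  obtain ⟨ω, _, _, ε, φ, hφ, hφx, hφdet⟩ := exists_coordinates_extending _ x hφ₀ hli
  let e : ι → κ → (π ⊕ (ι × κ)) ⊕ ω := fun i j => .inl (.inr (i, j))
  let Z : Set ((π ⊕ (ι × κ)) ⊕ ω) := Set.range fun k : π => .inl (.inl k)
  have hcρ : r + Fintype.card ι = Fintype.card π + Fintype.card μ := by
    simpa using Fintype.card_congr f
  have hcν : r + Fintype.card κ = Fintype.card ν := by
    simpa using Fintype.card_congr g
  have hZc : Z.ncard = Fintype.card π := by
    rw [← Nat.card_coe_set_eq, Nat.card_range_of_injective, Nat.card_eq_fintype_card]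
    intro k k' h
    simpa using h
  have key := isNormalCM_quotient_map_genIdeal ε φ x hφx hφdet (Z := Z) (e := e) (ℓ := ℓ)
    (fun _ _ h => by simpa [e, Prod.ext_iff] using h) (fun i j => by simp [e, Z])
    (by omega) (by omega)
    (by rw [hZc, Nat.card_congr ε, Nat.card_eq_fintype_card]; omega) A
  have hgen : (genIdeal Z e).map (aeval φ : MvPolynomial ((π ⊕ (ι × κ)) ⊕ ω) ℂ →ₐ[ℂ] _) =
      Ideal.span (Set.range F) ⊔ maxMinors N := by
    have h1 : maxMinors ((genMat e).map
        (aeval φ : MvPolynomial ((π ⊕ (ι × κ)) ⊕ ω) ℂ →ₐ[ℂ] MvPolynomial ν ℂ).toRingHom) =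
        (maxMinors (genMat e)).map
          (aeval φ : MvPolynomial ((π ⊕ (ι × κ)) ⊕ ω) ℂ →ₐ[ℂ] MvPolynomial ν ℂ) :=
      maxMinors_map _ _
    have h2 : (genMat e).map
        (aeval φ : MvPolynomial ((π ⊕ (ι × κ)) ⊕ ω) ℂ →ₐ[ℂ] MvPolynomial ν ℂ).toRingHom = N := by
      ext1 i j
      change aeval φ (X (e i j)) = N i j
      rw [aeval_X, hφ]
      rfl
    have h3 : (aeval φ : MvPolynomial ((π ⊕ (ι × κ)) ⊕ ω) ℂ →ₐ[ℂ] MvPolynomial ν ℂ) ''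
        (X '' Z) = Set.range F := by
      rw [← Set.range_comp, ← Set.range_comp]
      congr 1
      ext1 k
      change aeval φ (X (.inl (.inl k))) = F k
      rw [aeval_X, hφ]
      rfl
    rw [genIdeal, Ideal.map_sup, ← h1, h2, Ideal.map_span, h3]
  have hmax : (maxMinors M).map (algebraMap (MvPolynomial ν ℂ) A) =
      (maxMinors N).map (algebraMap (MvPolynomial ν ℂ) A) := by
    have h1 : N.map (algebraMap (MvPolynomial ν ℂ) A) =
        killLeft (M'.map (algebraMap (MvPolynomial ν ℂ) A)) *
          M'.map (algebraMap (MvPolynomial ν ℂ) A) *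
          killRight (M'.map (algebraMap (MvPolynomial ν ℂ) A)) := by
      rw [hN', killLeft_map, killRight_map, Matrix.map_mul, Matrix.map_mul]
    have hc : IsUnit ((Fintype.card ι).factorial : A) := by
      simpa using (isUnit_natCast_factorial (MvPolynomial ν ℂ) (Fintype.card ι)).map
        (algebraMap (MvPolynomial ν ℂ) A)
    rw [← maxMinors_map, ← maxMinors_map, h1, maxMinors_killLeft_mul_mul_killRight hc,
      ← maxMinors_submatrix_equiv _ f g]
    · rfl
    · rw [toBlocks₁₁_map_det, IsLocalization.AtPrime.isUnit_to_map_iff A (vanishingIdeal ℂ {x})]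
      intro hmem
      rw [toBlocks₁₁_map_det] at hdet'
      exact hdet' (mem_vanishingIdeal_singleton.1 hmem)
  have hI : (Ideal.span (Set.range F) ⊔ maxMinors M).map (algebraMap (MvPolynomial ν ℂ) A) =
      ((genIdeal Z e).map (aeval φ : MvPolynomial ((π ⊕ (ι × κ)) ⊕ ω) ℂ →ₐ[ℂ] _)).map
        (algebraMap (MvPolynomial ν ℂ) A) := by
    rw [hgen, Ideal.map_sup, Ideal.map_sup, hmax]
  rw [hI]
  exact key

end PolarLocal

section Dimension

theorem ringKrullDim_le_of_isIntegral {R S : Type*} [CommRing R] [CommRing S] [Algebra R S]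
    [Algebra.IsIntegral R S] : ringKrullDim S ≤ ringKrullDim R := by
  refine Order.krullDim_le_of_strictMono (PrimeSpectrum.comap (algebraMap R S)) fun P Q h => ?_
  obtain ⟨hle, x, hxQ, hxP⟩ := SetLike.lt_iff_le_and_exists.1 (PrimeSpectrum.asIdeal_lt_asIdeal P Q |>.2 h)
  exact Ideal.comap_lt_comap_of_integral_mem_sdiff hle ⟨hxQ, hxP⟩ (Algebra.IsIntegral.isIntegral x)

theorem natCast_le_height_of_isMaximal {d : ℕ} (m : Ideal (MvPolynomial (Fin d) ℂ))
    [hm : m.IsMaximal] : (d : ℕ∞) ≤ m.height := by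
  obtain ⟨x, rfl⟩ := isMaximal_iff_eq_vanishingIdeal_singleton.1 hm
  let τ : MvPolynomial (Fin d) ℂ ≃ₐ[ℂ] MvPolynomial (Fin d) ℂ :=
    AlgEquiv.ofAlgHom (aeval fun i => X i - C (x i)) (aeval fun i => X i + C (x i))
      (by ext i; simp [← algebraMap_eq]) (by ext i; simp [← algebraMap_eq])
  have hτ : ∀ i, τ (X i) = X i - C (x i) := fun i => aeval_X _ _
  calc (d : ℕ∞) ≤ (Ideal.span (X '' Set.univ) : Ideal (MvPolynomial (Fin d) ℂ)).height :=
        natCast_le_height_span_X d _ (by simp [Set.ncard_univ])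
    _ = ((Ideal.span (X '' Set.univ)).map τ.toRingEquiv).height :=
        (RingEquiv.height_map τ.toRingEquiv _).symm
    _ ≤ _ := by
        refine Ideal.height_mono ?_
        rw [Ideal.map_span, Ideal.span_le]
        rintro _ ⟨_, ⟨i, -, rfl⟩, rfl⟩
        change τ (X i) ∈ _
        rw [hτ, SetLike.mem_coe, mem_vanishingIdeal_singleton]
        simp

theorem ringKrullDim_eq_height_of_isMaximal {D : Type*} [CommRing D] [IsDomain D] [Algebra ℂ D]
    [Algebra.FiniteType ℂ D] (m : Ideal D) [hm : m.IsMaximal] :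
    ringKrullDim D = (m.height : WithBot ℕ∞) := by
  refine le_antisymm ?_ Ideal.height_le_ringKrullDim_of_isPrime
  obtain ⟨s, g, hg, hgi⟩ := exists_integral_inj_algHom_of_fg ℂ D
  let _ : Algebra (MvPolynomial (Fin s) ℂ) D := g.toRingHom.toAlgebra
  have _ : Algebra.IsIntegral (MvPolynomial (Fin s) ℂ) D := ⟨hgi⟩
  have _ : FaithfulSMul (MvPolynomial (Fin s) ℂ) D :=
    (faithfulSMul_iff_algebraMap_injective _ _).2 hg
  have _ : IsNoetherianRing D := Algebra.FiniteType.isNoetherianRing ℂ D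
  have _ : (m.under (MvPolynomial (Fin s) ℂ)).IsMaximal := Ideal.isMaximal_comap_of_isIntegral_of_isMaximal m
  have h1 := Ideal.height_eq_height_add_of_liesOver_of_hasGoingDown
    (m.under (MvPolynomial (Fin s) ℂ)) m
  have h2 : (s : ℕ∞) ≤ m.height :=
    (natCast_le_height_of_isMaximal (m.under (MvPolynomial (Fin s) ℂ))).trans (h1 ▸ le_self_add)
  calc ringKrullDim D ≤ ringKrullDim (MvPolynomial (Fin s) ℂ) := ringKrullDim_le_of_isIntegral
    _ = s := by simp [MvPolynomial.ringKrullDim_of_isNoetherianRing]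
    _ ≤ _ := by exact_mod_cast h2

end Dimension

section PolarLocus

open Matrix

variable {π μ ν : Type} [Fintype π] [Fintype μ] [Fintype ν] [DecidableEq π] [DecidableEq μ]
  [DecidableEq ν]

theorem Matrix.exists_mul_eq_one_of_rank_eq {K : Type*} [Field K] {M : Matrix π ν K}
    (h : M.rank = Fintype.card π) : ∃ Q : Matrix ν π K, M * Q = 1 := by
  rw [← Matrix.mulVec_surjective_iff_exists_right_inverse]
  have h1 : LinearMap.range M.mulVecLin = ⊤ := by
    refine Submodule.eq_top_of_finrank_eq ?_
    rw [Module.finrank_fintype_fun_eq_card]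
    exact h
  exact LinearMap.range_eq_top.1 h1

theorem maxMinors_eq_bot_iff_rank_lt {K : Type*} [Field K] {M : Matrix π ν K} :
    maxMinors M = ⊥ ↔ M.rank < Fintype.card π := by
  refine ⟨fun h => (Matrix.rank_le_card_height M).lt_of_ne fun h' => ?_, fun h => ?_⟩
  · obtain ⟨Q, hQ⟩ := Matrix.exists_mul_eq_one_of_rank_eq h'
    have h1 := det_mul_mem_maxMinors M Q
    rw [h, hQ, Matrix.det_one, Ideal.mem_bot] at h1
    exact one_ne_zero h1
  · rw [eq_bot_iff, maxMinors, Ideal.span_le]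
    rintro _ ⟨Q, rfl⟩
    by_contra hne
    have h1 := Matrix.rank_of_isUnit (M * Q)
      ((Matrix.isUnit_iff_isUnit_det _).2 (isUnit_iff_ne_zero.2 hne))
    have h2 := Matrix.rank_mul_le_left M Q
    omega

/-- The vanishing ideal of a set which agrees near `x` with the zero locus of `J` coincides with `J`
locally at `x`, provided that `J` is prime there. -/
theorem map_vanishingIdeal_eq_map {J : Ideal (MvPolynomial ν ℂ)} {T : Set (ν → ℂ)}
    (hJ : J ≤ vanishingIdeal ℂ T) {g : MvPolynomial ν ℂ}
    (hg : ∀ y ∈ zeroLocus ℂ J, eval y g ≠ 0 → y ∈ T) {x : ν → ℂ} (hx : eval x g ≠ 0)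
    {A : Type} [CommRing A] [Algebra (MvPolynomial ν ℂ) A]
    [IsLocalization.AtPrime A (vanishingIdeal ℂ {x})]
    (hA : (J.map (algebraMap (MvPolynomial ν ℂ) A)).IsPrime) :
    (vanishingIdeal ℂ T).map (algebraMap (MvPolynomial ν ℂ) A) =
      J.map (algebraMap (MvPolynomial ν ℂ) A) := by
  refine le_antisymm (Ideal.map_le_iff_le_comap.2 fun f hf => ?_) (Ideal.map_mono hJ)
  have h1 : g * f ∈ vanishingIdeal ℂ (zeroLocus ℂ J) := by
    intro y hy
    rw [aeval_eq_eval, map_mul]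
    by_cases h0 : eval y g = 0
    · rw [h0, zero_mul]
    · rw [show eval y f = 0 from hf y (hg y hy h0), mul_zero]
  rw [vanishingIdeal_zeroLocus_eq_radical] at h1
  obtain ⟨k, hk⟩ := h1
  have h2 := Ideal.mem_map_of_mem (algebraMap (MvPolynomial ν ℂ) A) hk
  rw [map_pow] at h2
  have h2 := hA.mem_of_pow_mem k h2
  rw [map_mul] at h2
  have h3 : IsUnit (algebraMap (MvPolynomial ν ℂ) A g) := by
    rw [IsLocalization.AtPrime.isUnit_to_map_iff A (vanishingIdeal ℂ {x})]
    exact fun h => hx (mem_vanishingIdeal_singleton.1 h)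
  exact (hA.mem_or_mem h2).resolve_left fun h => hA.ne_top (Ideal.eq_top_of_isUnit_mem _ h h3)

/-- The regular points of the zero set of `F` where the matrix `polarMat F c a` is degenerate. -/
def polarLocus (F : π → MvPolynomial ν ℂ) (c : ℂ) (a : Matrix μ ν ℂ) : Set (ν → ℂ) :=
  {x | (∀ k, aeval x (F k) = 0) ∧
    (Matrix.of fun k l => aeval x (pderiv l (F k))).rank = Fintype.card π ∧
    (polarMat F c a x).rank < Fintype.card π + Fintype.card μ}

theorem maxMinors_polarMat (F : π → MvPolynomial ν ℂ) (c : ℂ) (a : Matrix μ ν ℂ) (y : ν → ℂ) :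
    maxMinors (polarMat F c a y) = (maxMinors (polarMat F c (a.map C) X)).map
      (aeval y : MvPolynomial ν ℂ →ₐ[ℂ] ℂ).toRingHom := by
  rw [← polarMat_generic_map]
  exact maxMinors_map _ _

theorem mem_polarLocus_iff {F : π → MvPolynomial ν ℂ} {c : ℂ} {a : Matrix μ ν ℂ} {y : ν → ℂ} :
    y ∈ polarLocus F c a ↔
      y ∈ zeroLocus ℂ (Ideal.span (Set.range F) ⊔ maxMinors (polarMat F c (a.map C) X)) ∧
        (Matrix.of fun k l => aeval y (pderiv l (F k))).rank = Fintype.card π := by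
  have h1 : y ∈ zeroLocus ℂ (Ideal.span (Set.range F) ⊔ maxMinors (polarMat F c (a.map C) X)) ↔
      (∀ k, aeval y (F k) = 0) ∧ maxMinors (polarMat F c a y) = ⊥ := by
    have h2 : y ∈ zeroLocus ℂ
          (Ideal.span (Set.range F) ⊔ maxMinors (polarMat F c (a.map C) X)) ↔
        Ideal.span (Set.range F) ⊔ maxMinors (polarMat F c (a.map C) X) ≤
          RingHom.ker (aeval y : MvPolynomial ν ℂ →ₐ[ℂ] ℂ).toRingHom := Iff.rfl
    rw [h2, sup_le_iff, Ideal.span_le, maxMinors_polarMat, eq_bot_iff, Ideal.map_le_iff_le_comap,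
      Set.range_subset_iff]
    exact Iff.rfl
  rw [h1, maxMinors_eq_bot_iff_rank_lt, Fintype.card_sum]
  exact ⟨fun h => ⟨⟨h.1, h.2.2⟩, h.2.1⟩, fun h => ⟨h.1.1, h.2, h.1.2⟩⟩

theorem isNormalCM_quotient_vanishingIdeal_polarLocus {F : π → MvPolynomial ν ℂ} {c : ℂ}
    {a : Matrix μ ν ℂ}
    (hgood : ∀ z : PolarPoint π μ ν ℂ, z.a = a → ∃ i, PolarPoint.rel F c z i ≠ 0)
    (hcard : Fintype.card π + Fintype.card μ ≤ Fintype.card ν) {ℓ : ℕ}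
    (hℓ : ℓ + 1 = Fintype.card μ) {x : ν → ℂ} (hx : x ∈ polarLocus F c a)
    (A : Type) [CommRing A] [Algebra (MvPolynomial ν ℂ) A]
    [IsLocalization.AtPrime A (vanishingIdeal ℂ {x})] :
    IsNormalCM (A ⧸ (vanishingIdeal ℂ (polarLocus F c a)).map
      (algebraMap (MvPolynomial ν ℂ) A)) ℓ := by
  obtain ⟨hF, hJ, hrank⟩ := hx
  obtain ⟨Q, hQ⟩ := Matrix.exists_mul_eq_one_of_rank_eq hJ
  have h := isNormalCM_quotient_map_polar (A := A) hgood hF hQ hrank hcard hℓ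
  set J := Ideal.span (Set.range F) ⊔ maxMinors (polarMat F c (a.map C) X) with hJdef
  have hJle : J ≤ vanishingIdeal ℂ (polarLocus F c a) := fun f hf y hy =>
    (mem_polarLocus_iff.1 hy).1 f hf
  let g : MvPolynomial ν ℂ :=
    ((Matrix.of fun k l => pderiv l (F k) : Matrix π ν (MvPolynomial ν ℂ)) *
      (Q.map C : Matrix ν π (MvPolynomial ν ℂ)) : Matrix π π (MvPolynomial ν ℂ)).det
  have hgy : ∀ y : ν → ℂ, eval y g =
      ((Matrix.of fun k l => aeval y (pderiv l (F k)) : Matrix π ν ℂ) * Q).det := by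
    intro y
    refine (RingHom.map_det (eval y) _).trans ?_
    congr 1
    ext i j
    rw [RingHom.mapMatrix_apply]
    simp [Matrix.mul_apply]
  have hgx : eval x g ≠ 0 := by
    rw [hgy, hQ, Matrix.det_one]
    exact one_ne_zero
  have hnear : ∀ y ∈ zeroLocus ℂ J, eval y g ≠ 0 → y ∈ polarLocus F c a := by
    intro y hy hgy0
    rw [hgy] at hgy0
    refine mem_polarLocus_iff.2 ⟨hy, (Matrix.rank_le_card_height _).antisymm ?_⟩
    rw [← Matrix.rank_of_det_ne_zero hgy0]
    exact Matrix.rank_mul_le_left _ _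
  have hprime := (Ideal.Quotient.isDomain_iff_prime _).1 h.isDomain
  rw [map_vanishingIdeal_eq_map hJle hnear hgx hprime]
  exact h

end PolarLocus

section Transfer

theorem IsNormalCM.localization_atPrime {R B : Type} [CommRing R] [CommRing B] [Algebra R B] {d : ℕ}
    (h : IsNormalCM B d) (m : Ideal R) [m.IsPrime] [IsLocalization.AtPrime B m] :
    IsNormalCM (Localization.AtPrime m) d :=
  h.of_ringEquiv (IsLocalization.algEquiv m.primeCompl B (Localization.AtPrime m)).toRingEquiv

variable {ν : Type}

theorem normalAt_and_cmAt_of_isNormalCM {W : Set (ν → ℂ)} {x : ν → ℂ} (hx : x ∈ W) {d : ℕ}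
    (h : IsNormalCM (Localization.AtPrime (vanishingIdeal ℂ {x}) ⧸ (vanishingIdeal ℂ W).map
      (algebraMap (MvPolynomial ν ℂ) (Localization.AtPrime (vanishingIdeal ℂ {x})))) d) :
    NormalAt W x ∧ CMAt W x := by
  have hle : vanishingIdeal ℂ W ≤ vanishingIdeal ℂ {x} :=
    vanishingIdeal_anti_mono (Set.singleton_subset_iff.2 hx)
  have hp : (ptIdeal W x).IsPrime := isPrime_map_quotient_mk hle
  have hloc : IsLocalization.AtPrime _ (ptIdeal W x) := isLocalization_atPrime_quotient
    (A := Localization.AtPrime (vanishingIdeal ℂ {x})) (vanishingIdeal ℂ {x}) hle (hm := hp)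
  have h' := h.localization_atPrime (ptIdeal W x)
  exact ⟨⟨hp, h'.isDomain, h'.isIntegrallyClosed⟩, hp, h'.isCM⟩

theorem exists_mem_minimalPrime_le [Finite ν] {T : Set (ν → ℂ)} {P : Ideal (MvPolynomial ν ℂ)}
    (hP : P ∈ (vanishingIdeal ℂ T).minimalPrimes) : ∃ x ∈ T, P ≤ vanishingIdeal ℂ {x} := by
  have hPp : P.IsPrime := hP.1.1
  have hfin := (vanishingIdeal ℂ T).finite_minimalPrimes_of_isNoetherianRing
  obtain ⟨f, hf, hfP⟩ : ∃ f, f ∈ (hfin.toFinset.erase P).inf id ∧ f ∉ P := by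
    by_contra! hcon
    obtain ⟨P', hP', hle⟩ := (hPp.inf_le').1 (show (hfin.toFinset.erase P).inf id ≤ P from hcon)
    rw [Finset.mem_erase, Set.Finite.mem_toFinset] at hP'
    exact hP'.1 (le_antisymm hle (hP.2 hP'.2.1 hle))
  obtain ⟨x, hxT, hfx⟩ : ∃ x ∈ T, eval x f ≠ 0 := by
    by_contra! hcon
    exact hfP (hP.1.2 (show f ∈ vanishingIdeal ℂ T from hcon))
  refine ⟨x, hxT, ?_⟩
  obtain ⟨P', hP', hle⟩ := Ideal.exists_minimalPrimes_le
    (show vanishingIdeal ℂ T ≤ vanishingIdeal ℂ {x} from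
      vanishingIdeal_anti_mono (Set.singleton_subset_iff.2 hxT))
  by_cases hPP : P' = P
  · exact hPP ▸ hle
  · refine absurd (mem_vanishingIdeal_singleton.1 (hle ?_)) hfx
    have h1 : (hfin.toFinset.erase P).inf id ≤ P' :=
      Finset.inf_le (f := id) (by simpa [hPP] using hP')
    exact h1 hf

theorem isPureDim_of_isNormalCM [Finite ν] {T : Set (ν → ℂ)} {d : ℕ}
    (h : ∀ x ∈ T, IsNormalCM (Localization.AtPrime (vanishingIdeal ℂ {x}) ⧸
      (vanishingIdeal ℂ T).map
        (algebraMap (MvPolynomial ν ℂ) (Localization.AtPrime (vanishingIdeal ℂ {x})))) d) :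
    IsPureDim T d := by
  intro P hP
  obtain ⟨x, hxT, hPx⟩ := exists_mem_minimalPrime_le hP
  have hPp : P.IsPrime := hP.1.1
  let A := Localization.AtPrime (vanishingIdeal ℂ {x})
  obtain ⟨hdom, -, -, hdim⟩ := h x hxT
  have hp := (Ideal.Quotient.isDomain_iff_prime _).1 hdom
  have hdisj : Disjoint ((vanishingIdeal ℂ {x}).primeCompl : Set (MvPolynomial ν ℂ)) P :=
    Set.disjoint_left.2 fun y hy hyP => hy (hPx hyP)
  have hPA := IsLocalization.under_map_of_isPrime_disjoint (vanishingIdeal ℂ {x}).primeCompl A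
    hPp hdisj
  have hIA : (vanishingIdeal ℂ T).map (algebraMap (MvPolynomial ν ℂ) A) =
      P.map (algebraMap (MvPolynomial ν ℂ) A) := by
    refine le_antisymm (Ideal.map_mono hP.1.2) ?_
    have h1 : ((vanishingIdeal ℂ T).map (algebraMap (MvPolynomial ν ℂ) A)).comap
        (algebraMap (MvPolynomial ν ℂ) A) ≤ P :=
      (Ideal.comap_mono (Ideal.map_mono hP.1.2)).trans_eq hPA
    exact Ideal.map_le_iff_le_comap.2
      (hP.2 ⟨Ideal.comap_isPrime _ _, Ideal.le_comap_map⟩ h1)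
  rw [hIA] at hdim
  have hm := isPrime_map_quotient_mk hPx
  have hmax : ((vanishingIdeal ℂ {x}).map (Ideal.Quotient.mk P)).IsMaximal := by
    have : (vanishingIdeal ℂ {x}).IsMaximal := isMaximal_iff_eq_vanishingIdeal_singleton.2 ⟨x, rfl⟩
    exact (Ideal.map_eq_top_or_isMaximal_of_surjective _ Ideal.Quotient.mk_surjective
      this).resolve_left hm.ne_top
  have hloc := isLocalization_atPrime_quotient (A := A) (vanishingIdeal ℂ {x}) hPx
  rw [ringKrullDim_eq_height_of_isMaximal ((vanishingIdeal ℂ {x}).map (Ideal.Quotient.mk P)),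
    ← IsLocalization.AtPrime.ringKrullDim_eq_height _ (A ⧸ P.map (algebraMap _ A))]
  exact hdim

theorem vanishingIdeal_zcl (T : Set (ν → ℂ)) : vanishingIdeal ℂ (zcl T) = vanishingIdeal ℂ T :=
  le_antisymm (vanishingIdeal_anti_mono (zeroLocus_vanishingIdeal_le T))
    (le_vanishingIdeal_zeroLocus _)

end Transfer

section PolarVariety

open Matrix

theorem zcl_polarLocus_properties {π μ ν : Type} [Fintype π] [Fintype μ] [Fintype ν]
    [DecidableEq π] [DecidableEq μ] [DecidableEq ν] {F : π → MvPolynomial ν ℂ} {c : ℂ}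
    {a : Matrix μ ν ℂ}
    (hgood : ∀ z : PolarPoint π μ ν ℂ, z.a = a → ∃ i, PolarPoint.rel F c z i ≠ 0)
    (hcard : Fintype.card π + Fintype.card μ ≤ Fintype.card ν) {ℓ : ℕ}
    (hℓ : ℓ + 1 = Fintype.card μ) :
    zcl (polarLocus F c a) ⊆ {x | ∀ k, aeval x (F k) = 0} ∧
      IsPureDim (zcl (polarLocus F c a)) ℓ ∧
      ∀ x ∈ zcl (polarLocus F c a),
        (Matrix.of fun k l => aeval x (pderiv l (F k))).rank = Fintype.card π →
          NormalAt (zcl (polarLocus F c a)) x ∧ CMAt (zcl (polarLocus F c a)) x := by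
  have hle : Ideal.span (Set.range F) ⊔ maxMinors (polarMat F c (a.map C) X) ≤
      vanishingIdeal ℂ (polarLocus F c a) := fun f hf y hy => (mem_polarLocus_iff.1 hy).1 f hf
  have hCM : ∀ x ∈ polarLocus F c a, IsNormalCM (Localization.AtPrime (vanishingIdeal ℂ {x}) ⧸
      (vanishingIdeal ℂ (polarLocus F c a)).map
        (algebraMap (MvPolynomial ν ℂ) (Localization.AtPrime (vanishingIdeal ℂ {x})))) ℓ :=
    fun x hx => isNormalCM_quotient_vanishingIdeal_polarLocus hgood hcard hℓ hx _
  refine ⟨fun x hx k => hx _ (hle (Ideal.mem_sup_left (Ideal.subset_span ⟨k, rfl⟩))), ?_,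
    fun x hx hJ => normalAt_and_cmAt_of_isNormalCM (d := ℓ) hx ?_⟩
  · have h := isPureDim_of_isNormalCM hCM
    unfold IsPureDim at h ⊢
    rwa [vanishingIdeal_zcl]
  · rw [vanishingIdeal_zcl]
    exact hCM x (mem_polarLocus_iff.2 ⟨fun f hf => hx f (hle hf), hJ⟩)

variable {n p : ℕ}

theorem jacC_eq (F : Fin p → MvPolynomial (Fin n) ℚ) (x : Fin n → ℂ) :
    jacC F x = Matrix.of fun k l => aeval x (pderiv l (map (algebraMap ℚ ℂ) (F k))) := by
  ext k l
  simp [jacC, pderiv_map, aeval_map_algebraMap]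

theorem mem_zeroSetC_iff {F : Fin p → MvPolynomial (Fin n) ℚ} {x : Fin n → ℂ} :
    x ∈ zeroSetC F ↔ ∀ k, aeval x (map (algebraMap ℚ ℂ) (F k)) = 0 := by
  simp [zeroSetC, aeval_map_algebraMap]

theorem Wclassic_eq {m r : ℕ} (F : Fin p → MvPolynomial (Fin n) ℚ)
    (a : Matrix (Fin m) (Fin n) ℂ) (hr : r + 1 = p + m) :
    Wclassic F a r = zcl (polarLocus (fun k => map (algebraMap ℚ ℂ) (F k)) 0 a) := by
  unfold Wclassic
  congr 1
  ext x
  have h1 : polarMat (fun k => map (algebraMap ℚ ℂ) (F k)) 0 a x = fromRows (jacC F x) a := by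
    rw [jacC_eq, polarMat]
    congr 1
    ext k l
    simp
  rw [polarLocus, Set.mem_ofPred_eq, Set.mem_ofPred_eq, h1, SregC, Set.mem_ofPred_eq,
    mem_zeroSetC_iff, ← jacC_eq, Fintype.card_fin, Fintype.card_fin, ← hr, Nat.lt_succ_iff,
    and_assoc]

theorem Wdual_eq {m r : ℕ} (F : Fin p → MvPolynomial (Fin n) ℚ)
    (a : Matrix (Fin m) (Fin n) ℂ) (hr : r + 1 = p + m) :
    Wdual F a r = zcl (polarLocus (fun k => map (algebraMap ℚ ℂ) (F k)) 1 a) := by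
  unfold Wdual
  congr 1
  ext x
  have h1 : polarMat (fun k => map (algebraMap ℚ ℂ) (F k)) 1 a x =
      fromRows (jacC F x) (Matrix.of fun k l => a k l - x l) := by
    rw [jacC_eq, polarMat]
    congr 1
    ext k l
    simp
  rw [polarLocus, Set.mem_ofPred_eq, Set.mem_ofPred_eq, h1, SregC, Set.mem_ofPred_eq,
    mem_zeroSetC_iff, ← jacC_eq, Fintype.card_fin, Fintype.card_fin, ← hr, Nat.lt_succ_iff,
    and_assoc]

/-- The determinant of the leading maximal square block of the generic `N × n` matrix. -/
noncomputable def leadingMinor {N n : ℕ} (h : N ≤ n) : MvPolynomial (Fin N × Fin n) ℂ :=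
  (Matrix.of fun k l : Fin N => (X (k, Fin.castLE h l) : MvPolynomial (Fin N × Fin n) ℂ)).det

theorem eval_leadingMinor {N n : ℕ} (h : N ≤ n) (a : Matrix (Fin N) (Fin n) ℂ) :
    eval (fun q => a q.1 q.2) (leadingMinor h) = (a.submatrix id (Fin.castLE h)).det := by
  refine (RingHom.map_det (eval fun q : Fin N × Fin n => a q.1 q.2) _).trans ?_
  congr 1
  ext k l
  exact eval_X _

theorem leadingMinor_ne_zero {N n : ℕ} (h : N ≤ n) : leadingMinor h ≠ 0 := by
  intro h0
  have h1 := eval_leadingMinor h (Matrix.of fun k l => if l = Fin.castLE h k then 1 else 0)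
  have h2 : (Matrix.of fun (k : Fin N) (l : Fin n) =>
      if l = Fin.castLE h k then (1 : ℂ) else 0).submatrix id (Fin.castLE h) = 1 := by
    ext k l
    simp [Matrix.one_apply, eq_comm]
  rw [h0, h2, Matrix.det_one, map_zero] at h1
  exact zero_ne_one h1

theorem rank_firstRows {N n m : ℕ} (h : N ≤ n) (hm : m ≤ N) {a : Matrix (Fin N) (Fin n) ℂ}
    (ha : (a.submatrix id (Fin.castLE h)).det ≠ 0) : (firstRows a hm).rank = m := by
  have h1 : a.rank = Fintype.card (Fin N) := (Matrix.rank_le_card_height a).antisymm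
    ((Matrix.rank_of_det_ne_zero ha).symm.trans_le (Matrix.rank_submatrix_le _ _ _))
  obtain ⟨Q, hQ⟩ := Matrix.exists_mul_eq_one_of_rank_eq h1
  have h2 : firstRows a hm * Q.submatrix id (Fin.castLE hm) = 1 := by
    ext i j
    have := congrFun (congrFun hQ (Fin.castLE hm i)) (Fin.castLE hm j)
    simpa [Matrix.mul_apply, firstRows, Matrix.one_apply] using this
  refine le_antisymm (by simpa using Matrix.rank_le_card_height (firstRows a hm)) ?_
  calc m = (firstRows a hm * Q.submatrix id (Fin.castLE hm)).rank := by
        rw [h2, Matrix.rank_one, Fintype.card_fin]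
    _ ≤ _ := Matrix.rank_mul_le_left _ _

theorem eval_rename_castLE {N n m : ℕ} (hm : m ≤ N) (h : MvPolynomial (Fin m × Fin n) ℂ)
    (a : Matrix (Fin N) (Fin n) ℂ) :
    eval (fun q => a q.1 q.2) (rename (Prod.map (Fin.castLE hm) id) h) =
      eval (fun q => firstRows a hm q.1 q.2) h := by
  rw [eval_rename]
  rfl

end PolarVariety

/-- Corollary 2 of the paper. Without any smoothness assumption on `S`:
there is a nonempty Zariski open set `U` of complex `(n-p) × n` matrices such that for
every `a ∈ U` (all submatrices `a^{(i)}` having maximal rank) and every `1 ≤ i ≤ n-p`,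
the generic polar varieties `W_{K(a^{(i)})}(S)` and `W_{K̄(ā^{(i)})}(S)` are empty or
subvarieties of `S` of pure codimension `i` that are normal and Cohen–Macaulay at every
point where the Jacobian `J(F₁, …, F_p)` has maximal rank `p`. -/
theorem statement5 {n p : ℕ} (hp1 : 1 ≤ p) (hpn : p ≤ n)
    (F : Fin p → MvPolynomial (Fin n) ℚ)
    (hreg : IsRegSeq (List.ofFn F))
    (hrad : idealOfDef F)
    (hSne : (zeroSetC F).Nonempty)
    (hSdim : IsPureDim (zeroSetC F) (n - p)) :
    ∃ U : Set (Matrix (Fin (n - p)) (Fin n) ℂ),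
      U.Nonempty ∧ ZOpenMat U ∧
      ∀ a ∈ U, ∀ i, ∀ h1 : 1 ≤ i, ∀ h2 : i ≤ n - p,
        (firstRows a (by omega : n - p - i + 1 ≤ n - p)).rank = n - p - i + 1 ∧
        ∀ Wc Wd : Set (Fin n → ℂ),
          Wc = Wclassic F (firstRows a (by omega : n - p - i + 1 ≤ n - p)) (n - i) →
          Wd = Wdual F (firstRows a (by omega : n - p - i + 1 ≤ n - p)) (n - i) →
          ((Wc = ∅ ∨
            (Wc ⊆ zeroSetC F ∧ IsPureDim Wc (n - p - i) ∧
             ∀ x ∈ Wc, (jacC F x).rank = p → NormalAt Wc x ∧ CMAt Wc x)) ∧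
           (Wd = ∅ ∨
            (Wd ⊆ zeroSetC F ∧ IsPureDim Wd (n - p - i) ∧
             ∀ x ∈ Wd, (jacC F x).rank = p → NormalAt Wd x ∧ CMAt Wd x))) := by
  choose h hne hgood using fun (m : ℕ) (c : ℂ) => PolarPoint.exists_eliminant (μ := Fin m)
    (fun k => map (algebraMap ℚ ℂ) (F k)) c
  have hN : n - p ≤ n := Nat.sub_le n p
  let H : MvPolynomial (Fin (n - p) × Fin n) ℂ := leadingMinor hN * ∏ m : Fin (n - p),
    (rename (Prod.map (Fin.castLE m.2) id) (h (m + 1) 0) *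
      rename (Prod.map (Fin.castLE m.2) id) (h (m + 1) 1))
  have hH : H ≠ 0 := by
    have hinj : ∀ m : Fin (n - p), Function.Injective
        (Prod.map (Fin.castLE m.2) id : Fin (m + 1) × Fin n → Fin (n - p) × Fin n) := fun m =>
      (Fin.castLE_injective m.2).prodMap Function.injective_id
    refine mul_ne_zero (leadingMinor_ne_zero hN) (Finset.prod_ne_zero_iff.2 fun m _ => mul_ne_zero
      ?_ ?_) <;>
    exact (map_ne_zero_iff _ (rename_injective _ (hinj m))).2 (hne _ _)
  refine ⟨{a | eval (fun q => a q.1 q.2) H ≠ 0}, ?_, ⟨Ideal.span {H}, ?_⟩, ?_⟩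
  · by_contra hcon
    refine hH (MvPolynomial.funext fun w => ?_)
    by_contra hw
    rw [map_zero] at hw
    exact hcon ⟨Matrix.of fun k l => w (k, l), hw⟩
  · ext a
    constructor
    · exact fun ha => ⟨H, Ideal.mem_span_singleton_self H, ha⟩
    · rintro ⟨f, hf, hfa⟩ h0
      obtain ⟨g, rfl⟩ := Ideal.mem_span_singleton.1 hf
      rw [map_mul, h0, zero_mul] at hfa
      exact hfa rfl
  · intro a ha i hi1 hi2
    rw [Set.mem_ofPred_eq, map_mul, map_prod, eval_leadingMinor] at ha
    have hm : n - p - i + 1 ≤ n - p := by omega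
    refine ⟨rank_firstRows hN hm (left_ne_zero_of_mul ha), ?_⟩
    have ha' := Finset.prod_ne_zero_iff.1 (right_ne_zero_of_mul ha) ⟨n - p - i, hm⟩
      (Finset.mem_univ _)
    rw [map_mul, eval_rename_castLE, eval_rename_castLE] at ha'
    have hprop : ∀ c : ℂ,
        eval (fun q => firstRows a hm q.1 q.2) (h (n - p - i + 1) c) ≠ 0 → _ :=
      fun c hc => zcl_polarLocus_properties (F := fun k => map (algebraMap ℚ ℂ) (F k)) (c := c)
        (a := firstRows a hm) (ℓ := n - p - i)
        (fun z hz => by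
          by_contra! hcon
          have := hgood _ c z hcon
          rw [hz] at this
          exact hc this)
        (by simp only [Fintype.card_fin]; omega) (by simp)
    simp only [← jacC_eq, ← mem_zeroSetC_iff, Fintype.card_fin, Set.ofPred_mem_eq] at hprop
    rintro _ _ rfl rfl
    rw [Wclassic_eq _ _ (by omega), Wdual_eq _ _ (by omega)]
    exact ⟨.inr (hprop 0 (left_ne_zero_of_mul ha')), .inr (hprop 1 (right_ne_zero_of_mul ha'))⟩
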